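/- arXiv:1905.11937 — 5 statements merged into one kernel-verified Lean document; each statement's English description precedes it below -/
import Mathlib

section
/- Suppose b = 1, A_1 = I_d (Assumption (A5)), Assumption (A0) holds, and U_1 : ℝ^d → ℝ is twice continuously differentiable with U_1(θ) ≥ a_1 + a_2‖θ‖^α and ‖∇U_1(θ)‖ ≤ a_3 + a_4‖θ‖^β for some a_2 > 0, α > 0, β > 0 and a_1, a_3, a_4 ∈ ℝ. Then, with π(θ) ∝ exp(−U_1(θ)) and π_ρ = π convolved with N(0, ρ²I_d), W_1(π, π_ρ) ≤ min(ρ√d, (ρ²/2)∫_{ℝ^d}‖∇U_1(θ)‖π(θ)dθ). Moreover, if U_1 additionally satisfies (A2) and (A4) with m_1 > 0 (gradient Lipschitz and strong convexity), then the growth conditions hold and W_1(π, π_ρ) ≤ min(ρ√d, (ρ²/2)√(M_1 d)). -/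
/-!
STATEMENT 11: 1-Wasserstein bias bound, single splitting (b = 1, A₁ = I_d).
With π ∝ exp(−U₁) and π_ρ the convolution of π with N(0, ρ²I_d):
W₁(π, π_ρ) ≤ min(ρ√d, (ρ²/2)∫‖∇U₁‖dπ) under growth conditions; and under
(A2), (A4) with m₁ > 0, the growth conditions hold and W₁ ≤ min(ρ√d, (ρ²/2)√(M₁d)).
-/

open MeasureTheory
open scoped ENNReal RealInnerProductSpace

noncomputable section

abbrev EV (n : ℕ) := EuclideanSpace ℝ (Fin n)

/-- Probability measure with (unnormalized) density `f` w.r.t. the volume measure. -/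
def densMeasure {α : Type*} [MeasureSpace α] (f : α → ℝ) : Measure α :=
  (∫⁻ x, ENNReal.ofReal (f x))⁻¹ • (volume.withDensity fun x => ENNReal.ofReal (f x))

def IsCoupling {α : Type*} [MeasurableSpace α] (γ : Measure (α × α)) (μ ν : Measure α) : Prop :=
  γ.map Prod.fst = μ ∧ γ.map Prod.snd = ν

/-- Wasserstein distance of order `p` w.r.t. the metric `w`. -/
def Wp {α : Type*} [MeasurableSpace α] (p : ℝ) (w : α → α → ℝ) (μ ν : Measure α) : ℝ :=
  sInf {r | ∃ γ : Measure (α × α), IsCoupling γ μ ν ∧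
    r = (∫ x, w x.1 x.2 ^ p ∂γ) ^ (1 / p)}

/-- The target density π ∝ exp(−U₁). -/
def targetPi {n : ℕ} (U : EV n → ℝ) : Measure (EV n) :=
  densMeasure fun θ => Real.exp (-U θ)

/-- π_ρ : the convolution of π with a centered Gaussian of covariance ρ²I. -/
def targetPiRho {n : ℕ} (U : EV n → ℝ) (ρ : ℝ) : Measure (EV n) :=
  densMeasure fun θ => ∫ z : EV n, Real.exp (-U z - ‖z - θ‖ ^ 2 / (2 * ρ ^ 2))

section KR

lemma finite_kr {ι : Type*} [Fintype ι] [DecidableEq ι] (c : ι → ι → ℝ) (p q : ι → ℝ)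
    (hp : ∀ i, 0 ≤ p i) (hq : ∀ i, 0 ≤ q i) (hp1 : ∑ i, p i = 1) (hq1 : ∑ i, q i = 1) (C : ℝ)
    (h : ∀ f g : ι → ℝ, (∀ i j, g j ≤ f i + c i j) →
      ∑ j, g j * q j - ∑ i, f i * p i ≤ C) :
    ∃ γ : ι → ι → ℝ, (∀ i j, 0 ≤ γ i j) ∧ (∀ i, ∑ j, γ i j = p i) ∧ (∀ j, ∑ i, γ i j = q j) ∧
      ∑ i, ∑ j, γ i j * c i j ≤ C := by
  classical
  let L : (ι × ι → ℝ) → (ι → ℝ) × (ι → ℝ) × ℝ := fun γ =>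
    (fun i => ∑ j, γ (i, j), fun j => ∑ i, γ (i, j), ∑ i, ∑ j, γ (i, j) * c i j)
  have hL : IsLinearMap ℝ L := by
    constructor
    · intro x y
      simp only [L, Prod.mk_add_mk, Prod.mk.injEq, Pi.add_apply, Finset.sum_add_distrib, add_mul]
      exact ⟨rfl, rfl, trivial⟩
    · intro a x
      simp only [L, Prod.smul_mk, Prod.mk.injEq, Pi.smul_apply, smul_eq_mul, Finset.mul_sum,
        mul_assoc]
      refine ⟨?_, ?_, ?_⟩
      · ext i; simp [Finset.mul_sum]
      · ext i; simp [Finset.mul_sum]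
      · trivial
  have hLc : Continuous L := by
    simp only [L]; fun_prop
  let s : Set ((ι → ℝ) × (ι → ℝ) × ℝ) := L '' stdSimplex ℝ (ι × ι)
  let t : Set ((ι → ℝ) × (ι → ℝ) × ℝ) := {p} ×ˢ ({q} ×ˢ Set.Iic C)
  have hs1 : Convex ℝ s := (convex_stdSimplex ℝ (ι × ι)).is_linear_image hL
  have hs2 : IsCompact s := (isCompact_stdSimplex ℝ (ι × ι)).image hLc
  have ht1 : Convex ℝ t := (convex_singleton p).prod ((convex_singleton q).prod (convex_Iic C))
  have ht2 : IsClosed t := isClosed_singleton.prod (isClosed_singleton.prod isClosed_Iic)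
  by_cases hd : Disjoint s t
  · exfalso
    obtain ⟨F, u, v, hFs, huv, hFt⟩ := geometric_hahn_banach_compact_closed hs1 hs2 ht1 ht2 hd
    let f : ι → ℝ := fun i => F (Pi.single i 1, 0, 0)
    let g : ι → ℝ := fun j => F (0, Pi.single j 1, 0)
    let l : ℝ := F (0, 0, 1)
    have hF : ∀ a b r, F (a, b, r) = ∑ i, a i * f i + ∑ j, b j * g j + r * l := by
      intro a b r
      have e : (a, b, r) = ∑ i, a i • ((Pi.single i 1, 0, 0) : (ι → ℝ) × (ι → ℝ) × ℝ)
          + ∑ j, b j • ((0, Pi.single j 1, 0) : (ι → ℝ) × (ι → ℝ) × ℝ)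
          + r • ((0, 0, 1) : (ι → ℝ) × (ι → ℝ) × ℝ) := by
        refine Prod.ext ?_ (Prod.ext ?_ ?_)
        · ext k; simp [Prod.fst_sum, Pi.single_apply]
        · ext k; simp [Prod.fst_sum, Prod.snd_sum, Pi.single_apply]
        · simp [Prod.snd_sum]
      rw [e]; simp only [map_add, map_sum, map_smul, smul_eq_mul]
      rfl
    have h1 : ∀ i j, f i + g j + c i j * l < u := by
      intro i j
      have := hFs (L (Pi.single (i, j) 1)) ⟨_, single_mem_stdSimplex ℝ (i, j), rfl⟩
      rw [hF] at this
      have e1 : ∀ a : ι, ∑ b, (Pi.single (i, j) (1 : ℝ) : ι × ι → ℝ) (a, b) = if a = i then 1 else 0 := by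
        intro a; simp [Pi.single_apply, Prod.ext_iff, ite_and]
      have e2 : ∀ b : ι, ∑ a, (Pi.single (i, j) (1 : ℝ) : ι × ι → ℝ) (a, b) = if b = j then 1 else 0 := by
        intro a; simp [Pi.single_apply, Prod.ext_iff, ite_and]
      have e3 : ∑ a, ∑ b, (Pi.single (i, j) (1 : ℝ) : ι × ι → ℝ) (a, b) * c a b = c i j := by
        simp [Pi.single_apply, Prod.ext_iff, ite_and]
      simp only [e1, e2, e3] at this
      simpa using this
    have h2 : ∀ k : ℝ, 0 ≤ k → v < ∑ i, p i * f i + ∑ j, q j * g j + (C - k) * l := by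
      intro k hk
      rw [← hF]; apply hFt; simp [t, hk]
    have hl : l ≤ 0 := by
      by_contra hl
      push Not at hl
      have a := h2 (max 0 ((∑ i, p i * f i + ∑ j, q j * g j + C * l - v) / l)) (le_max_left _ _)
      have b := le_max_right 0 ((∑ i, p i * f i + ∑ j, q j * g j + C * l - v) / l)
      rw [div_le_iff₀ hl] at b
      nlinarith
    have h20 := h2 0 le_rfl
    rcases hl.lt_or_eq with hl | hl
    · have := h (fun i => f i / l) (fun j => (u - g j) / l) (by
        intro i j
        have := h1 i j
        rw [div_add' _ _ _ hl.ne, div_le_div_right_of_neg hl]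
        linarith)
      have e1 : ∑ j, (u - g j) / l * q j = (u - ∑ j, q j * g j) / l := by
        have : u = ∑ j, u * q j := by rw [← Finset.mul_sum, hq1, mul_one]
        conv_rhs => rw [this]
        rw [← Finset.sum_sub_distrib, Finset.sum_div]
        refine Finset.sum_congr rfl fun j _ => ?_
        ring
      have e2 : ∑ j, f j / l * p j = (∑ j, p j * f j) / l := by
        rw [Finset.sum_div]
        refine Finset.sum_congr rfl fun j _ => ?_
        ring
      rw [e1, e2, ← sub_div, div_le_iff_of_neg hl] at this
      linarith
    · have : ∑ i, p i * f i + ∑ j, q j * g j ≤ u := by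
        have : ∑ i, ∑ j, p i * q j * (f i + g j) ≤ ∑ i, ∑ j, p i * q j * u := by
          refine Finset.sum_le_sum fun i _ => Finset.sum_le_sum fun j _ => ?_
          refine mul_le_mul_of_nonneg_left ?_ (mul_nonneg (hp i) (hq j))
          have := h1 i j
          rw [hl] at this; linarith
        have e1 : ∑ i, ∑ j, p i * q j * u = u := by
          simp_rw [← Finset.sum_mul, ← Finset.mul_sum, hq1, mul_one, hp1, one_mul]
        have e2 : ∑ i, ∑ j, p i * q j * (f i + g j) = ∑ i, p i * f i + ∑ j, q j * g j := by
          simp_rw [mul_add, Finset.sum_add_distrib]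
          congr 1
          · refine Finset.sum_congr rfl fun i _ => ?_
            rw [← Finset.sum_mul, ← Finset.mul_sum, hq1, mul_one]
          · rw [Finset.sum_comm]
            refine Finset.sum_congr rfl fun i _ => ?_
            rw [← Finset.sum_mul, ← Finset.sum_mul, hp1, one_mul]
        linarith
      rw [hl] at h20
      linarith
  · rw [Set.not_disjoint_iff] at hd
    obtain ⟨x, ⟨γ, hγ, rfl⟩, hx⟩ := hd
    simp only [t, Set.mem_prod, Set.mem_singleton_iff, L, Set.mem_Iic] at hx
    exact ⟨fun i j => γ (i, j), fun i j => hγ.1 _, fun i => congrFun hx.1 i,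
      fun j => congrFun hx.2.1 j, hx.2.2⟩

end KR
section Lift
open ProbabilityTheory

lemma sum_cond_fst {d : ℕ} (μ ν : Measure (EV d)) [IsProbabilityMeasure μ] [IsProbabilityMeasure ν]
    (T : SimpleFunc (EV d) (EV d)) (γ : T.range → T.range → ℝ) (h0 : ∀ i j, 0 ≤ γ i j)
    (h1 : ∀ i, ∑ j, γ i j = μ.real (T ⁻¹' {(i : EV d)}))
    (h2 : ∀ j, ∑ i, γ i j = ν.real (T ⁻¹' {(j : EV d)})) :
    ∑ i, ∑ j, (ENNReal.ofReal (γ i j) * ν[|T ⁻¹' {(j : EV d)}] Set.univ) •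
      μ[|T ⁻¹' {(i : EV d)}] = μ := by
  have key : ∀ i j, ENNReal.ofReal (γ i j) * ν[|T ⁻¹' {(j : EV d)}] Set.univ
      = ENNReal.ofReal (γ i j) := by
    intro i j
    by_cases hj : ν (T ⁻¹' {(j : EV d)}) = 0
    · have : γ i j = 0 := by
        have e := h2 j
        rw [measureReal_def, hj, ENNReal.toReal_zero,
          Finset.sum_eq_zero_iff_of_nonneg (fun i _ => h0 i j)] at e
        exact e i (Finset.mem_univ _)
      simp [this]
    · have := cond_isProbabilityMeasure hj
      simp
  simp_rw [key]
  have key2 : ∀ i : T.range, ∑ j, ENNReal.ofReal (γ i j) • μ[|T ⁻¹' {(i : EV d)}]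
      = μ.restrict (T ⁻¹' {(i : EV d)}) := by
    intro i
    rw [← Finset.sum_smul, ← ENNReal.ofReal_sum_of_nonneg (fun j _ => h0 i j), h1,
      measureReal_def, ENNReal.ofReal_toReal (measure_ne_top _ _)]
    by_cases hi : μ (T ⁻¹' {(i : EV d)}) = 0
    · rw [hi, zero_smul]; exact (Measure.restrict_eq_zero.2 hi).symm
    · rw [ProbabilityTheory.cond, smul_smul, ENNReal.mul_inv_cancel hi (measure_ne_top _ _),
        one_smul]
  simp_rw [key2]
  ext A hA
  rw [Measure.finsetSum_apply]
  simp_rw [Measure.restrict_apply hA]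
  rw [← measure_biUnion_finset]
  · congr 1
    ext x
    simp
  · intro i _ j _ hij
    refine Set.disjoint_left.2 ?_
    rintro x ⟨-, hx⟩ ⟨-, hy⟩
    exact hij (Subtype.ext (hx.symm.trans hy))
  · intro i _
    exact hA.inter (T.measurableSet_preimage _)

lemma lift_coupling {d : ℕ} (μ ν : Measure (EV d)) [IsProbabilityMeasure μ] [IsProbabilityMeasure ν]
    (T : SimpleFunc (EV d) (EV d)) (γ : T.range → T.range → ℝ) (h0 : ∀ i j, 0 ≤ γ i j)
    (h1 : ∀ i, ∑ j, γ i j = μ.real (T ⁻¹' {(i : EV d)}))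
    (h2 : ∀ j, ∑ i, γ i j = ν.real (T ⁻¹' {(j : EV d)})) :
    ∃ Γ : Measure (EV d × EV d), IsCoupling Γ μ ν ∧
      ∫⁻ x, ‖x.1 - x.2‖ₑ ∂Γ ≤ ∫⁻ x, ‖T x - x‖ₑ ∂μ +
        ENNReal.ofReal (∑ i, ∑ j, γ i j * ‖(i : EV d) - j‖) + ∫⁻ x, ‖T x - x‖ₑ ∂ν := by
  let Γ : Measure (EV d × EV d) := ∑ i, ∑ j, ENNReal.ofReal (γ i j) •
    (μ[|T ⁻¹' {(i : EV d)}]).prod (ν[|T ⁻¹' {(j : EV d)}])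
  have hΓ : IsCoupling Γ μ ν := by
    constructor
    · conv_rhs => rw [← sum_cond_fst μ ν T γ h0 h1 h2]
      simp only [Γ]
      rw [Measure.map_finset_sum measurable_fst.aemeasurable]
      refine Finset.sum_congr rfl fun i _ => ?_
      rw [Measure.map_finset_sum measurable_fst.aemeasurable]
      refine Finset.sum_congr rfl fun j _ => ?_
      rw [Measure.map_smul, Measure.map_fst_prod, smul_smul]
    · conv_rhs => rw [← sum_cond_fst ν μ T (fun i j => γ j i) (fun i j => h0 j i) h2 h1]
      simp only [Γ]
      rw [Finset.sum_comm]
      rw [Measure.map_finset_sum measurable_snd.aemeasurable]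
      refine Finset.sum_congr rfl fun i _ => ?_
      rw [Measure.map_finset_sum measurable_snd.aemeasurable]
      refine Finset.sum_congr rfl fun j _ => ?_
      rw [Measure.map_smul, Measure.map_snd_prod, smul_smul]
  refine ⟨Γ, hΓ, ?_⟩
  have mT : Measurable T := T.measurable
  have e1 : ∫⁻ x, ‖T x - x‖ₑ ∂μ = ∫⁻ x, ‖T x.1 - x.1‖ₑ ∂Γ := by
    rw [← hΓ.1, lintegral_map (by fun_prop) measurable_fst]
  have e2 : ∫⁻ x, ‖T x - x‖ₑ ∂ν = ∫⁻ x, ‖T x.2 - x.2‖ₑ ∂Γ := by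
    rw [← hΓ.2, lintegral_map (by fun_prop) measurable_snd]
  have e3 : ∫⁻ x, ‖T x.1 - T x.2‖ₑ ∂Γ ≤ ENNReal.ofReal (∑ i, ∑ j, γ i j * ‖(i : EV d) - j‖) := by
    simp only [Γ]
    rw [lintegral_finsetSum_measure, ENNReal.ofReal_sum_of_nonneg
      (fun i _ => Finset.sum_nonneg fun j _ => mul_nonneg (h0 i j) (norm_nonneg _))]
    refine Finset.sum_le_sum fun i _ => ?_
    rw [lintegral_finsetSum_measure, ENNReal.ofReal_sum_of_nonneg
      (fun j _ => mul_nonneg (h0 i j) (norm_nonneg _))]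
    refine Finset.sum_le_sum fun j _ => ?_
    rw [lintegral_smul_measure, ENNReal.ofReal_mul (h0 i j), smul_eq_mul]
    gcongr
    rw [lintegral_prod _ (by fun_prop)]
    have a1 : ∀ᵐ x ∂μ[|T ⁻¹' {(i : EV d)}], T x = i := by
      filter_upwards [ae_cond_mem (μ := μ) (T.measurableSet_preimage {(i : EV d)})] with x hx
      exact hx
    have a2 : ∀ᵐ x ∂ν[|T ⁻¹' {(j : EV d)}], T x = j := by
      filter_upwards [ae_cond_mem (μ := ν) (T.measurableSet_preimage {(j : EV d)})] with x hx
      exact hx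
    have : ∀ᵐ x ∂μ[|T ⁻¹' {(i : EV d)}], ∫⁻ y, ‖T x - T y‖ₑ ∂ν[|T ⁻¹' {(j : EV d)}]
        ≤ ENNReal.ofReal ‖(i : EV d) - j‖ := by
      filter_upwards [a1] with x hx
      calc _ ≤ ∫⁻ y, ENNReal.ofReal ‖(i : EV d) - j‖ ∂ν[|T ⁻¹' {(j : EV d)}] := by
            refine lintegral_mono_ae ?_
            filter_upwards [a2] with y hy
            rw [hx, hy, ofReal_norm]
        _ ≤ _ := by
            rw [lintegral_const]
            exact mul_le_of_le_one_right' prob_le_one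
    calc _ ≤ ∫⁻ x, ENNReal.ofReal ‖(i : EV d) - j‖ ∂μ[|T ⁻¹' {(i : EV d)}] :=
            lintegral_mono_ae this
        _ ≤ _ := by
            rw [lintegral_const]
            exact mul_le_of_le_one_right' prob_le_one
  rw [e1, e2]
  calc ∫⁻ x, ‖x.1 - x.2‖ₑ ∂Γ ≤ ∫⁻ x, (‖T x.1 - x.1‖ₑ + ‖T x.1 - T x.2‖ₑ + ‖T x.2 - x.2‖ₑ) ∂Γ := by
        refine lintegral_mono fun x => ?_
        have : x.1 - x.2 = -(T x.1 - x.1) + (T x.1 - T x.2) + (T x.2 - x.2) := by abel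
        rw [this]
        refine (enorm_add_le _ _).trans ?_
        gcongr
        refine (enorm_add_le _ _).trans ?_
        rw [enorm_neg]
    _ = _ := by
        rw [lintegral_add_left (by fun_prop), lintegral_add_left (by fun_prop)]
    _ ≤ _ := by gcongr

/-- Kantorovich–Rubinstein, in the form needed here. -/
lemma kr_le {d : ℕ} (μ ν : Measure (EV d)) [IsProbabilityMeasure μ] [IsProbabilityMeasure ν]
    (hμ : Integrable (fun x => x) μ) (hν : Integrable (fun x => x) ν) (C : ℝ)
    (h : ∀ f : EV d → ℝ, LipschitzWith 1 f → ∫ x, f x ∂ν - ∫ x, f x ∂μ ≤ C) :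
    Wp 1 (fun x y => ‖x - y‖) μ ν ≤ C := by
  have hC : 0 ≤ C := by simpa using h (fun _ => 0) (LipschitzWith.const' 0)
  refine le_of_forall_pos_le_add fun ε hε => ?_
  have hbb : BddBelow {r | ∃ γ : Measure (EV d × EV d), IsCoupling γ μ ν ∧
    r = (∫ x, ‖x.1 - x.2‖ ^ (1 : ℝ) ∂γ) ^ (1 / (1 : ℝ))} := by
    refine ⟨0, ?_⟩
    rintro r ⟨γ, -, rfl⟩
    simp only [Real.rpow_one, div_one]
    exact integral_nonneg fun x => norm_nonneg _
  -- approximating simple function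
  obtain ⟨T, hT⟩ : ∃ T : SimpleFunc (EV d) (EV d),
      ∫⁻ x, ‖T x - x‖ₑ ∂(μ + ν) < ENNReal.ofReal (ε / 4) := by
    have hi : Integrable (fun x : EV d => x) (μ + ν) := hμ.add_measure hν
    have := SimpleFunc.tendsto_approxOn_L1_enorm (μ := μ + ν) (f := fun x : EV d => x)
      measurable_id (s := Set.univ) (y₀ := 0) (Set.mem_univ _) (by simp) (by
        simpa using hi.2)
    obtain ⟨n, hn⟩ := (this.eventually_lt_const (u := ENNReal.ofReal (ε / 4)) (by simpa using hε)).exists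
    exact ⟨_, hn⟩
  rw [lintegral_add_measure] at hT
  have hT1 : ∫⁻ x, ‖T x - x‖ₑ ∂μ ≤ ENNReal.ofReal (ε / 4) := le_self_add.trans hT.le
  have hT2 : ∫⁻ x, ‖T x - x‖ₑ ∂ν ≤ ENNReal.ofReal (ε / 4) := le_add_self.trans hT.le
  have mT : Measurable T := T.measurable
  have toR : ∀ (m : Measure (EV d)), ∫⁻ x, ‖T x - x‖ₑ ∂m ≤ ENNReal.ofReal (ε / 4) →
      ∫ x, ‖T x - x‖ ∂m ≤ ε / 4 ∧ Integrable (fun x => T x - x) m := by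
    intro m hm
    refine ⟨?_, by fun_prop, lt_of_le_of_lt hm ENNReal.ofReal_lt_top⟩
    rw [integral_norm_eq_lintegral_enorm (by fun_prop)]
    exact ENNReal.toReal_le_of_le_ofReal (by positivity) hm
  obtain ⟨R1, I1⟩ := toR μ hT1
  obtain ⟨R2, I2⟩ := toR ν hT2
  have hsum : ∀ (m : Measure (EV d)) [IsProbabilityMeasure m] (f : EV d → ℝ),
      ∑ i : T.range, f i * m.real (T ⁻¹' {(i : EV d)}) = ∫ x, f (T x) ∂m := by
    intro m _ f
    have e : ∀ x, f (T x) = ∑ i : T.range,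
        (T ⁻¹' {(i : EV d)}).indicator (fun _ => f i) x := by
      intro x
      rw [Finset.sum_eq_single (⟨T x, T.mem_range_self x⟩ : T.range)]
      · simp
      · intro j _ hj
        refine Set.indicator_of_notMem ?_ _
        intro hx
        exact hj (Subtype.ext hx.symm)
      · simp
    simp_rw [e]
    rw [integral_finsetSum]
    · refine Finset.sum_congr rfl fun i _ => ?_
      rw [integral_indicator_const _ (T.measurableSet_preimage _), smul_eq_mul, mul_comm]
    · intro i _
      exact (integrable_const _).indicator (T.measurableSet_preimage _)
  have hone : ∀ (m : Measure (EV d)) [IsProbabilityMeasure m],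
      ∑ i : T.range, m.real (T ⁻¹' {(i : EV d)}) = 1 := by
    intro m _
    simpa using hsum m (fun _ => 1)
  obtain ⟨γ, g0, g1, g2, g3⟩ := finite_kr (fun i j : T.range => ‖(i : EV d) - j‖)
    (fun i => μ.real (T ⁻¹' {(i : EV d)})) (fun i => ν.real (T ⁻¹' {(i : EV d)}))
    (fun _ => measureReal_nonneg) (fun _ => measureReal_nonneg) (hone μ) (hone ν) (C + ε / 2) (by
      intro f g hfg
      have hne : Nonempty T.range := by
        by_contra hne
        rw [not_nonempty_iff] at hne
        simpa using hone μ
      let φ : EV d → ℝ := fun y => Finset.univ.inf' Finset.univ_nonempty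
        (fun i : T.range => f i + ‖(i : EV d) - y‖)
      have φlip : LipschitzWith 1 φ := by
        refine LipschitzWith.of_le_add fun x y => ?_
        rw [← sub_le_iff_le_add]
        refine Finset.le_inf' _ _ fun i hi => ?_
        rw [sub_le_iff_le_add]
        refine (Finset.inf'_le _ hi).trans ?_
        rw [add_assoc]
        gcongr
        rw [← dist_eq_norm, ← dist_eq_norm, dist_comm x y]
        exact dist_triangle _ _ _
      have φf : ∀ i : T.range, φ i ≤ f i := fun i =>
        (Finset.inf'_le _ (Finset.mem_univ i)).trans (by simp)
      have φg : ∀ j : T.range, g j ≤ φ j := fun j =>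
        Finset.le_inf' _ _ fun i hi => hfg i j
      have s1 : ∑ j, g j * ν.real (T ⁻¹' {(j : EV d)}) ≤ ∫ x, φ (T x) ∂ν := by
        rw [← hsum]
        exact Finset.sum_le_sum fun j _ => mul_le_mul_of_nonneg_right (φg j) measureReal_nonneg
      have s2 : ∫ x, φ (T x) ∂μ ≤ ∑ j, f j * μ.real (T ⁻¹' {(j : EV d)}) := by
        rw [← hsum]
        exact Finset.sum_le_sum fun j _ => mul_le_mul_of_nonneg_right (φf j) measureReal_nonneg
      have iT : ∀ (m : Measure (EV d)) [IsProbabilityMeasure m], Integrable (fun x => φ (T x)) m :=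
        fun m _ => (T.map φ).integrable_of_isFiniteMeasure
      have φc : ∀ x, |φ (T x) - φ x| ≤ ‖T x - x‖ := by
        intro x
        have := φlip.dist_le_mul (T x) x
        rwa [NNReal.coe_one, one_mul, dist_eq_norm, dist_eq_norm] at this
      have φi : ∀ (m : Measure (EV d)) [IsProbabilityMeasure m], Integrable (fun x => T x - x) m →
          Integrable φ m := by
        intro m _ hm
        have : Integrable (fun x => φ (T x) - φ x) m :=
          hm.norm.mono' (by have := φlip.continuous; fun_prop) (.of_forall φc)
        have h3 := (iT m).sub this
        have e : ((fun x => φ (T x)) - fun x => φ (T x) - φ x) = φ := by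
          ext x; simp
        rwa [e] at h3
      have d1 : ∫ x, φ (T x) ∂ν - ∫ x, φ x ∂ν ≤ ε / 4 := by
        rw [← integral_sub (iT ν) (φi ν I2)]
        refine (integral_mono ((iT ν).sub (φi ν I2)) I2.norm fun x => ?_).trans R2
        exact (le_abs_self _).trans (φc x)
      have d2 : ∫ x, φ x ∂μ - ∫ x, φ (T x) ∂μ ≤ ε / 4 := by
        rw [← integral_sub (φi μ I1) (iT μ)]
        refine (integral_mono ((φi μ I1).sub (iT μ)) I1.norm fun x => ?_).trans R1
        exact (neg_le_abs _).trans' (by simp) |>.trans (φc x)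
      have := h φ φlip
      linarith)
  obtain ⟨Γ, hΓ, hc⟩ := lift_coupling μ ν T γ g0 g1 g2
  have hfin : ∫⁻ x, ‖x.1 - x.2‖ₑ ∂Γ ≤ ENNReal.ofReal (C + ε) := by
    refine hc.trans ?_
    calc _ ≤ ENNReal.ofReal (ε / 4) + ENNReal.ofReal (C + ε / 2) + ENNReal.ofReal (ε / 4) := by
          gcongr
      _ = _ := by
          rw [← ENNReal.ofReal_add (by positivity) (by positivity),
            ← ENNReal.ofReal_add (by positivity) (by positivity)]
          congr 1; ring
  refine (csInf_le hbb ⟨Γ, hΓ, rfl⟩).trans ?_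
  simp only [Real.rpow_one, div_one]
  rw [integral_norm_eq_lintegral_enorm (by fun_prop)]
  exact ENNReal.toReal_le_of_le_ofReal (by positivity) hfin

end Lift
section Dens

variable {α : Type*} [MeasureSpace α]

lemma dens_mass {f : α → ℝ} (hf : ∀ x, 0 < f x) (hi : Integrable f)
    (hv : (volume : Measure α) ≠ 0) :
    (∫⁻ x, ENNReal.ofReal (f x)) ≠ 0 ∧ (∫⁻ x, ENNReal.ofReal (f x)) ≠ ∞ := by
  constructor
  · rw [← ofReal_integral_eq_lintegral_ofReal hi (.of_forall fun x => (hf x).le)]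
    have : 0 < ∫ x, f x := by
      rw [integral_pos_iff_support_of_nonneg (fun x => (hf x).le) hi]
      have : Function.support f = Set.univ := by
        ext x; simp [(hf x).ne']
      rw [this]
      simpa [pos_iff_ne_zero] using hv
    simpa using this
  · exact hi.lintegral_lt_top.ne

lemma dens_prob {f : α → ℝ} (hf : ∀ x, 0 < f x) (hi : Integrable f)
    (hv : (volume : Measure α) ≠ 0) : IsProbabilityMeasure (densMeasure f) := by
  obtain ⟨h1, h2⟩ := dens_mass hf hi hv
  constructor
  rw [densMeasure, Measure.smul_apply, withDensity_apply _ MeasurableSet.univ,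
    Measure.restrict_univ, smul_eq_mul, ENNReal.inv_mul_cancel h1 h2]

lemma dens_integral {f : α → ℝ} (hf : ∀ x, 0 < f x) (hi : Integrable f) (F : α → ℝ) :
    ∫ x, F x ∂(densMeasure f) = (∫ x, f x)⁻¹ * ∫ x, F x * f x := by
  rw [densMeasure, integral_smul_measure,
    ← ofReal_integral_eq_lintegral_ofReal hi (.of_forall fun x => (hf x).le),
    integral_withDensity_eq_integral_toReal_smul₀ hi.aemeasurable.ennreal_ofReal (by simp)]
  rw [ENNReal.toReal_inv, ENNReal.toReal_ofReal (integral_nonneg fun x => (hf x).le), smul_eq_mul]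
  congr 1
  refine integral_congr_ae (.of_forall fun x => ?_)
  simp only [ENNReal.toReal_ofReal (hf x).le, smul_eq_mul, mul_comm]

lemma dens_integrable {f : α → ℝ} (hf : ∀ x, 0 < f x) (hi : Integrable f)
    (hv : (volume : Measure α) ≠ 0) (F : α → ℝ) :
    Integrable F (densMeasure f) ↔ Integrable (fun x => F x * f x) := by
  obtain ⟨h1, h2⟩ := dens_mass hf hi hv
  rw [densMeasure, integrable_smul_measure (by simpa using h2) (by simpa using h1),
    integrable_withDensity_iff_integrable_smul₀' hi.aemeasurable.ennreal_ofReal (by simp)]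
  refine integrable_congr (.of_forall fun x => ?_)
  simp only [ENNReal.toReal_ofReal (hf x).le, smul_eq_mul, mul_comm]

lemma dens_of_smul [Inhabited α] {f : α → ℝ} (ν : Measure α) [IsProbabilityMeasure ν] (c : ℝ≥0∞) (h1 : c ≠ 0)
    (h2 : c ≠ ∞) (h : volume.withDensity (fun x => ENNReal.ofReal (f x)) = c • ν) :
    densMeasure f = ν := by
  have : ∫⁻ x, ENNReal.ofReal (f x) = c := by
    have := congrArg (fun m => m Set.univ) h
    simpa [withDensity_apply _ MeasurableSet.univ] using this
  rw [densMeasure, this, h, smul_smul, ENNReal.inv_mul_cancel h1 h2, one_smul]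

lemma dens_ac {f : α → ℝ} : densMeasure f ≪ volume := by
  rw [densMeasure]
  exact (withDensity_absolutelyContinuous _ _).smul_left _

lemma dens_prod {β : Type*} [MeasureSpace β] [SFinite (volume : Measure α)]
    [SFinite (volume : Measure β)]
    {f : α → ℝ} {g : β → ℝ} (hf : ∀ x, 0 < f x) (hg : ∀ x, 0 < g x) (hfi : Integrable f)
    (hgi : Integrable g) (hv : (volume : Measure α) ≠ 0) (hw : (volume : Measure β) ≠ 0) :
    (densMeasure f).prod (densMeasure g) = densMeasure (fun x : α × β => f x.1 * g x.2) := by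
  obtain ⟨h1, h2⟩ := dens_mass hf hfi hv
  obtain ⟨h3, h4⟩ := dens_mass hg hgi hw
  have e : ∀ x : α × β, ENNReal.ofReal (f x.1 * g x.2) =
      ENNReal.ofReal (f x.1) * ENNReal.ofReal (g x.2) := fun x => ENNReal.ofReal_mul (hf _).le
  simp only [densMeasure, e]
  rw [Measure.prod_smul_left, Measure.prod_smul_right, smul_smul,
    prod_withDensity₀ hfi.aemeasurable.ennreal_ofReal hgi.aemeasurable.ennreal_ofReal]
  congr 1
  change _ = (∫⁻ x : α × β, _ ∂(volume.prod volume))⁻¹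
  rw [lintegral_prod_mul hfi.aemeasurable.ennreal_ofReal hgi.aemeasurable.ennreal_ofReal,
    ENNReal.mul_inv (Or.inl h1) (Or.inl h2)]

end Dens

section Stein

lemma vol_ne {E : Type*} [NormedAddCommGroup E] [MeasureSpace E]
    [(volume : Measure E).IsAddHaarMeasure] : (volume : Measure E) ≠ 0 := NeZero.ne _

variable {E : Type*} [NormedAddCommGroup E] [NormedSpace ℝ E] [FiniteDimensional ℝ E]
  [MeasureSpace E] [BorelSpace E] [(volume : Measure E).IsAddHaarMeasure]

lemma stein (V V' H H' : E → ℝ) (v : E) (hi : Integrable fun x => Real.exp (-V x))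
    (hV : ∀ x, HasLineDerivAt ℝ V (V' x) x v) (hH : ∀ x, HasLineDerivAt ℝ H (H' x) x v)
    (i1 : Integrable H (densMeasure fun x => Real.exp (-V x)))
    (i2 : Integrable H' (densMeasure fun x => Real.exp (-V x)))
    (i3 : Integrable (fun x => H x * V' x) (densMeasure fun x => Real.exp (-V x))) :
    ∫ x, H' x ∂(densMeasure fun x => Real.exp (-V x)) =
      ∫ x, H x * V' x ∂(densMeasure fun x => Real.exp (-V x)) := by
  have hp : ∀ x, 0 < Real.exp (-V x) := fun x => Real.exp_pos _
  rw [dens_integrable hp hi vol_ne] at i1 i2 i3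
  rw [dens_integral hp hi, dens_integral hp hi]
  congr 1
  have i3' : Integrable (fun x => H x * (-V' x * Real.exp (-V x))) :=
    i3.neg.congr (.of_forall fun x => by simp only [Pi.neg_apply]; ring)
  have := integral_bilinear_hasLineDerivAt_right_eq_neg_left_of_integrable (μ := volume)
    (f := H) (f' := H') (g := fun x => Real.exp (-V x)) (g' := fun x => -V' x * Real.exp (-V x))
    (v := v) (B := ContinuousLinearMap.mul ℝ ℝ) i2 i3' i1 (fun x _ => hH x) (fun x _ => by
      have := (hV x).neg.exp
      simpa [mul_comm] using! this)
  simp only [ContinuousLinearMap.mul_apply'] at this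
  rw [eq_neg_iff_add_eq_zero, add_comm, ← eq_neg_iff_add_eq_zero] at this
  rw [this, ← integral_neg]
  congr 1; ext x; ring

end Stein
section Moments

lemma poly_exp_bound (a α p : ℝ) (ha : 0 < a) (hα : 0 < α) (hp : 0 ≤ p) :
    ∃ C : ℝ, ∀ r : ℝ, 0 ≤ r → (1 + r) ^ p * Real.exp (-(a * r ^ α)) ≤ C := by
  obtain ⟨n, hn⟩ := exists_nat_ge (p / α)
  rw [div_le_iff₀ hα] at hn
  refine ⟨2 ^ p * (1 + n.factorial / a ^ n), fun r hr => ?_⟩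
  have h2 : (0 : ℝ) < 2 ^ p := by positivity
  have hra : 0 ≤ r ^ α := by positivity
  have hf : (0 : ℝ) < n.factorial := by exact_mod_cast n.factorial_pos
  rcases le_total r 1 with h | h
  · calc (1 + r) ^ p * Real.exp (-(a * r ^ α)) ≤ 2 ^ p * 1 := by
          gcongr
          · linarith
          · exact Real.exp_le_one_iff.2 (by nlinarith)
      _ ≤ _ := by
          gcongr
          have : 0 ≤ n.factorial / a ^ n := by positivity
          linarith
  · have e1 : (1 + r) ^ p ≤ 2 ^ p * (r ^ α) ^ n := by
      calc (1 + r) ^ p ≤ (2 * r) ^ p := by gcongr; linarith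
        _ = 2 ^ p * r ^ p := Real.mul_rpow (by norm_num) hr
        _ ≤ 2 ^ p * r ^ (α * n) := by
            gcongr
            · linarith
        _ = _ := by rw [Real.rpow_mul hr, Real.rpow_natCast]
    have e2 := Real.pow_div_factorial_le_exp (x := a * r ^ α) (by positivity) n
    rw [Real.exp_neg, ← div_eq_mul_inv, div_le_iff₀ (Real.exp_pos _)]
    rw [mul_pow, div_le_iff₀ hf] at e2
    have e3 : (r ^ α) ^ n ≤ (n.factorial / a ^ n) * Real.exp (a * r ^ α) := by
      rw [div_mul_eq_mul_div, le_div_iff₀ (by positivity)]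
      linarith
    calc (1 + r) ^ p ≤ 2 ^ p * ((n.factorial / a ^ n) * Real.exp (a * r ^ α)) := by
          refine e1.trans ?_; gcongr
      _ ≤ 2 ^ p * ((1 + n.factorial / a ^ n) * Real.exp (a * r ^ α)) := by
          gcongr; linarith
      _ = _ := by ring

lemma integrable_poly {d : ℕ} (U : EV d → ℝ) (hU : Continuous U) (a₁ a₂ α q : ℝ) (ha : 0 < a₂)
    (hα : 0 < α) (hq : 0 ≤ q) (h : ∀ θ : EV d, a₁ + a₂ * ‖θ‖ ^ α ≤ U θ) :
    Integrable (fun θ : EV d => (1 + ‖θ‖) ^ q * Real.exp (-U θ)) := by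
  obtain ⟨C, hC⟩ := poly_exp_bound a₂ α (q + (d + 1)) ha hα (by positivity)
  have hi : Integrable (fun θ : EV d => (1 + ‖θ‖) ^ (-((d : ℝ) + 1))) :=
    integrable_one_add_norm (by simp)
  refine (hi.const_mul (Real.exp (-a₁) * C)).mono' ?_ (.of_forall fun θ => ?_)
  · refine Continuous.aestronglyMeasurable ?_
    refine Continuous.mul ?_ (by fun_prop)
    exact Continuous.rpow_const (by fun_prop) (fun x => Or.inr hq)
  · have h1 : 0 < 1 + ‖θ‖ := by positivity
    rw [Real.norm_of_nonneg (by positivity)]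
    have e1 := hC ‖θ‖ (norm_nonneg _)
    rw [Real.rpow_add h1] at e1
    rw [Real.rpow_neg h1.le, ← div_eq_mul_inv, le_div_iff₀ (by positivity)]
    calc (1 + ‖θ‖) ^ q * Real.exp (-U θ) * (1 + ‖θ‖) ^ ((d : ℝ) + 1)
        ≤ (1 + ‖θ‖) ^ q * (Real.exp (-a₁) * Real.exp (-(a₂ * ‖θ‖ ^ α)))
          * (1 + ‖θ‖) ^ ((d : ℝ) + 1) := by
          rw [← Real.exp_add]
          gcongr
          linarith [h θ]
      _ = Real.exp (-a₁) * ((1 + ‖θ‖) ^ q * (1 + ‖θ‖) ^ ((d : ℝ) + 1)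
          * Real.exp (-(a₂ * ‖θ‖ ^ α))) := by ring
      _ ≤ _ := by gcongr

/-- All polynomially bounded functions are integrable for `targetPi U`. -/
lemma target_integrable {d : ℕ} (U : EV d → ℝ) (hU : Continuous U) (a₁ a₂ α : ℝ) (ha : 0 < a₂)
    (hα : 0 < α) (h : ∀ θ : EV d, a₁ + a₂ * ‖θ‖ ^ α ≤ U θ)
    (hint : Integrable fun θ : EV d => Real.exp (-U θ)) (F : EV d → ℝ) (hF : Continuous F)
    (c q : ℝ) (hq : 0 ≤ q) (hb : ∀ θ, |F θ| ≤ c * (1 + ‖θ‖) ^ q) :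
    Integrable F (targetPi U) := by
  have : Integrable (fun θ : EV d => (1 + ‖θ‖) ^ q) (targetPi U) := by
    rw [targetPi, dens_integrable (fun x => Real.exp_pos _) hint vol_ne]
    exact integrable_poly U hU a₁ a₂ α q ha hα hq h
  exact (this.const_mul c).mono' hF.aestronglyMeasurable (.of_forall hb)

/-- Standard Gaussian potential. -/
def gK {d : ℕ} (z : EV d) : ℝ := ‖z‖ ^ 2 / 2

lemma gK_cont {d : ℕ} : Continuous (gK (d := d)) := by unfold gK; fun_prop

lemma gK_growth {d : ℕ} (θ : EV d) : 0 + 1 / 2 * ‖θ‖ ^ (2 : ℝ) ≤ gK θ := by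
  rw [gK, Real.rpow_two]; linarith

lemma gK_int {d : ℕ} : Integrable fun θ : EV d => Real.exp (-gK θ) := by
  simpa using integrable_poly gK gK_cont 0 (1 / 2) 2 0 (by norm_num) (by norm_num) le_rfl
    (gK_growth (d := d))

instance gK_prob {d : ℕ} : IsProbabilityMeasure (targetPi (gK (d := d))) :=
  dens_prob (fun _ => Real.exp_pos _) gK_int vol_ne

lemma rho_eq {d : ℕ} (U : EV d → ℝ) (hU : Continuous U) (ρ : ℝ) (hρ : 0 < ρ)
    (hint : Integrable fun θ : EV d => Real.exp (-U θ)) :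
    targetPiRho U ρ = ((targetPi U).prod (targetPi gK)).map (fun x => x.1 + ρ • x.2) := by
  have p1 : IsProbabilityMeasure (targetPi U) :=
    dens_prob (fun _ => Real.exp_pos _) hint vol_ne
  have mm : Measurable (fun x : EV d × EV d => x.1 + ρ • x.2) := by fun_prop
  have p2 : IsProbabilityMeasure
      (((targetPi U).prod (targetPi gK)).map (fun x : EV d × EV d => x.1 + ρ • x.2)) :=
    Measure.isProbabilityMeasure_map mm.aemeasurable
  obtain ⟨u1, u2⟩ := dens_mass (fun x => Real.exp_pos (-U x)) hint vol_ne
  obtain ⟨k1, k2⟩ := dens_mass (fun x : EV d => Real.exp_pos (-gK x)) gK_int vol_ne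
  set A := ∫⁻ x, ENNReal.ofReal (Real.exp (-U x)) with hA
  set B := ∫⁻ x : EV d, ENNReal.ofReal (Real.exp (-gK x)) with hB
  set R : ℝ≥0∞ := ENNReal.ofReal |(ρ ^ d)⁻¹| with hR
  have R0 : R ≠ 0 := by simp only [hR, ne_eq, ENNReal.ofReal_eq_zero, not_le]; positivity
  have Rt : R ≠ ∞ := ENNReal.ofReal_ne_top
  refine dens_of_smul _ (R⁻¹ * A * B)
    (by simp [R0, Rt, u1, k1]) (by
      refine ENNReal.mul_ne_top (ENNReal.mul_ne_top ?_ u2) k2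
      simpa using R0) ?_
  refine Measure.ext_of_lintegral _ fun φ hφ => ?_
  have mU : Measurable U := hU.measurable
  have mK : Measurable (gK (d := d)) := gK_cont.measurable
  -- right side
  have r1 : ∫⁻ y, φ y ∂(((targetPi U).prod (targetPi gK)).map (fun x : EV d × EV d => x.1 + ρ • x.2))
      = A⁻¹ * B⁻¹ * ∫⁻ θ, ENNReal.ofReal (Real.exp (-U θ)) *
        ∫⁻ z, ENNReal.ofReal (Real.exp (-gK z)) * φ (θ + ρ • z) := by
    rw [lintegral_map hφ mm, lintegral_prod _ (by fun_prop)]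
    simp only [targetPi, densMeasure, lintegral_smul_measure, smul_eq_mul]
    rw [lintegral_withDensity_eq_lintegral_mul _ (by fun_prop) (by fun_prop)]
    simp only [Pi.mul_apply]
    rw [mul_assoc, ← lintegral_const_mul' B⁻¹ _ (by simpa using k1)]
    congr 1
    refine lintegral_congr fun θ => ?_
    rw [lintegral_withDensity_eq_lintegral_mul _ (by fun_prop) (by fun_prop)]
    simp only [Pi.mul_apply]
    ring
  have r2 : ∀ θ, ∫⁻ z, ENNReal.ofReal (Real.exp (-gK z)) * φ (θ + ρ • z)
      = R * ∫⁻ y, ENNReal.ofReal (Real.exp (-‖θ - y‖ ^ 2 / (2 * ρ ^ 2))) * φ y := by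
    intro θ
    have e := Measure.map_addHaar_smul (volume : Measure (EV d)) hρ.ne'
    rw [finrank_euclideanSpace_fin] at e
    let G : EV d → ℝ≥0∞ := fun y => ENNReal.ofReal (Real.exp (-‖θ - y‖ ^ 2 / (2 * ρ ^ 2))) * φ y
    have mG : Measurable G := by simp only [G]; fun_prop
    calc _ = ∫⁻ z, G (θ + ρ • z) := by
          refine lintegral_congr fun z => ?_
          simp only [G, gK]
          congr 3
          rw [sub_add_cancel_left, norm_neg, norm_smul, Real.norm_of_nonneg hρ.le]
          field_simp
      _ = ∫⁻ w, G (θ + w) ∂(Measure.map (ρ • ·) volume) := by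
          rw [lintegral_map (by fun_prop) (by fun_prop)]
      _ = R * ∫⁻ w, G (θ + w) := by rw [e, lintegral_smul_measure, smul_eq_mul]
      _ = R * ∫⁻ w, G w := by rw [lintegral_add_left_eq_self]
  simp_rw [r2] at r1
  -- left side
  have l0 : ∀ θ, ENNReal.ofReal (∫ z : EV d, Real.exp (-U z - ‖z - θ‖ ^ 2 / (2 * ρ ^ 2)))
      = ∫⁻ z, ENNReal.ofReal (Real.exp (-U z)) *
        ENNReal.ofReal (Real.exp (-‖z - θ‖ ^ 2 / (2 * ρ ^ 2))) := by
    intro θ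
    rw [ofReal_integral_eq_lintegral_ofReal]
    · refine lintegral_congr fun z => ?_
      rw [← ENNReal.ofReal_mul (Real.exp_pos _).le, ← Real.exp_add]
      congr 2; ring
    · refine hint.mono' (by fun_prop) (.of_forall fun z => ?_)
      rw [Real.norm_of_nonneg (Real.exp_pos _).le]
      gcongr
      have : 0 ≤ ‖z - θ‖ ^ 2 / (2 * ρ ^ 2) := by positivity
      linarith
    · exact .of_forall fun z => (Real.exp_pos _).le
  have l1 : ∫⁻ y, φ y ∂(volume.withDensity fun θ => ENNReal.ofReal
      (∫ z : EV d, Real.exp (-U z - ‖z - θ‖ ^ 2 / (2 * ρ ^ 2))))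
      = ∫⁻ θ, ENNReal.ofReal (Real.exp (-U θ)) *
        ∫⁻ y, ENNReal.ofReal (Real.exp (-‖θ - y‖ ^ 2 / (2 * ρ ^ 2))) * φ y := by
    simp_rw [l0]
    rw [lintegral_withDensity_eq_lintegral_mul _ (Measurable.lintegral_prod_right' (f := fun x : EV d × EV d => ENNReal.ofReal (Real.exp (-U x.2)) *
        ENNReal.ofReal (Real.exp (-‖x.2 - x.1‖ ^ 2 / (2 * ρ ^ 2)))) (by fun_prop)) hφ]
    simp only [Pi.mul_apply]
    calc _ = ∫⁻ y, ∫⁻ θ, ENNReal.ofReal (Real.exp (-U θ)) *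
          (ENNReal.ofReal (Real.exp (-‖θ - y‖ ^ 2 / (2 * ρ ^ 2))) * φ y) := by
          refine lintegral_congr fun y => ?_
          rw [← lintegral_mul_const _ (by fun_prop)]
          simp_rw [mul_assoc]
      _ = _ := by
          rw [lintegral_lintegral_swap (by fun_prop)]
          refine lintegral_congr fun θ => ?_
          rw [lintegral_const_mul _ (by fun_prop)]
  rw [l1, lintegral_smul_measure, r1, smul_eq_mul]
  set I := ∫⁻ θ, ENNReal.ofReal (Real.exp (-U θ)) *
        ∫⁻ y, ENNReal.ofReal (Real.exp (-‖θ - y‖ ^ 2 / (2 * ρ ^ 2))) * φ y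
  have : ∫⁻ θ, ENNReal.ofReal (Real.exp (-U θ)) *
        (R * ∫⁻ y, ENNReal.ofReal (Real.exp (-‖θ - y‖ ^ 2 / (2 * ρ ^ 2))) * φ y) = R * I := by
    rw [← lintegral_const_mul' _ _ Rt]
    refine lintegral_congr fun θ => by ring
  rw [this]
  calc I = (R⁻¹ * R) * (A * A⁻¹) * (B * B⁻¹) * I := by
        rw [ENNReal.inv_mul_cancel R0 Rt, ENNReal.mul_inv_cancel u1 u2,
          ENNReal.mul_inv_cancel k1 k2]; simp
    _ = _ := by ring

end Moments
section Grad

variable {d : ℕ}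

lemma grad_contDiff {U : EV d → ℝ} (hU : ContDiff ℝ 2 U) : ContDiff ℝ 1 (gradient U) := by
  have h1 : ContDiff ℝ 1 (fderiv ℝ U) := hU.fderiv_right (by norm_num)
  exact (InnerProductSpace.toDual ℝ (EV d)).symm.contDiff.comp h1

lemma grad_apply (U : EV d → ℝ) (θ : EV d) (i : Fin d) :
    gradient U θ i = fderiv ℝ U θ (EuclideanSpace.single i 1) := by
  rw [← inner_gradient_left, EuclideanSpace.inner_single_right]; simp

lemma grad_norm_bound {U : EV d → ℝ} (hU : ContDiff ℝ 2 U)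
    (hint : Integrable fun θ : EV d => Real.exp (-U θ)) (M : ℝ)
    (hM : ∀ θ v : EV d, |⟪v, fderiv ℝ (gradient U) θ v⟫| ≤ M * ‖v‖ ^ 2)
    (i1 : Integrable (fun θ => ‖gradient U θ‖) (targetPi U))
    (i2 : Integrable (fun θ => ‖gradient U θ‖ ^ 2) (targetPi U)) :
    ∫ θ, ‖gradient U θ‖ ∂(targetPi U) ≤ Real.sqrt (M * d) := by
  have p1 : IsProbabilityMeasure (targetPi U) :=
    dens_prob (fun _ => Real.exp_pos _) hint vol_ne
  have hg := grad_contDiff hU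
  have hgc : Continuous (gradient U) := hg.continuous
  have hgd : Differentiable ℝ (gradient U) := hg.differentiable (by norm_num)
  have hUd : Differentiable ℝ U := hU.differentiable (by norm_num)
  have cle : ∀ θ i, |gradient U θ i| ≤ ‖gradient U θ‖ := fun θ i => by
    rw [← Real.norm_eq_abs]; exact PiLp.norm_apply_le _ i
  have ci : ∀ i, Continuous fun θ => gradient U θ i := fun i => by fun_prop
  have hesc : Continuous (fderiv ℝ (gradient U)) := hg.continuous_fderiv (by norm_num)
  have bd : ∀ (i : Fin d) θ, |⟪EuclideanSpace.single i (1 : ℝ), fderiv ℝ (gradient U) θ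
      (EuclideanSpace.single i 1)⟫| ≤ M := by
    intro i θ
    simpa using hM θ (EuclideanSpace.single i 1)
  have hi : ∀ i : Fin d, Integrable (fun θ => ⟪EuclideanSpace.single i (1 : ℝ),
      fderiv ℝ (gradient U) θ (EuclideanSpace.single i 1)⟫) (targetPi U) := by
    intro i
    refine (integrable_const M).mono' ?_ (.of_forall (bd i))
    exact Continuous.aestronglyMeasurable (by fun_prop)
  have hsq : ∀ i : Fin d, Integrable (fun θ => gradient U θ i * gradient U θ i) (targetPi U) := by
    intro i
    refine i2.mono' (by have := ci i; fun_prop) (.of_forall fun θ => ?_)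
    rw [Real.norm_eq_abs, abs_mul, pow_two]
    gcongr <;> exact cle θ i
  have key : ∀ i : Fin d, ∫ θ, gradient U θ i * gradient U θ i ∂(targetPi U) ≤ M := by
    intro i
    have := stein U (fun θ => gradient U θ i) (fun θ => gradient U θ i)
      (fun θ => ⟪EuclideanSpace.single i (1 : ℝ),
        fderiv ℝ (gradient U) θ (EuclideanSpace.single i 1)⟫) (EuclideanSpace.single i 1) hint
      (fun θ => by
        rw [grad_apply]
        exact (hUd θ).hasFDerivAt.hasLineDerivAt _)
      (fun θ => by
        have h1 := ((EuclideanSpace.proj (𝕜 := ℝ) i : EV d →L[ℝ] ℝ).hasFDerivAt (x := gradient U θ)).comp θ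
          (hgd θ).hasFDerivAt
        have h2 := h1.hasLineDerivAt (EuclideanSpace.single i 1)
        rw [EuclideanSpace.inner_single_left]
        simpa using! h2)
      (i1.mono' (ci i).aestronglyMeasurable (.of_forall fun θ => cle θ i)) (hi i) (hsq i)
    change ∫ θ, gradient U θ i * gradient U θ i ∂(densMeasure fun x => Real.exp (-U x)) ≤ M
    rw [← this]
    calc _ ≤ ∫ θ, M ∂(targetPi U) := integral_mono (hi i) (integrable_const M)
          fun θ => (le_abs_self _).trans (bd i θ)
      _ = M := by simp
  have tot : ∫ θ, ‖gradient U θ‖ ^ 2 ∂(targetPi U) ≤ M * d := by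
    have : ∀ θ, ‖gradient U θ‖ ^ 2 = ∑ i, gradient U θ i * gradient U θ i := by
      intro θ
      rw [EuclideanSpace.norm_sq_eq]
      refine Finset.sum_congr rfl fun i _ => ?_
      rw [Real.norm_eq_abs, sq_abs, pow_two]
    simp_rw [this]
    rw [integral_finsetSum _ (fun i _ => hsq i)]
    refine (Finset.sum_le_sum fun i _ => key i).trans ?_
    simp [mul_comm]
  refine Real.le_sqrt_of_sq_le (le_trans ?_ tot)
  set m := ∫ θ, ‖gradient U θ‖ ∂(targetPi U) with hm
  have h0 : 0 ≤ ∫ θ, (‖gradient U θ‖ - m) ^ 2 ∂(targetPi U) :=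
    integral_nonneg fun θ => sq_nonneg _
  have : ∫ θ, (‖gradient U θ‖ - m) ^ 2 ∂(targetPi U) =
      ∫ θ, ‖gradient U θ‖ ^ 2 ∂(targetPi U) - m ^ 2 := by
    have e : ∀ θ, (‖gradient U θ‖ - m) ^ 2 = ‖gradient U θ‖ ^ 2 - 2 * m * ‖gradient U θ‖ + m ^ 2 := by
      intro θ; ring
    simp_rw [e]
    have h4 : Integrable (fun θ => ‖gradient U θ‖ ^ 2 - 2 * m * ‖gradient U θ‖) (targetPi U) :=
      i2.sub (i1.const_mul _)
    rw [integral_add h4 (integrable_const _),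
      integral_sub i2 (i1.const_mul _), integral_const_mul, ← hm]
    simp; ring
  linarith

lemma gK_grad : gradient (gK (d := d)) = fun z => z := by
  refine gradient_eq fun z => ?_
  rw [hasGradientAt_iff_hasFDerivAt]
  have h := (hasStrictFDerivAt_norm_sq z).hasFDerivAt.mul_const (2 : ℝ)⁻¹
  refine (h.congr_fderiv ?_)
  ext v
  simp [InnerProductSpace.toDual_apply_apply]

lemma gK_contDiff : ContDiff ℝ 2 (gK (d := d)) := by
  unfold gK
  exact (contDiff_norm_sq ℝ).div_const _

lemma gK_norm_integrable (q : ℕ) : Integrable (fun z : EV d => ‖z‖ ^ q) (targetPi gK) := by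
  refine target_integrable gK gK_cont 0 (1 / 2) 2 (by norm_num) (by norm_num) gK_growth gK_int _
    (by fun_prop) 1 q (by positivity) fun θ => ?_
  rw [Real.rpow_natCast, one_mul, abs_of_nonneg (by positivity)]
  gcongr; linarith

lemma gK_norm_le : ∫ z : EV d, ‖z‖ ∂(targetPi gK) ≤ Real.sqrt d := by
  have := grad_norm_bound (gK_contDiff (d := d)) gK_int 1 (by
    intro θ v
    rw [gK_grad]
    simp [real_inner_self_eq_norm_sq]) (by
      simpa [gK_grad] using gK_norm_integrable (d := d) 1) (by
      simpa [gK_grad] using gK_norm_integrable (d := d) 2)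
  simpa [gK_grad] using this

end Grad

section Heat

variable {d : ℕ}

lemma heat_deriv {U : EV d → ℝ} (hU : ContDiff ℝ 2 U)
    (hint : Integrable fun θ : EV d => Real.exp (-U θ))
    (i0 : Integrable (fun θ => ‖θ‖) (targetPi U))
    (i1 : Integrable (fun θ => ‖gradient U θ‖) (targetPi U))
    (f : EV d → ℝ) (hf : LipschitzWith 1 f) (s : ℝ) (hs : 0 ≤ s) :
    ∃ g' : ℝ, HasDerivAt (fun s : ℝ => ∫ x : EV d × EV d, f (x.1 + s • x.2)
        ∂((targetPi U).prod (targetPi gK))) g' s ∧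
      g' ≤ s * ∫ θ, ‖gradient U θ‖ ∂(targetPi U) := by
  have p1 : IsProbabilityMeasure (targetPi U) :=
    dens_prob (fun _ => Real.exp_pos _) hint vol_ne
  set J := (targetPi U).prod (targetPi (gK (d := d))) with hJ
  have hUd : Differentiable ℝ U := hU.differentiable (by norm_num)
  have hKd : Differentiable ℝ (gK (d := d)) := gK_contDiff.differentiable (by norm_num)
  have mp1 : MeasurePreserving Prod.fst J (targetPi U) := measurePreserving_fst
  have mp2 : MeasurePreserving Prod.snd J (targetPi (gK (d := d))) := measurePreserving_snd
  have j0 : Integrable (fun x : EV d × EV d => ‖x.1‖) J := mp1.integrable_comp_of_integrable i0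
  have j1 : Integrable (fun x : EV d × EV d => ‖gradient U x.1‖) J :=
    mp1.integrable_comp_of_integrable i1
  have j2 : Integrable (fun x : EV d × EV d => ‖x.2‖) J :=
    mp2.integrable_comp_of_integrable (by simpa using gK_norm_integrable (d := d) 1)
  have hfc : Continuous f := hf.continuous
  have hgc : Continuous (gradient U) := (grad_contDiff hU).continuous
  have hfb : ∀ y, ‖fderiv ℝ f y‖ ≤ 1 := fun y => by simpa using norm_fderiv_le_of_lipschitz ℝ hf (x₀ := y)
  have mfd : Measurable (fderiv ℝ f) := measurable_fderiv ℝ f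
  have mfi : ∀ i : Fin d, Measurable fun x : EV d × EV d =>
      fderiv ℝ f (x.1 + s • x.2) (EuclideanSpace.single i 1) := fun i =>
    (measurable_fderiv_apply_const ℝ f _).comp (by fun_prop)
  have hfs : ∀ y v, fderiv ℝ f y v = ∑ i, v i * fderiv ℝ f y (EuclideanSpace.single i 1) := by
    intro y v
    conv_lhs => rw [← (EuclideanSpace.basisFun (Fin d) ℝ).sum_repr v]
    simp
  have bi : ∀ y (i : Fin d), |fderiv ℝ f y (EuclideanSpace.single i 1)| ≤ 1 := by
    intro y i
    refine ((fderiv ℝ f y).le_opNorm _).trans ?_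
    simpa using hfb y
  -- a.e. differentiability
  have hae : ∀ᵐ x ∂J, DifferentiableAt ℝ f (x.1 + s • x.2) := by
    have h0 : ∀ᵐ y, DifferentiableAt ℝ f y := hf.ae_differentiableAt
    have qm : Measure.QuasiMeasurePreserving (fun x : EV d × EV d => x.1 + s • x.2) J volume := by
      refine ⟨by fun_prop, ?_⟩
      have ac : J ≪ (volume : Measure (EV d)).prod (volume : Measure (EV d)) :=
        Measure.AbsolutelyContinuous.prod dens_ac dens_ac
      refine (ac.map (by fun_prop)).trans ?_
      refine Measure.AbsolutelyContinuous.mk fun N hN hN0 => ?_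
      have hm : Measurable fun x : EV d × EV d => x.1 + s • x.2 := by fun_prop
      rw [Measure.map_apply hm hN, Measure.prod_apply_symm (hm hN)]
      refine lintegral_eq_zero_of_ae_eq_zero (.of_forall fun z => ?_)
      have : (fun x : EV d => (x, z)) ⁻¹' ((fun x : EV d × EV d => x.1 + s • x.2) ⁻¹' N) =
        (fun x => x + s • z) ⁻¹' N := rfl
      simp only [this, measure_preimage_add_right, hN0, Pi.zero_apply]
    exact qm.ae h0
  have hlip : ∀ (x : EV d × EV d), LipschitzWith (Real.nnabs ‖x.2‖) (fun s : ℝ => f (x.1 + s • x.2)) := by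
    intro x
    refine LipschitzWith.of_dist_le_mul fun a b => ?_
    refine (hf.dist_le_mul _ _).trans ?_
    rw [NNReal.coe_one, one_mul, dist_add_left, dist_eq_norm, ← sub_smul, norm_smul, dist_eq_norm,
      mul_comm]
    simp
  obtain ⟨I', hD⟩ := hasDerivAt_integral_of_dominated_loc_of_lip (μ := J) (s := Set.univ) (x₀ := s)
    (F := fun s x => f (x.1 + s • x.2)) (bound := fun x => ‖x.2‖)
    (F' := fun x => fderiv ℝ f (x.1 + s • x.2) x.2) Filter.univ_mem
    (.of_forall fun t => Continuous.aestronglyMeasurable (by fun_prop))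
    (by
      refine ((j0.add (j2.const_mul s)).add (integrable_const |f 0|)).mono'
        (Continuous.aestronglyMeasurable (by fun_prop)) (.of_forall fun x => ?_)
      have h1 := hf.dist_le_mul (x.1 + s • x.2) 0
      rw [NNReal.coe_one, one_mul, dist_zero_right, Real.dist_eq] at h1
      have h2 := norm_add_le x.1 (s • x.2)
      rw [norm_smul, Real.norm_of_nonneg hs] at h2
      have h3 := abs_sub_abs_le_abs_sub (f (x.1 + s • x.2)) (f 0)
      simp only [Pi.add_apply, Real.norm_eq_abs]
      linarith)
    (by
      refine Measurable.aestronglyMeasurable ?_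
      have e : (fun x : EV d × EV d => fderiv ℝ f (x.1 + s • x.2) x.2) = fun x =>
          ∑ i, x.2 i * fderiv ℝ f (x.1 + s • x.2) (EuclideanSpace.single i 1) :=
        funext fun x => hfs _ _
      rw [e]
      refine Finset.measurable_fun_sum _ fun i _ => ?_
      exact Measurable.mul (by fun_prop) (mfi i))
    (.of_forall fun x => (hlip x).lipschitzOnWith)
    j2
    (by
      filter_upwards [hae] with x hx
      have h1 : HasDerivAt (fun t : ℝ => x.1 + t • x.2) x.2 s := by
        simpa using! ((hasDerivAt_id s).smul_const x.2).const_add x.1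
      exact hx.hasFDerivAt.comp_hasDerivAt s h1)
  refine ⟨_, hD, ?_⟩
  -- integration by parts
  have hJd : J = densMeasure (fun x : EV d × EV d => Real.exp (-(U x.1 + gK x.2))) := by
    rw [hJ, targetPi, targetPi, dens_prod (fun _ => Real.exp_pos _) (fun _ => Real.exp_pos _) hint
      gK_int vol_ne vol_ne]
    congr 1; ext x; rw [← Real.exp_add]; congr 1; ring
  have hWi : Integrable (fun x : EV d × EV d => Real.exp (-(U x.1 + gK x.2))) := by
    refine (hint.mul_prod gK_int).congr (.of_forall fun x => ?_)
    simp only []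
    rw [← Real.exp_add]; congr 1; ring
  have k1 : ∀ i : Fin d, Integrable (fun x : EV d × EV d =>
      x.2 i * fderiv ℝ f (x.1 + s • x.2) (EuclideanSpace.single i 1)) J := by
    intro i
    refine j2.mono' (by have := mfi i; fun_prop) (.of_forall fun x => ?_)
    rw [norm_mul]
    exact (mul_le_of_le_one_right (norm_nonneg _) (bi _ i)).trans (PiLp.norm_apply_le _ i)
  have k2 : ∀ i : Fin d, Integrable (fun x : EV d × EV d =>
      gradient U x.1 i * fderiv ℝ f (x.1 + s • x.2) (EuclideanSpace.single i 1)) J := by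
    intro i
    have hgi : Continuous fun x : EV d × EV d => gradient U x.1 i :=
      (EuclideanSpace.proj (𝕜 := ℝ) i : EV d →L[ℝ] ℝ).continuous.comp (hgc.comp continuous_fst)
    refine j1.mono' (hgi.measurable.mul (mfi i)).aestronglyMeasurable (.of_forall fun x => ?_)
    rw [norm_mul]
    exact (mul_le_of_le_one_right (norm_nonneg _) (bi _ i)).trans (PiLp.norm_apply_le _ i)
  have parts : ∀ i : Fin d,
      ∫ x, x.2 i * fderiv ℝ f (x.1 + s • x.2) (EuclideanSpace.single i 1) ∂J =
      s * ∫ x, gradient U x.1 i * fderiv ℝ f (x.1 + s • x.2) (EuclideanSpace.single i 1) ∂J := by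
    intro i
    have inst : (volume : Measure (EV d × EV d)).IsAddHaarMeasure :=
      inferInstanceAs ((volume : Measure (EV d)).prod (volume : Measure (EV d))).IsAddHaarMeasure
    have := stein (fun x : EV d × EV d => U x.1 + gK x.2)
      (fun x => x.2 i - s * gradient U x.1 i)
      (fun x => fderiv ℝ f (x.1 + s • x.2) (EuclideanSpace.single i 1)) (fun _ => 0)
      (-s • EuclideanSpace.single i 1, EuclideanSpace.single i 1) hWi
      (fun x => by
        have h1 := ((hUd x.1).hasFDerivAt.comp x (hasFDerivAt_fst (𝕜 := ℝ) (p := x))).add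
          ((hKd x.2).hasFDerivAt.comp x (hasFDerivAt_snd (𝕜 := ℝ) (p := x)))
        have h2 := h1.hasLineDerivAt (-s • EuclideanSpace.single i 1, EuclideanSpace.single i 1)
        have e : x.2 i = fderiv ℝ gK x.2 (EuclideanSpace.single i 1) := by
          rw [← grad_apply, gK_grad]
        rw [e, grad_apply]
        convert! h2 using 1
        simp; ring)
      (fun x => by
        have : (fun t : ℝ => fderiv ℝ f ((x + t • (-s • EuclideanSpace.single i (1 : ℝ),
          EuclideanSpace.single i (1 : ℝ)) : EV d × EV d).1 + s • (x + t • (-s • EuclideanSpace.single i (1 : ℝ),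
          EuclideanSpace.single i (1 : ℝ)) : EV d × EV d).2) (EuclideanSpace.single i 1))
          = fun t => fderiv ℝ f (x.1 + s • x.2) (EuclideanSpace.single i 1) := by
          ext t
          congr 2
          simp only [Prod.fst_add, Prod.snd_add, Prod.smul_fst, Prod.smul_snd]
          module
        unfold HasLineDerivAt
        rw [this]
        exact hasDerivAt_const _ _)
      (by
        rw [← hJd]
        exact (integrable_const 1).mono' (mfi i).aestronglyMeasurable (.of_forall fun x => bi _ i))
      (integrable_zero _ _ _)
      (by
        rw [← hJd]
        refine ((k1 i).sub ((k2 i).const_mul s)).congr (.of_forall fun x => ?_)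
        simp only [Pi.sub_apply]; ring)
    rw [← hJd, integral_zero] at this
    have e : ∀ x : EV d × EV d, fderiv ℝ f (x.1 + s • x.2) (EuclideanSpace.single i 1)
        * (x.2 i - s * gradient U x.1 i) =
        x.2 i * fderiv ℝ f (x.1 + s • x.2) (EuclideanSpace.single i 1) -
        s * (gradient U x.1 i * fderiv ℝ f (x.1 + s • x.2) (EuclideanSpace.single i 1)) := by
      intro x; ring
    simp_rw [e] at this
    rw [integral_sub (k1 i) ((k2 i).const_mul s), integral_const_mul] at this
    linarith
  have tot : ∫ x, fderiv ℝ f (x.1 + s • x.2) x.2 ∂J =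
      s * ∫ x, fderiv ℝ f (x.1 + s • x.2) (gradient U x.1) ∂J := by
    have e1 : ∀ x : EV d × EV d, fderiv ℝ f (x.1 + s • x.2) x.2 =
      ∑ i, x.2 i * fderiv ℝ f (x.1 + s • x.2) (EuclideanSpace.single i 1) := fun x => hfs _ _
    have e2 : ∀ x : EV d × EV d, fderiv ℝ f (x.1 + s • x.2) (gradient U x.1) =
      ∑ i, gradient U x.1 i * fderiv ℝ f (x.1 + s • x.2) (EuclideanSpace.single i 1) :=
      fun x => hfs _ _
    simp_rw [e1, e2]
    rw [integral_finsetSum _ (fun i _ => k1 i), integral_finsetSum _ (fun i _ => k2 i),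
      Finset.mul_sum]
    exact Finset.sum_congr rfl fun i _ => parts i
  rw [tot]
  refine mul_le_mul_of_nonneg_left ?_ hs
  have le : ∀ x : EV d × EV d, ‖fderiv ℝ f (x.1 + s • x.2) (gradient U x.1)‖ ≤ ‖gradient U x.1‖ := by
    intro x
    refine ((fderiv ℝ f _).le_opNorm _).trans ?_
    exact mul_le_of_le_one_left (norm_nonneg _) (hfb _)
  calc _ ≤ ∫ x, ‖gradient U x.1‖ ∂J := by
        refine (le_abs_self _).trans ?_
        exact norm_integral_le_of_norm_le j1 (.of_forall le)
    _ = ∫ θ, ‖gradient U θ‖ ∂(targetPi U) := by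
        have h := integral_map (μ := J) (φ := Prod.fst) (f := fun θ => ‖gradient U θ‖)
          measurable_fst.aemeasurable hgc.norm.aestronglyMeasurable
        rw [mp1.map_eq] at h
        exact h.symm

end Heat
section Final

variable {d : ℕ}

lemma grad_moment {U : EV d → ℝ} (hU : ContDiff ℝ 2 U)
    (hint : Integrable fun θ : EV d => Real.exp (-U θ)) (a₁ a₂ a₃ a₄ α β : ℝ)
    (ha : 0 < a₂) (hα : 0 < α) (hβ : 0 < β)
    (h1 : ∀ θ : EV d, a₁ + a₂ * ‖θ‖ ^ α ≤ U θ)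
    (h2 : ∀ θ : EV d, ‖gradient U θ‖ ≤ a₃ + a₄ * ‖θ‖ ^ β) :
    Integrable (fun θ => ‖θ‖) (targetPi U) ∧ Integrable (fun θ => ‖gradient U θ‖) (targetPi U) ∧
    Integrable (fun θ => ‖gradient U θ‖ ^ 2) (targetPi U) := by
  have hgc : Continuous (gradient U) := (grad_contDiff hU).continuous
  have hb : ∀ θ, ‖gradient U θ‖ ≤ (|a₃| + |a₄|) * (1 + ‖θ‖) ^ β := by
    intro θ
    have e1 : (1 : ℝ) ≤ (1 + ‖θ‖) ^ β := Real.one_le_rpow (by linarith [norm_nonneg θ]) hβ.le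
    have e2 : ‖θ‖ ^ β ≤ (1 + ‖θ‖) ^ β := by gcongr; linarith
    have e0 : 0 ≤ ‖θ‖ ^ β := by positivity
    have e3 : a₃ ≤ |a₃| * (1 + ‖θ‖) ^ β := (le_abs_self _).trans (le_mul_of_one_le_right (abs_nonneg _) e1)
    have e4 : a₄ * ‖θ‖ ^ β ≤ |a₄| * (1 + ‖θ‖) ^ β := by
      calc _ ≤ |a₄| * ‖θ‖ ^ β := by gcongr; exact le_abs_self _
        _ ≤ _ := by gcongr
    linarith [h2 θ]
  refine ⟨?_, ?_, ?_⟩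
  · refine target_integrable U hU.continuous a₁ a₂ α ha hα h1 hint _ (by fun_prop) 1 1 (by norm_num) fun θ => ?_
    rw [Real.rpow_one, abs_of_nonneg (norm_nonneg _)]; linarith
  · refine target_integrable U hU.continuous a₁ a₂ α ha hα h1 hint _ (by fun_prop) (|a₃| + |a₄|) β hβ.le fun θ => ?_
    rw [abs_of_nonneg (norm_nonneg _)]; exact hb θ
  · refine target_integrable U hU.continuous a₁ a₂ α ha hα h1 hint _ (by fun_prop) ((|a₃| + |a₄|) ^ 2) (β * 2)
      (by positivity) fun θ => ?_
    rw [abs_of_nonneg (by positivity), Real.rpow_mul (by positivity), Real.rpow_two, ← mul_pow]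
    exact pow_le_pow_left₀ (norm_nonneg _) (hb θ) 2

lemma main_bound {U : EV d → ℝ} (hU : ContDiff ℝ 2 U) (ρ : ℝ) (hρ : 0 < ρ)
    (hint : Integrable fun θ : EV d => Real.exp (-U θ))
    (i0 : Integrable (fun θ => ‖θ‖) (targetPi U))
    (i1 : Integrable (fun θ => ‖gradient U θ‖) (targetPi U)) :
    Wp 1 (fun x y => ‖x - y‖) (targetPi U) (targetPiRho U ρ) ≤
        min (ρ * Real.sqrt d) (ρ ^ 2 / 2 * ∫ θ, ‖gradient U θ‖ ∂(targetPi U)) := by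
  have p1 : IsProbabilityMeasure (targetPi U) :=
    dens_prob (fun _ => Real.exp_pos _) hint vol_ne
  have hr := rho_eq U hU.continuous ρ hρ hint
  set J := (targetPi U).prod (targetPi (gK (d := d))) with hJ
  have hmm : Measurable (fun x : EV d × EV d => x.1 + ρ • x.2) := by fun_prop
  have p2 : IsProbabilityMeasure (targetPiRho U ρ) := by
    rw [hr]; exact Measure.isProbabilityMeasure_map hmm.aemeasurable
  have mp1 : MeasurePreserving Prod.fst J (targetPi U) := measurePreserving_fst
  have mp2 : MeasurePreserving Prod.snd J (targetPi (gK (d := d))) := measurePreserving_snd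
  have ii : Integrable (fun θ : EV d => θ) (targetPi U) :=
    (integrable_norm_iff (by fun_prop)).1 i0
  have iz : Integrable (fun θ : EV d => θ) (targetPi (gK (d := d))) :=
    (integrable_norm_iff (by fun_prop)).1 (by simpa using gK_norm_integrable (d := d) 1)
  have j0 : Integrable (fun x : EV d × EV d => x.1) J := mp1.integrable_comp_of_integrable ii
  have j2 : Integrable (fun x : EV d × EV d => x.2) J := mp2.integrable_comp_of_integrable iz
  have hfi : ∀ (f : EV d → ℝ) (hf : LipschitzWith 1 f) (s : ℝ),
      Integrable (fun x : EV d × EV d => f (x.1 + s • x.2)) J := by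
    intro f hf s
    have hfc := hf.continuous
    refine ((j0.add (j2.smul s)).norm.add (integrable_const |f 0|)).mono'
        (Continuous.aestronglyMeasurable (by fun_prop)) (.of_forall fun x => ?_)
    have h1 := hf.dist_le_mul (x.1 + s • x.2) 0
    rw [NNReal.coe_one, one_mul, dist_zero_right, Real.dist_eq] at h1
    have h3 := abs_sub_abs_le_abs_sub (f (x.1 + s • x.2)) (f 0)
    simp only [Pi.add_apply, Pi.smul_apply, Real.norm_eq_abs]
    linarith
  refine kr_le _ _ ii ?_ _ fun f hf => ?_
  · rw [hr, integrable_map_measure (by fun_prop) hmm.aemeasurable]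
    exact j0.add (j2.smul ρ)
  have hfc := hf.continuous
  have e1 : ∫ x, f x ∂(targetPiRho U ρ) = ∫ x, f (x.1 + ρ • x.2) ∂J := by
    rw [hr, integral_map hmm.aemeasurable hfc.aestronglyMeasurable]
  have e0 : ∫ x, f x ∂(targetPi U) = ∫ x, f (x.1 + (0 : ℝ) • x.2) ∂J := by
    have h := integral_map (μ := J) (φ := Prod.fst) (f := f)
          measurable_fst.aemeasurable hfc.aestronglyMeasurable
    rw [mp1.map_eq] at h
    simpa using h
  rw [e1, e0]
  refine le_min ?_ ?_
  · rw [← integral_sub (hfi f hf ρ) (hfi f hf 0)]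
    calc _ ≤ ∫ x, ρ * ‖x.2‖ ∂J := by
          refine integral_mono ((hfi f hf ρ).sub (hfi f hf 0)) (j2.norm.const_mul ρ) fun x => ?_
          have h1 := hf.dist_le_mul (x.1 + ρ • x.2) (x.1 + (0 : ℝ) • x.2)
          rw [NNReal.coe_one, one_mul, dist_add_left, zero_smul, dist_zero_right, norm_smul,
            Real.norm_of_nonneg hρ.le, Real.dist_eq] at h1
          simp only [zero_smul]
          exact (le_abs_self _).trans h1
      _ = ρ * ∫ z : EV d, ‖z‖ ∂(targetPi gK) := by
          rw [integral_const_mul]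
          have h := integral_map (μ := J) (φ := Prod.snd) (f := fun z => ‖z‖)
            measurable_snd.aemeasurable (by fun_prop)
          rw [mp2.map_eq] at h
          rw [h]
      _ ≤ _ := by gcongr; exact gK_norm_le
  · set B := ∫ θ, ‖gradient U θ‖ ∂(targetPi U) with hB
    set g : ℝ → ℝ := fun s => ∫ x, f (x.1 + s • x.2) ∂J with hg
    have hd : ∀ s, 0 ≤ s → ∃ g', HasDerivAt g g' s ∧ g' ≤ s * B := fun s hs =>
      heat_deriv hU hint i0 i1 f hf s hs
    have hd2 : ∀ s, 0 ≤ s → ∃ g', HasDerivAt (fun s => g s - s ^ 2 / 2 * B) g' s ∧ g' ≤ 0 := by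
      intro s hs
      obtain ⟨g', h1, h2⟩ := hd s hs
      refine ⟨g' - s * B, ?_, by linarith⟩
      have h3 : HasDerivAt (fun s : ℝ => s ^ 2 / 2 * B) (s * B) s := by
        have := (((hasDerivAt_pow 2 s).div_const 2).mul_const B)
        exact this.congr_deriv (by push_cast; ring)
      exact h1.sub h3
    have anti : AntitoneOn (fun s => g s - s ^ 2 / 2 * B) (Set.Icc 0 ρ) := by
      refine antitoneOn_of_deriv_nonpos (convex_Icc 0 ρ) ?_ ?_ ?_
      · intro s hs
        obtain ⟨g', h1, h2⟩ := hd2 s hs.1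
        exact h1.continuousAt.continuousWithinAt
      · intro s hs
        rw [interior_Icc] at hs
        obtain ⟨g', h1, h2⟩ := hd2 s hs.1.le
        exact h1.differentiableAt.differentiableWithinAt
      · intro s hs
        rw [interior_Icc] at hs
        obtain ⟨g', h1, h2⟩ := hd2 s hs.1.le
        rw [h1.deriv]; exact h2
    have := anti (Set.left_mem_Icc.2 hρ.le) (Set.right_mem_Icc.2 hρ.le) hρ.le
    simp only [] at this
    change g ρ - g 0 ≤ _
    norm_num at this
    linarith

lemma growth_lower {U : EV d → ℝ} (hU : ContDiff ℝ 2 U) (m : ℝ) (hm : 0 < m)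
    (hc : ConvexOn ℝ Set.univ fun z => U z - m / 2 * ‖z‖ ^ 2) :
    ∃ a₁ : ℝ, ∀ θ : EV d, a₁ + m / 4 * ‖θ‖ ^ (2 : ℝ) ≤ U θ := by
  set c := ‖fderiv ℝ U 0‖ with hcd
  refine ⟨U 0 - c ^ 2 / m, fun θ => ?_⟩
  have hUd : Differentiable ℝ U := hU.differentiable (by norm_num)
  -- slope inequality along the segment
  set φ : ℝ → ℝ := fun t => U (t • θ) - m / 2 * ‖t • θ‖ ^ 2 with hφ
  have hφc : ConvexOn ℝ Set.univ φ := by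
    have := hc.comp_linearMap (LinearMap.toSpanSingleton ℝ (EV d) θ)
    simpa [hφ, Function.comp_def] using this
  have hφd : HasDerivAt φ (fderiv ℝ U 0 θ) 0 := by
    have h1 : HasDerivAt (fun t : ℝ => t • θ) θ 0 := by
      simpa using (hasDerivAt_id (0 : ℝ)).smul_const θ
    have h2 : HasDerivAt (fun t : ℝ => U (t • θ)) (fderiv ℝ U 0 θ) 0 := by
      have h3 : HasFDerivAt U (fderiv ℝ U 0) ((0 : ℝ) • θ) := by
        rw [zero_smul]; exact (hUd 0).hasFDerivAt
      exact h3.comp_hasDerivAt 0 h1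
    have h4 : HasDerivAt (fun t : ℝ => m / 2 * ‖t • θ‖ ^ 2) 0 0 := by
      have : (fun t : ℝ => m / 2 * ‖t • θ‖ ^ 2) = fun t => t ^ 2 * (m / 2 * ‖θ‖ ^ 2) := by
        ext t; rw [norm_smul, mul_pow, Real.norm_eq_abs, sq_abs]; ring
      rw [this]
      simpa using (hasDerivAt_pow 2 (0 : ℝ)).mul_const (m / 2 * ‖θ‖ ^ 2)
    simpa using! h2.sub h4
  have hs := hφc.le_slope_of_hasDerivAt (Set.mem_univ 0) (Set.mem_univ 1) one_pos hφd
  rw [slope_def_field] at hs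
  simp only [hφ, one_smul, zero_smul, norm_zero, sub_zero, div_one] at hs
  have h5 : -(c * ‖θ‖) ≤ fderiv ℝ U 0 θ := (abs_le.1 ((fderiv ℝ U 0).le_opNorm θ)).1
  rw [Real.rpow_two]
  have h6 : c * ‖θ‖ ≤ c ^ 2 / m + m / 4 * ‖θ‖ ^ 2 := by
    have : c ^ 2 / m + m / 4 * ‖θ‖ ^ 2 - c * ‖θ‖ = (c - m / 2 * ‖θ‖) ^ 2 / m := by
      field_simp; ring
    have : 0 ≤ (c - m / 2 * ‖θ‖) ^ 2 / m := by positivity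
    linarith
  norm_num at hs
  linarith

lemma growth_grad {U : EV d → ℝ} (hU : ContDiff ℝ 2 U) (M : ℝ)
    (hM : ∀ θ v : EV d, |⟪v, fderiv ℝ (gradient U) θ v⟫| ≤ M * ‖v‖ ^ 2) (θ : EV d) :
    ‖gradient U θ‖ ≤ ‖gradient U 0‖ + |M| * ‖θ‖ ^ (1 : ℝ) := by
  have hg := grad_contDiff hU
  have hgd : Differentiable ℝ (gradient U) := hg.differentiable (by norm_num)
  have h1 : ContDiff ℝ 1 (fderiv ℝ U) := hU.fderiv_right (by norm_num)
  have h1d : Differentiable ℝ (fderiv ℝ U) := h1.differentiable (by norm_num)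
  have hin : ∀ x v w : EV d, ⟪fderiv ℝ (gradient U) x v, w⟫ = fderiv ℝ (fderiv ℝ U) x v w := by
    intro x v w
    have e : (fun y => ⟪gradient U y, w⟫) = fun y => fderiv ℝ U y w := by
      ext y; exact inner_gradient_left
    have d1 : HasFDerivAt (fun y => ⟪gradient U y, w⟫) _ x :=
      (hgd x).hasFDerivAt.inner ℝ (hasFDerivAt_const w x)
    have d2 : HasFDerivAt (fun y => fderiv ℝ U y w) _ x :=
      (h1d x).hasFDerivAt.clm_apply (hasFDerivAt_const w x)
    rw [e] at d1
    have := congrArg (fun L => L v) (d1.unique d2)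
    simpa using this
  have hsym : ∀ x v w : EV d, ⟪fderiv ℝ (gradient U) x v, w⟫ = ⟪v, fderiv ℝ (gradient U) x w⟫ := by
    intro x v w
    rw [hin, real_inner_comm, hin]
    exact (hU.contDiffAt.isSymmSndFDerivAt (by simp)) v w
  have hop : ∀ x, ‖fderiv ℝ (gradient U) x‖ ≤ |M| := by
    intro x
    refine ContinuousLinearMap.opNorm_le_bound _ (abs_nonneg _) fun v => ?_
    set L := fderiv ℝ (gradient U) x with hL
    have q : ∀ v, |⟪v, L v⟫| ≤ |M| * ‖v‖ ^ 2 := fun v =>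
      (hM x v).trans (by gcongr; exact le_abs_self _)
    -- polarization
    have pol : ∀ a b : EV d, 4 * ⟪a, L b⟫ ≤ |M| * (2 * ‖a‖ ^ 2 + 2 * ‖b‖ ^ 2) := by
      intro a b
      have e1 := (abs_le.1 (q (a + b))).2
      have e2 := (abs_le.1 (q (a - b))).1
      have e3 : ⟪a + b, L (a + b)⟫ - ⟪a - b, L (a - b)⟫ = 4 * ⟪a, L b⟫ := by
        have : ⟪b, L a⟫ = ⟪a, L b⟫ := by rw [real_inner_comm]; exact hsym x a b
        simp only [map_add, map_sub, inner_add_left, inner_add_right, inner_sub_left,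
          inner_sub_right, this]
        ring
      have e4 := parallelogram_law_with_norm ℝ a b
      have e5 : |M| * ‖a + b‖ ^ 2 + |M| * ‖a - b‖ ^ 2 = |M| * (2 * ‖a‖ ^ 2 + 2 * ‖b‖ ^ 2) := by
        rw [← mul_add]; congr 1; nlinarith
      linarith
    by_cases hLv : L v = 0
    · rw [hLv, norm_zero]; positivity
    have hv : v ≠ 0 := fun h => hLv (by rw [h, map_zero])
    have nv : 0 < ‖v‖ := norm_pos_iff.2 hv
    have nL : 0 < ‖L v‖ := norm_pos_iff.2 hLv
    have := pol ((‖v‖ / ‖L v‖) • L v) v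
    rw [real_inner_smul_left, real_inner_self_eq_norm_sq, norm_smul, Real.norm_of_nonneg (by positivity),
      div_mul_cancel₀ _ nL.ne'] at this
    have e : ‖v‖ / ‖L v‖ * ‖L v‖ ^ 2 = ‖v‖ * ‖L v‖ := by field_simp
    rw [e] at this
    have : ‖v‖ * ‖L v‖ ≤ ‖v‖ * (|M| * ‖v‖) := by nlinarith
    exact le_of_mul_le_mul_left this nv
  have mv := Convex.norm_image_sub_le_of_norm_fderiv_le (𝕜 := ℝ) (f := gradient U) (s := Set.univ)
    (fun x _ => hgd x) (fun x _ => hop x) convex_univ (Set.mem_univ 0) (Set.mem_univ θ)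
  rw [sub_zero] at mv
  rw [Real.rpow_one]
  have := norm_sub_norm_le (gradient U θ) (gradient U 0)
  linarith

end Final
theorem stmt11 {d : ℕ} (U : EV d → ℝ) (ρ : ℝ) (hρ : 0 < ρ)
    -- (A0): U bounded below and exp(−U) integrable
    (hbdd : BddBelow (Set.range U))
    (hint : Integrable fun θ : EV d => Real.exp (-U θ))
    -- U twice continuously differentiable
    (hC2 : ContDiff ℝ 2 U) :
    -- first claim, under the growth conditions
    (∀ a₁ a₂ a₃ a₄ α β : ℝ, 0 < a₂ → 0 < α → 0 < β →
      (∀ θ : EV d, a₁ + a₂ * ‖θ‖ ^ α ≤ U θ) →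
      (∀ θ : EV d, ‖gradient U θ‖ ≤ a₃ + a₄ * ‖θ‖ ^ β) →
      Wp 1 (fun x y => ‖x - y‖) (targetPi U) (targetPiRho U ρ) ≤
        min (ρ * Real.sqrt d)
          (ρ ^ 2 / 2 * ∫ θ, ‖gradient U θ‖ ∂(targetPi U))) ∧
    -- second claim, under (A2) and (A4) with m₁ > 0
    (∀ M₁ m₁ : ℝ, 0 < m₁ →
      (∀ θ v : EV d, |⟪v, fderiv ℝ (gradient U) θ v⟫| ≤ M₁ * ‖v‖ ^ 2) →
      (ConvexOn ℝ Set.univ fun z => U z - m₁ / 2 * ‖z‖ ^ 2) →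
      (∃ a₁ a₂ a₃ a₄ α β : ℝ, 0 < a₂ ∧ 0 < α ∧ 0 < β ∧
        (∀ θ : EV d, a₁ + a₂ * ‖θ‖ ^ α ≤ U θ) ∧
        (∀ θ : EV d, ‖gradient U θ‖ ≤ a₃ + a₄ * ‖θ‖ ^ β)) ∧
      Wp 1 (fun x y => ‖x - y‖) (targetPi U) (targetPiRho U ρ) ≤
        min (ρ * Real.sqrt d) (ρ ^ 2 / 2 * Real.sqrt (M₁ * d))) := by
  refine ⟨fun a₁ a₂ a₃ a₄ α β ha hα hβ h1 h2 => ?_, fun M m hm hM hc => ?_⟩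
  · obtain ⟨i0, i1, _⟩ := grad_moment hC2 hint a₁ a₂ a₃ a₄ α β ha hα hβ h1 h2
    exact main_bound hC2 ρ hρ hint i0 i1
  · obtain ⟨a₁, h1⟩ := growth_lower hC2 m hm hc
    have h2 := growth_grad hC2 M hM
    have h4 : 0 < m / 4 := by positivity
    refine ⟨⟨a₁, m / 4, _, _, 2, 1, h4, by norm_num, by norm_num, h1, h2⟩, ?_⟩
    obtain ⟨i0, i1, i2⟩ := grad_moment hC2 hint a₁ (m / 4) _ _ 2 1 h4 (by norm_num) (by norm_num)
      h1 h2
    refine (main_bound hC2 ρ hρ hint i0 i1).trans ?_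
    gcongr
    exact grad_norm_bound hC2 hint M hM i1 i2

end
end

section
/- Let θ, θ' ∈ ℝ^d, ρ > 0, and for a fixed i let μ_i and μ'_i be the probability densities on ℝ^{d_i} proportional to exp(−U_i(z) − ‖z − A_iθ‖²/(2ρ²)) and exp(−U_i(z) − ‖z − A_iθ'‖²/(2ρ²)) respectively. If U_i is m_i-strongly convex with m_i ≥ 0 (Assumption (A4)), then for every 1 ≤ p ≤ ∞, W_p(μ_i, μ'_i) ≤ ‖A_i(θ − θ')‖/(1 + ρ²m_i), where W_p is the p-Wasserstein distance for the Euclidean metric on ℝ^{d_i}. -/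
/-!
STATEMENT 13: contraction of the SGS auxiliary-variable conditionals.
For μ_i ∝ exp(−U_i(z) − ‖z − A_iθ‖²/(2ρ²)) and μ'_i the analogue with θ',
if U_i is m_i-strongly convex (m_i ≥ 0), then for all 1 ≤ p ≤ ∞,
W_p(μ_i, μ'_i) ≤ ‖A_i(θ − θ')‖/(1 + ρ²m_i).
-/

open MeasureTheory Matrix
open scoped ENNReal

noncomputable section

/-- Action of a matrix on a Euclidean vector. -/
def mvec {m n : ℕ} (A : Matrix (Fin m) (Fin n) ℝ) (x : EV n) : EV m :=
  (EuclideanSpace.equiv (Fin m) ℝ).symm (A.mulVec (EuclideanSpace.equiv (Fin n) ℝ x))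

/-- Wasserstein distance of order `∞` w.r.t. the metric `w`. -/
def Winf {α : Type*} [MeasurableSpace α] (w : α → α → ℝ) (μ ν : Measure α) : ℝ :=
  sInf {r | ∃ γ : Measure (α × α), IsCoupling γ μ ν ∧
    r = (essSup (fun x => ENNReal.ofReal (w x.1 x.2)) γ).toReal}

open Filter Topology Set

/-- There is a probability coupling concentrated on pairs at distance at most `r`. -/
def HasCpl {n : ℕ} (μ ν : Measure (EV n)) (r : ℝ) : Prop :=
  ∃ γ : Measure (EV n × EV n), IsProbabilityMeasure γ ∧ IsCoupling γ μ ν ∧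
    ∀ᵐ z ∂γ, ‖z.1 - z.2‖ ≤ r

lemma hasCpl_limit {n : ℕ} (μs νs : ℕ → ProbabilityMeasure (EV n))
    (μ ν : ProbabilityMeasure (EV n)) (hμ : Tendsto μs atTop (𝓝 μ))
    (hν : Tendsto νs atTop (𝓝 ν)) (r : ℝ)
    (h : ∀ k, HasCpl (μs k : Measure (EV n)) (νs k : Measure (EV n)) r) :
    HasCpl (μ : Measure (EV n)) (ν : Measure (EV n)) r := by
  choose γ hγp hγc hγr using h
  let Γ : ℕ → ProbabilityMeasure (EV n × EV n) := fun k => ⟨γ k, hγp k⟩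
  have tμ : IsTightMeasureSet {((μ : ProbabilityMeasure (EV n)) : Measure (EV n)) | μ ∈ range μs} := by
    apply isTightMeasureSet_of_isCompact_closure
    exact hμ.isCompact_insert_range.closure_of_subset (subset_insert _ _)
  have tν : IsTightMeasureSet {((μ : ProbabilityMeasure (EV n)) : Measure (EV n)) | μ ∈ range νs} := by
    apply isTightMeasureSet_of_isCompact_closure
    exact hν.isCompact_insert_range.closure_of_subset (subset_insert _ _)
  have tΓ : IsTightMeasureSet
      {((μ : ProbabilityMeasure (EV n × EV n)) : Measure (EV n × EV n)) | μ ∈ range Γ} := by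
    apply IsTightMeasureSet.prodMk
    · refine tμ.subset ?_
      rintro _ ⟨_, ⟨_, ⟨k, rfl⟩, rfl⟩, rfl⟩
      exact ⟨μs k, ⟨k, rfl⟩, ((hγc k).1).symm⟩
    · refine tν.subset ?_
      rintro _ ⟨_, ⟨_, ⟨k, rfl⟩, rfl⟩, rfl⟩
      exact ⟨νs k, ⟨k, rfl⟩, ((hγc k).2).symm⟩
  have hc := isCompact_closure_of_isTightMeasureSet tΓ
  obtain ⟨G, -, φ, hφ, hG⟩ := hc.tendsto_subseq (x := Γ) (fun k => subset_closure ⟨k, rfl⟩)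
  refine ⟨G, inferInstance, ⟨?_, ?_⟩, ?_⟩
  · have h1 := ((ProbabilityMeasure.continuous_map (Ω := EV n × EV n) (Ω' := EV n)
      (f := Prod.fst) continuous_fst).tendsto G).comp hG
    have h2 := hμ.comp hφ.tendsto_atTop
    have : ∀ k, ((Γ (φ k)).map (f := Prod.fst) continuous_fst.measurable.aemeasurable) = μs (φ k) := by
      intro k
      apply Subtype.ext
      exact (hγc (φ k)).1
    have h3 := tendsto_nhds_unique h1 (h2.congr (fun k => (this k).symm))
    exact congrArg (fun q : ProbabilityMeasure (EV n) => (q : Measure (EV n))) h3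
  · have h1 := ((ProbabilityMeasure.continuous_map (Ω := EV n × EV n) (Ω' := EV n)
      (f := Prod.snd) continuous_snd).tendsto G).comp hG
    have h2 := hν.comp hφ.tendsto_atTop
    have : ∀ k, ((Γ (φ k)).map (f := Prod.snd) continuous_snd.measurable.aemeasurable) = νs (φ k) := by
      intro k
      apply Subtype.ext
      exact (hγc (φ k)).2
    have h3 := tendsto_nhds_unique h1 (h2.congr (fun k => (this k).symm))
    exact congrArg (fun q : ProbabilityMeasure (EV n) => (q : Measure (EV n))) h3
  · have hF : IsClosed {z : EV n × EV n | ‖z.1 - z.2‖ ≤ r} :=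
      isClosed_le (by fun_prop) continuous_const
    have h1 := ProbabilityMeasure.limsup_measure_closed_le_of_tendsto hG hF
    have h2 : ∀ k, ((Γ ∘ φ) k : Measure (EV n × EV n)) {z : EV n × EV n | ‖z.1 - z.2‖ ≤ r} = 1 := by
      intro k
      exact (prob_compl_eq_zero_iff hF.measurableSet).1 (hγr (φ k))
    simp only [h2, limsup_const] at h1
    exact (prob_compl_eq_zero_iff hF.measurableSet).2 (le_antisymm prob_le_one h1)

/-- Continuous potentials with Gaussian lower growth. -/
def GoodPot {n : ℕ} (V : EV n → ℝ) : Prop :=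
  Continuous V ∧ ∃ K β : ℝ, 0 < β ∧ ∀ x, Real.exp (-V x) ≤ K * Real.exp (-β * ‖x‖ ^ 2)

lemma gauss_int {n : ℕ} {β : ℝ} (hβ : 0 < β) :
    Integrable (fun x : EV n => Real.exp (-β * ‖x‖ ^ 2)) := by
  by_contra h
  have h1 := GaussianFourier.integral_rexp_neg_mul_sq_norm (V := EV n) hβ
  rw [integral_undef h] at h1
  have : (0:ℝ) < (Real.pi / β) ^ ((Module.finrank ℝ (EV n) : ℝ) / 2) := by positivity
  linarith

lemma poly_exp {β : ℝ} (hβ : 0 < β) :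
    ∃ C : ℝ, ∀ t : ℝ, 0 ≤ t → (1 + t) ^ 3 * Real.exp (-β * t ^ 2) ≤ C * Real.exp (-(β / 2) * t ^ 2) := by
  set δ := min 1 (β / 6) with hδ
  have hδ0 : 0 < δ := lt_min one_pos (by positivity)
  have hδ1 : δ ≤ 1 := min_le_left _ _
  have hδ2 : δ ≤ β / 6 := min_le_right _ _
  refine ⟨(2 / δ) ^ 3, fun t ht => ?_⟩
  have h1 : 1 + t ≤ (2 / δ) * Real.exp (δ * t ^ 2) := by
    have h2 : δ * t ^ 2 + 1 ≤ Real.exp (δ * t ^ 2) := Real.add_one_le_exp _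
    have h3 : 1 + t ≤ (2 / δ) * (δ * t ^ 2 + 1) := by
      have : (2 / δ) * (δ * t ^ 2 + 1) = 2 * t ^ 2 + 2 / δ := by field_simp
      rw [this]
      have : 2 ≤ 2 / δ := by rw [le_div_iff₀ hδ0]; linarith
      nlinarith [sq_nonneg (t - 1), sq_nonneg t]
    exact h3.trans (by gcongr)
  calc (1 + t) ^ 3 * Real.exp (-β * t ^ 2)
      ≤ ((2 / δ) * Real.exp (δ * t ^ 2)) ^ 3 * Real.exp (-β * t ^ 2) := by gcongr
    _ = (2 / δ) ^ 3 * Real.exp (3 * (δ * t ^ 2) + -β * t ^ 2) := by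
        rw [mul_pow, ← Real.exp_nat_mul, Real.exp_add]; push_cast; ring
    _ ≤ _ := by
        gcongr
        nlinarith [sq_nonneg t]

lemma GoodPot.int3 {n : ℕ} {V : EV n → ℝ} (hV : GoodPot V) :
    Integrable (fun x : EV n => Real.exp (-V x) * (1 + ‖x‖) ^ 3) := by
  obtain ⟨hc, K, β, hβ, hK⟩ := hV
  obtain ⟨C, hC⟩ := poly_exp hβ
  have hK0 : 0 ≤ K := by
    have := hK 0
    simp at this
    exact (Real.exp_pos _).le.trans this
  refine ((gauss_int (n := n) (half_pos hβ)).const_mul (K * C)).mono'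
    (by fun_prop) (ae_of_all _ fun x => ?_)
  rw [Real.norm_of_nonneg (by positivity)]
  calc Real.exp (-V x) * (1 + ‖x‖) ^ 3 ≤ K * Real.exp (-β * ‖x‖ ^ 2) * (1 + ‖x‖) ^ 3 := by
        gcongr; exact hK x
    _ = K * ((1 + ‖x‖) ^ 3 * Real.exp (-β * ‖x‖ ^ 2)) := by ring
    _ ≤ K * (C * Real.exp (-(β / 2) * ‖x‖ ^ 2)) := by
        exact mul_le_mul_of_nonneg_left (hC ‖x‖ (norm_nonneg x)) hK0
    _ = _ := by ring

lemma GoodPot.int {n : ℕ} {V : EV n → ℝ} (hV : GoodPot V) :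
    Integrable (fun x : EV n => Real.exp (-V x)) := by
  have hc := hV.1
  refine hV.int3.mono' (by fun_prop) (ae_of_all _ fun x => ?_)
  rw [Real.norm_of_nonneg (by positivity)]
  refine le_mul_of_one_le_right (by positivity) (one_le_pow₀ ?_)
  linarith [norm_nonneg x]

lemma GoodPot.lint_ne_zero {n : ℕ} {V : EV n → ℝ} (hV : GoodPot V) :
    (∫⁻ x, ENNReal.ofReal (Real.exp (-V x))) ≠ 0 := by
  have hc := hV.1
  rw [← ofReal_integral_eq_lintegral_ofReal hV.int (ae_of_all _ fun x => by positivity)]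
  simpa using integral_exp_pos hV.int

lemma GoodPot.lint_ne_top {n : ℕ} {V : EV n → ℝ} (hV : GoodPot V) :
    (∫⁻ x, ENNReal.ofReal (Real.exp (-V x))) ≠ ⊤ := by
  rw [← ofReal_integral_eq_lintegral_ofReal hV.int (ae_of_all _ fun x => by positivity)]
  exact ENNReal.ofReal_ne_top

lemma GoodPot.prob {n : ℕ} {V : EV n → ℝ} (hV : GoodPot V) :
    IsProbabilityMeasure (densMeasure fun x => Real.exp (-V x)) := by
  constructor
  simp only [densMeasure, Measure.smul_apply, smul_eq_mul, MeasurableSet.univ, withDensity_apply,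
    Measure.restrict_univ]
  exact ENNReal.inv_mul_cancel hV.lint_ne_zero hV.lint_ne_top

lemma GoodPot.integral {n : ℕ} {V : EV n → ℝ} (hV : GoodPot V) (φ : EV n → ℝ) :
    ∫ x, φ x ∂(densMeasure fun x => Real.exp (-V x)) =
      (∫ x, Real.exp (-V x))⁻¹ * ∫ x, Real.exp (-V x) * φ x := by
  have hc := hV.1
  rw [densMeasure, integral_smul_measure, integral_withDensity_eq_integral_toReal_smul
    (by fun_prop) (by simp), ← ofReal_integral_eq_lintegral_ofReal hV.int
    (ae_of_all _ fun x => by positivity), ENNReal.toReal_inv, ENNReal.toReal_ofReal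
    (by positivity)]
  simp only [smul_eq_mul, ENNReal.toReal_ofReal (Real.exp_pos _).le]

lemma GoodPot.integrable {n : ℕ} {V : EV n → ℝ} (hV : GoodPot V) {φ : EV n → ℝ}
    (h : Integrable (fun x => Real.exp (-V x) * φ x)) :
    Integrable φ (densMeasure fun x => Real.exp (-V x)) := by
  have hc := hV.1
  rw [densMeasure]
  refine Integrable.smul_measure ?_ (by simpa using hV.lint_ne_zero)
  rw [integrable_withDensity_iff_integrable_smul' (by fun_prop) (by simp)]
  simpa only [smul_eq_mul, ENNReal.toReal_ofReal (Real.exp_pos _).le] using h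

/-- Reference Gaussian measure. -/
def gaus (n : ℕ) : Measure (EV n) := densMeasure fun w => Real.exp (-(‖w‖ ^ 2 / 4))

lemma gaus_good (n : ℕ) : GoodPot (fun w : EV n => ‖w‖ ^ 2 / 4) := by
  refine ⟨by fun_prop, 1, 1 / 4, by norm_num, fun x => ?_⟩
  rw [one_mul]
  apply le_of_eq
  congr 1
  ring

instance gaus_prob (n : ℕ) : IsProbabilityMeasure (gaus n) := (gaus_good n).prob

lemma gaus_lintegral {n : ℕ} {s : ℝ} (hs : 0 < s) :
    ∃ c : ℝ≥0∞, c ≠ ⊤ ∧ ∀ (v : EV n) (Φ : EV n → ℝ≥0∞), Measurable Φ →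
      ∫⁻ w, Φ (v + s • w) ∂(gaus n) =
        c * ∫⁻ y, ENNReal.ofReal (Real.exp (-(‖y - v‖ ^ 2 / (4 * s ^ 2)))) * Φ y := by
  refine ⟨(∫⁻ x : EV n, ENNReal.ofReal (Real.exp (-(‖x‖ ^ 2 / 4))))⁻¹ *
    ENNReal.ofReal |(s ^ Module.finrank ℝ (EV n))⁻¹|, ?_, fun v Φ hΦ => ?_⟩
  · exact ENNReal.mul_ne_top (ENNReal.inv_ne_top.2 (gaus_good n).lint_ne_zero) ENNReal.ofReal_ne_top
  rw [gaus, densMeasure, lintegral_smul_measure,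
    lintegral_withDensity_eq_lintegral_mul _ (by fun_prop) (by fun_prop), smul_eq_mul, mul_assoc]
  congr 1
  let G : EV n → ℝ≥0∞ := fun u => ENNReal.ofReal (Real.exp (-(‖u‖ ^ 2 / (4 * s ^ 2)))) * Φ (v + u)
  have hG : Measurable G := by fun_prop
  have h1 : ∀ w : EV n, ((fun w : EV n => ENNReal.ofReal (Real.exp (-(‖w‖ ^ 2 / 4)))) *
      fun w => Φ (v + s • w)) w = G (s • w) := by
    intro w
    simp only [G, Pi.mul_apply, norm_smul, Real.norm_of_nonneg hs.le]
    congr 4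
    field_simp
  simp_rw [h1]
  rw [← lintegral_map (f := G) (g := fun w => s • w) hG (by fun_prop),
    Measure.map_addHaar_smul volume hs.ne', lintegral_smul_measure, smul_eq_mul]
  congr 1
  rw [← lintegral_sub_right_eq_self G v]
  simp [G]

lemma joint {n : ℕ} {V : EV n → ℝ} (hV : GoodPot V) {s : ℝ} (hs : 0 < s) {T : EV n → EV n}
    (hT : Continuous T) :
    ∃ c : ℝ≥0∞, c ≠ ⊤ ∧
      (((densMeasure fun x => Real.exp (-V x)).prod (gaus n)).map
        fun z => (z.1, T z.1 + s • z.2)) =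
      c • ((volume : Measure (EV n)).prod (volume : Measure (EV n))).withDensity
        fun z => ENNReal.ofReal (Real.exp (-V z.1 - ‖z.2 - T z.1‖ ^ 2 / (4 * s ^ 2))) := by
  obtain ⟨c, hc, h⟩ := gaus_lintegral (n := n) hs
  have hVc := hV.1
  refine ⟨(∫⁻ x : EV n, ENNReal.ofReal (Real.exp (-V x)))⁻¹ * c,
    ENNReal.mul_ne_top (ENNReal.inv_ne_top.2 hV.lint_ne_zero) hc, ?_⟩
  have := hV.prob
  refine Measure.ext_of_lintegral _ fun Φ hΦ => ?_
  rw [lintegral_map hΦ (by fun_prop), lintegral_prod _ (by fun_prop), lintegral_smul_measure,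
    lintegral_withDensity_eq_lintegral_mul _ (by fun_prop) hΦ, lintegral_prod _ (by fun_prop),
    smul_eq_mul, mul_assoc]
  have h1 : ∀ x, ∫⁻ w, Φ (x, T x + s • w) ∂(gaus n) =
        c * ∫⁻ y, ENNReal.ofReal (Real.exp (-(‖y - T x‖ ^ 2 / (4 * s ^ 2)))) * Φ (x, y) :=
    fun x => h (T x) (fun y => Φ (x, y)) (by fun_prop)
  simp_rw [h1]
  rw [lintegral_const_mul _ (by fun_prop), densMeasure, lintegral_smul_measure,
    lintegral_withDensity_eq_lintegral_mul _ (by fun_prop) (by fun_prop), smul_eq_mul, mul_left_comm]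
  congr 2
  refine lintegral_congr fun x => ?_
  simp only [Pi.mul_apply]
  rw [← lintegral_const_mul _ (by fun_prop)]
  refine lintegral_congr fun y => ?_
  rw [← mul_assoc, ← ENNReal.ofReal_mul (Real.exp_pos _).le, ← Real.exp_add,
    ← sub_eq_add_neg]

lemma abs_exp_sub_exp_le (u v : ℝ) :
    |Real.exp u - Real.exp v| ≤ |u - v| * (Real.exp u + Real.exp v) := by
  have key : ∀ a b : ℝ, b ≤ a → |Real.exp a - Real.exp b| ≤ |a - b| * (Real.exp a + Real.exp b) := by
    intro a b hab
    have h1 : Real.exp b ≤ Real.exp a := Real.exp_le_exp.2 hab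
    rw [abs_of_nonneg (sub_nonneg.2 h1), abs_of_nonneg (sub_nonneg.2 hab)]
    have h2 : Real.exp b = Real.exp a * Real.exp (b - a) := by
      rw [← Real.exp_add]; congr 1; ring
    have h3 := Real.add_one_le_exp (b - a)
    have h4 : Real.exp a * (b - a + 1) ≤ Real.exp b := by
      rw [h2]; exact mul_le_mul_of_nonneg_left h3 (Real.exp_pos a).le
    have h5 : 0 ≤ (a - b) * Real.exp b := mul_nonneg (sub_nonneg.2 hab) (Real.exp_pos b).le
    nlinarith
  rcases le_total v u with h | h
  · exact key u v h
  · have := key v u h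
    rw [abs_sub_comm (Real.exp v), abs_sub_comm v, add_comm] at this
    exact this

lemma ratio_bound {n : ℕ} {V : EV n → ℝ} {g : EV n → EV n} {L : ℝ}
    (hg : ∀ x y, ‖g x - g y‖ ≤ L * ‖x - y‖)
    (hsub : ∀ x y, V x + inner ℝ (g x) (y - x) ≤ V y) {h : ℝ} (hh : 0 < h) (x y : EV n) :
    |(-V x - ‖y - (x - h • g x)‖ ^ 2 / (4 * h)) - (-V y - ‖x - (y - h • g y)‖ ^ 2 / (4 * h))| ≤
      L / 2 * ‖y - x‖ ^ 2 + h / 4 * (L * ‖y - x‖ * (2 * ‖g x‖ + L * ‖y - x‖)) := by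
  set Δ := y - x with hΔ
  have e1 : y - (x - h • g x) = Δ + h • g x := by rw [hΔ]; abel
  have e2 : x - (y - h • g y) = h • g y - Δ := by rw [hΔ]; abel
  rw [e1, e2, norm_add_sq_real Δ, norm_sub_sq_real (h • g y), norm_smul, norm_smul, Real.norm_of_nonneg hh.le,
    inner_smul_left, inner_smul_right]
  simp only [conj_trivial]
  have e3 : (-V x - (‖Δ‖ ^ 2 + 2 * (h * inner ℝ Δ (g x)) + (h * ‖g x‖) ^ 2) / (4 * h)) -
      (-V y - ((h * ‖g y‖) ^ 2 - 2 * (h * inner ℝ (g y) Δ) + ‖Δ‖ ^ 2) / (4 * h)) =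
      (V y - V x - 1 / 2 * (inner ℝ (g x) Δ + inner ℝ (g y) Δ)) +
        h / 4 * (‖g y‖ ^ 2 - ‖g x‖ ^ 2) := by
    rw [real_inner_comm (g x) Δ]
    field_simp
    ring
  rw [e3]
  have s1 := hsub x y
  have s2 := hsub y x
  have e4 : x - y = -Δ := by rw [hΔ]; abel
  rw [e4, inner_neg_right] at s2
  rw [← hΔ] at s1
  have hl : ‖g y - g x‖ ≤ L * ‖Δ‖ := hg y x
  have s3 : inner ℝ (g y) Δ - inner ℝ (g x) Δ ≤ L * ‖Δ‖ ^ 2 := by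
    rw [← inner_sub_left]
    refine (real_inner_le_norm _ _).trans ?_
    nlinarith [norm_nonneg Δ]
  have a1 : |V y - V x - 1 / 2 * (inner ℝ (g x) Δ + inner ℝ (g y) Δ)| ≤ L / 2 * ‖Δ‖ ^ 2 := by
    rw [abs_le]; constructor <;> linarith
  have a2 : |‖g y‖ ^ 2 - ‖g x‖ ^ 2| ≤ L * ‖Δ‖ * (2 * ‖g x‖ + L * ‖Δ‖) := by
    have b1 : |‖g y‖ - ‖g x‖| ≤ L * ‖Δ‖ := (abs_norm_sub_norm_le _ _).trans hl
    have b2 : ‖g y‖ + ‖g x‖ ≤ 2 * ‖g x‖ + L * ‖Δ‖ := by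
      have := (abs_le.1 b1).2; linarith
    have b3 : ‖g y‖ ^ 2 - ‖g x‖ ^ 2 = (‖g y‖ - ‖g x‖) * (‖g y‖ + ‖g x‖) := by ring
    rw [b3, abs_mul, abs_of_nonneg (by positivity : 0 ≤ ‖g y‖ + ‖g x‖)]
    exact mul_le_mul b1 b2 (by positivity) ((abs_nonneg _).trans b1)
  calc _ ≤ |V y - V x - 1 / 2 * (inner ℝ (g x) Δ + inner ℝ (g y) Δ)| +
        |h / 4 * (‖g y‖ ^ 2 - ‖g x‖ ^ 2)| := abs_add_le _ _
    _ ≤ _ := by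
      rw [abs_mul, abs_of_pos (by positivity : 0 < h / 4)]
      gcongr

lemma step_bound {n : ℕ} {V : EV n → ℝ} {g : EV n → EV n} {L : ℝ} (hL : 0 ≤ L)
    (hg : ∀ x y, ‖g x - g y‖ ≤ L * ‖x - y‖)
    (hsub : ∀ x y, V x + inner ℝ (g x) (y - x) ≤ V y) {s : ℝ} (hs : 0 < s) (hs1 : s ≤ 1)
    (x y w : EV n) (hy : y = (x - s ^ 2 • g x) + s • w) :
    ‖y - x‖ * |(-V x - ‖y - (x - s ^ 2 • g x)‖ ^ 2 / (4 * s ^ 2)) -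
      (-V y - ‖x - (y - s ^ 2 • g y)‖ ^ 2 / (4 * s ^ 2))| ≤
    s ^ 3 * ((L + L ^ 2) * (‖g 0‖ + L + 1) ^ 3 * ((1 + ‖x‖) ^ 3 * (1 + ‖w‖) ^ 3)) := by
  have h1 := ratio_bound hg hsub (h := s ^ 2) (by positivity) x y
  set B := (‖g 0‖ + L + 1) * (1 + ‖x‖) * (1 + ‖w‖) with hB
  have hgx : ‖g x‖ ≤ ‖g 0‖ + L * ‖x‖ := by
    have h2 := hg x 0
    rw [sub_zero] at h2
    have h3 : ‖g x‖ ≤ ‖g 0‖ + ‖g x - g 0‖ := by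
      calc ‖g x‖ = ‖g 0 + (g x - g 0)‖ := by congr 1; abel
        _ ≤ _ := norm_add_le _ _
    linarith
  have n0 := norm_nonneg (g 0)
  have nx := norm_nonneg x
  have nw := norm_nonneg w
  have ngx := norm_nonneg (g x)
  have hB1 : ‖g x‖ + ‖w‖ ≤ B := by
    have t1 : 0 ≤ ‖g 0‖ * ‖x‖ := by positivity
    have t2 : 0 ≤ ‖g 0‖ * ‖x‖ * ‖w‖ := by positivity
    have t3 : 0 ≤ L * ‖x‖ * ‖w‖ := by positivity
    have t4 : 0 ≤ ‖x‖ * ‖w‖ := by positivity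
    have t5 : 0 ≤ L * ‖w‖ := by positivity
    have t6 : 0 ≤ ‖g 0‖ * ‖w‖ := by positivity
    rw [hB]; nlinarith
  have hB0 : 0 ≤ B := by positivity
  have hΔ : ‖y - x‖ ≤ s * B := by
    have e : y - x = s • w - s ^ 2 • g x := by rw [hy]; abel
    rw [e]
    refine (norm_sub_le _ _).trans ?_
    rw [norm_smul, norm_smul, Real.norm_of_nonneg hs.le, Real.norm_of_nonneg (by positivity)]
    have : s ^ 2 * ‖g x‖ ≤ s * ‖g x‖ := by
      gcongr; nlinarith
    nlinarith
  have hgB : ‖g x‖ ≤ B := by linarith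
  have hsB : s * B ≤ B := by nlinarith
  calc _ ≤ (s * B) * (L / 2 * (s * B) ^ 2 + s ^ 2 / 4 * (L * (s * B) * (2 * B + L * (s * B)))) := by
        refine mul_le_mul hΔ (h1.trans ?_) (abs_nonneg _) (by positivity)
        gcongr
    _ ≤ (s * B) * (L / 2 * (s * B) ^ 2 + s ^ 2 / 4 * (L * B * (2 * B + L * B))) := by
        gcongr
    _ = s ^ 3 * ((L / 2 + L / 2 + L ^ 2 / 4) * B ^ 3) := by ring
    _ ≤ s ^ 3 * ((L + L ^ 2) * B ^ 3) := by
        have : L / 2 + L / 2 + L ^ 2 / 4 ≤ L + L ^ 2 := by nlinarith [sq_nonneg L]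
        gcongr
    _ = _ := by rw [hB]; ring

lemma one_step {n : ℕ} {V : EV n → ℝ} (hV : GoodPot V) {g : EV n → EV n} {L : ℝ} (hL : 0 ≤ L)
    (hg : ∀ x y, ‖g x - g y‖ ≤ L * ‖x - y‖) (hgc : Continuous g)
    (hsub : ∀ x y, V x + inner ℝ (g x) (y - x) ≤ V y) :
    ∃ C : ℝ, 0 ≤ C ∧ ∀ s : ℝ, 0 < s → s ≤ 1 → ∀ f : EV n → ℝ, Continuous f →
      (∃ M, ∀ x, |f x| ≤ M) → ∀ ℓ : ℝ, 0 ≤ ℓ → (∀ x y, |f x - f y| ≤ ℓ * ‖x - y‖) →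
      |∫ x, (∫ w, f ((x - s ^ 2 • g x) + s • w) ∂(gaus n)) ∂(densMeasure fun x => Real.exp (-V x)) -
        ∫ x, f x ∂(densMeasure fun x => Real.exp (-V x))| ≤ ℓ * (C * s ^ 3) := by
  set π := densMeasure fun x => Real.exp (-V x) with hπ
  have hπp : IsProbabilityMeasure π := hV.prob
  have hVc := hV.1
  set K := (L + L ^ 2) * (‖g 0‖ + L + 1) ^ 3 with hK
  have hP : Integrable (fun z : EV n × EV n => (1 + ‖z.1‖) ^ 3 * (1 + ‖z.2‖) ^ 3)
      (π.prod (gaus n)) :=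
    (hV.integrable hV.int3).mul_prod ((gaus_good n).integrable (gaus_good n).int3)
  refine ⟨K * ∫ z : EV n × EV n, (1 + ‖z.1‖) ^ 3 * (1 + ‖z.2‖) ^ 3 ∂(π.prod (gaus n)),
    mul_nonneg (by positivity) (integral_nonneg fun z => by positivity), ?_⟩
  intro s hs hs1 f hfc ⟨M, hM⟩ ℓ hℓ hf
  set T : EV n → EV n := fun x => x - s ^ 2 • g x with hTdef
  have hT : Continuous T := by fun_prop
  obtain ⟨c, hc, hj⟩ := joint hV hs hT
  set Ψ : EV n × EV n → EV n × EV n := fun z => (z.1, T z.1 + s • z.2) with hΨ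
  have hΨm : Measurable Ψ := by fun_prop
  set lg : EV n × EV n → ℝ := fun z => -V z.1 - ‖z.2 - T z.1‖ ^ 2 / (4 * s ^ 2) with hlg
  have hlgc : Continuous lg := by fun_prop
  set vol2 := (volume : Measure (EV n)).prod (volume : Measure (EV n)) with hvol
  have hinteg : ∀ F : EV n × EV n → ℝ, Continuous F →
      ∫ z, F (Ψ z) ∂(π.prod (gaus n)) = c.toReal * ∫ z, Real.exp (lg z) * F z ∂vol2 := by
    intro F hF
    rw [← integral_map hΨm.aemeasurable (by fun_prop), hj, integral_smul_measure,
      integral_withDensity_eq_integral_toReal_smul (by fun_prop) (by simp)]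
    simp only [smul_eq_mul, ENNReal.toReal_ofReal (Real.exp_pos _).le, hlg]
  have hc0 : c ≠ 0 := by
    rintro rfl
    have h1 : IsProbabilityMeasure ((π.prod (gaus n)).map Ψ) :=
      Measure.isProbabilityMeasure_map hΨm.aemeasurable
    rw [hj] at h1
    have := h1.measure_univ
    simp at this
  have hintegble : ∀ F : EV n × EV n → ℝ, Continuous F →
      Integrable (fun z => F (Ψ z)) (π.prod (gaus n)) →
      Integrable (fun z => Real.exp (lg z) * F z) vol2 := by
    intro F hF hFi
    have h1 : Integrable F ((π.prod (gaus n)).map Ψ) :=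
      (integrable_map_measure (by fun_prop) hΨm.aemeasurable).2 hFi
    rw [hj, integrable_smul_measure hc0 hc,
      integrable_withDensity_iff_integrable_smul' (by fun_prop) (by simp)] at h1
    simpa only [smul_eq_mul, ENNReal.toReal_ofReal (Real.exp_pos _).le] using h1
  have hfb : ∀ z : EV n × EV n, ‖f z.2 - f z.1‖ ≤ 2 * M := by
    intro z
    have := abs_sub (f z.2) (f z.1)
    rw [Real.norm_eq_abs]
    linarith [hM z.1, hM z.2]
  set H : EV n × EV n → ℝ := fun z => f z.2 - f z.1 with hH
  have hHc : Continuous H := by fun_prop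
  have hHi : Integrable (fun z => Real.exp (lg z) * H z) vol2 := by
    apply hintegble H hHc
    exact Integrable.of_bound (by fun_prop) (2 * M) (ae_of_all _ fun z => hfb _)
  set D : EV n × EV n → ℝ := fun z => ‖z.2 - z.1‖ * |lg z - lg z.swap| with hD
  have hDc : Continuous D := by fun_prop
  have hDb : ∀ z, D (Ψ z) ≤ s ^ 3 * (K * ((1 + ‖z.1‖) ^ 3 * (1 + ‖z.2‖) ^ 3)) := by
    intro z
    exact step_bound hL hg hsub hs hs1 z.1 _ z.2 rfl
  have hD0 : ∀ z, 0 ≤ D z := fun z => by positivity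
  have hDi' : Integrable (fun z => D (Ψ z)) (π.prod (gaus n)) := by
    refine ((hP.const_mul K).const_mul (s ^ 3)).mono' (by fun_prop) (ae_of_all _ fun z => ?_)
    rw [Real.norm_of_nonneg (hD0 _)]
    exact hDb z
  have hDi := hintegble D hDc hDi'
  have e1 : ∫ x, (∫ w, f (T x + s • w) ∂(gaus n)) ∂π - ∫ x, f x ∂π =
      ∫ z, H (Ψ z) ∂(π.prod (gaus n)) := by
    have i1 : Integrable (fun z : EV n × EV n => f (T z.1 + s • z.2)) (π.prod (gaus n)) :=
      Integrable.of_bound (by fun_prop) M (ae_of_all _ fun z => hM _)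
    have i2 : Integrable (fun z : EV n × EV n => f z.1) (π.prod (gaus n)) :=
      Integrable.of_bound (by fun_prop) M (ae_of_all _ fun z => hM _)
    have : ∫ z, H (Ψ z) ∂(π.prod (gaus n)) =
      ∫ z : EV n × EV n, f (T z.1 + s • z.2) - f z.1 ∂(π.prod (gaus n)) := rfl
    rw [this, integral_sub i1 i2, integral_prod _ i1, integral_prod _ i2]
    simp
  rw [e1, hinteg H hHc, abs_mul, abs_of_nonneg ENNReal.toReal_nonneg]
  have sw : ∀ F : EV n × EV n → ℝ, ∫ z, F z.swap ∂vol2 = ∫ z, F z ∂vol2 := fun F =>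
    integral_prod_swap F
  have hHi' : Integrable (fun z => Real.exp (lg z.swap) * H z.swap) vol2 := hHi.swap
  have hDi2 : Integrable (fun z => Real.exp (lg z.swap) * D z.swap) vol2 := hDi.swap
  have e2 : 2 * ∫ z, Real.exp (lg z) * H z ∂vol2 =
      ∫ z, (Real.exp (lg z) - Real.exp (lg z.swap)) * H z ∂vol2 := by
    have h1 := sw (fun z => Real.exp (lg z) * H z)
    rw [two_mul]
    nth_rewrite 2 [← h1]
    rw [← integral_add hHi hHi']
    refine integral_congr_ae (ae_of_all _ fun z => ?_)
    simp only [hH, Prod.snd_swap, Prod.fst_swap]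
    ring
  have e3 : |∫ z, (Real.exp (lg z) - Real.exp (lg z.swap)) * H z ∂vol2| ≤
      ∫ z, ℓ * (Real.exp (lg z) * D z + Real.exp (lg z.swap) * D z.swap) ∂vol2 := by
    rw [← Real.norm_eq_abs]
    refine norm_integral_le_of_norm_le ((hDi.add hDi2).const_mul ℓ) (ae_of_all _ fun z => ?_)
    rw [norm_mul, Real.norm_eq_abs, Real.norm_eq_abs]
    have q1 := abs_exp_sub_exp_le (lg z) (lg z.swap)
    have q2 := hf z.2 z.1
    have q3 : D z.swap = D z := by
      simp only [hD, Prod.swap_swap, Prod.snd_swap, Prod.fst_swap]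
      rw [norm_sub_rev, abs_sub_comm]
    rw [q3]
    calc _ ≤ (|lg z - lg z.swap| * (Real.exp (lg z) + Real.exp (lg z.swap))) * (ℓ * ‖z.2 - z.1‖) :=
          mul_le_mul q1 q2 (abs_nonneg _) (by positivity)
      _ = _ := by simp only [hD]; ring
  have e4 : ∫ z, ℓ * (Real.exp (lg z) * D z + Real.exp (lg z.swap) * D z.swap) ∂vol2 =
      2 * (ℓ * ∫ z, Real.exp (lg z) * D z ∂vol2) := by
    rw [integral_const_mul, integral_add hDi hDi2, sw (fun z => Real.exp (lg z) * D z)]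
    ring
  have e5 : |∫ z, Real.exp (lg z) * H z ∂vol2| ≤ ℓ * ∫ z, Real.exp (lg z) * D z ∂vol2 := by
    have : |2 * ∫ z, Real.exp (lg z) * H z ∂vol2| ≤ 2 * (ℓ * ∫ z, Real.exp (lg z) * D z ∂vol2) := by
      rw [e2, ← e4]; exact e3
    rw [abs_mul, abs_two] at this
    linarith
  calc c.toReal * |∫ z, Real.exp (lg z) * H z ∂vol2|
      ≤ c.toReal * (ℓ * ∫ z, Real.exp (lg z) * D z ∂vol2) := by gcongr
    _ = ℓ * ∫ z, D (Ψ z) ∂(π.prod (gaus n)) := by rw [hinteg D hDc]; ring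
    _ ≤ ℓ * ∫ z : EV n × EV n, s ^ 3 * (K * ((1 + ‖z.1‖) ^ 3 * (1 + ‖z.2‖) ^ 3)) ∂(π.prod (gaus n)) := by
        exact mul_le_mul_of_nonneg_left
          (integral_mono hDi' ((hP.const_mul K).const_mul (s ^ 3)) hDb) hℓ
    _ = _ := by rw [integral_const_mul, integral_const_mul]; ring

/-- One step of the discretised Langevin semigroup. -/
def Pop {n : ℕ} (g : EV n → EV n) (s : ℝ) (f : EV n → ℝ) : EV n → ℝ :=
  fun x => ∫ w, f ((x - s ^ 2 • g x) + s • w) ∂(gaus n)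

/-- Bounded continuous Lipschitz test functions. -/
def BL {n : ℕ} (M ℓ : ℝ) (f : EV n → ℝ) : Prop :=
  Continuous f ∧ (∀ x, |f x| ≤ M) ∧ ∀ x y, |f x - f y| ≤ ℓ * ‖x - y‖

lemma Pop_BL {n : ℕ} {g : EV n → EV n} {s q M ℓ : ℝ} (hℓ : 0 ≤ ℓ) (hq : 0 ≤ q)
    (hT : ∀ x y, ‖(x - s ^ 2 • g x) - (y - s ^ 2 • g y)‖ ≤ q * ‖x - y‖)
    {f : EV n → ℝ} (hf : BL M ℓ f) : BL M (q * ℓ) (Pop g s f) := by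
  obtain ⟨hc, hM, hl⟩ := hf
  have hi : ∀ v : EV n, Integrable (fun w => f (v + s • w)) (gaus n) := fun v =>
    Integrable.of_bound (by fun_prop) M (ae_of_all _ fun z => hM _)
  have hlip : ∀ x y, |Pop g s f x - Pop g s f y| ≤ (q * ℓ) * ‖x - y‖ := by
    intro x y
    rw [Pop, Pop, ← integral_sub (hi _) (hi _), ← Real.norm_eq_abs]
    refine (norm_integral_le_of_norm_le_const (C := (q * ℓ) * ‖x - y‖)
      (ae_of_all _ fun w => ?_)).trans (by simp)
    rw [Real.norm_eq_abs]
    refine (hl _ _).trans ?_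
    rw [add_sub_add_right_eq_sub]
    calc _ ≤ ℓ * (q * ‖x - y‖) := by gcongr; exact hT x y
      _ = _ := by ring
  refine ⟨?_, fun x => ?_, hlip⟩
  · refine (LipschitzWith.of_dist_le_mul (K := ⟨q * ℓ, by positivity⟩) fun x y => ?_).continuous
    rw [Real.dist_eq, dist_eq_norm]
    exact hlip x y
  · rw [Pop, ← Real.norm_eq_abs]
    exact (norm_integral_le_of_norm_le_const (C := M)
      (ae_of_all _ fun w => hM _)).trans (by simp)

lemma Pop_iter_BL {n : ℕ} {g : EV n → EV n} {s q M ℓ : ℝ} (hℓ : 0 ≤ ℓ) (hq : 0 ≤ q)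
    (hT : ∀ x y, ‖(x - s ^ 2 • g x) - (y - s ^ 2 • g y)‖ ≤ q * ‖x - y‖)
    {f : EV n → ℝ} (hf : BL M ℓ f) (k : ℕ) : BL M (q ^ k * ℓ) ((Pop g s)^[k] f) := by
  induction k with
  | zero => simpa using hf
  | succ k ih =>
    rw [Function.iterate_succ_apply', pow_succ', mul_assoc]
    exact Pop_BL (by positivity) hq hT ih

lemma chain_conv {n : ℕ} {V : EV n → ℝ} (hV : GoodPot V) {g : EV n → EV n} {L : ℝ} (hL : 0 ≤ L)
    (hg : ∀ x y, ‖g x - g y‖ ≤ L * ‖x - y‖) (hgc : Continuous g)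
    (hsub : ∀ x y, V x + inner ℝ (g x) (y - x) ≤ V y) {κ : ℝ} (hκ : 0 < κ) :
    ∃ C : ℝ, 0 ≤ C ∧ ∀ s : ℝ, 0 < s → s ≤ 1 → 0 ≤ 1 - s ^ 2 * κ →
      (∀ x y, ‖(x - s ^ 2 • g x) - (y - s ^ 2 • g y)‖ ≤ (1 - s ^ 2 * κ) * ‖x - y‖) →
      ∀ k : ℕ, (1 - s ^ 2 * κ) ^ k ≤ s → ∀ M ℓ : ℝ, 0 ≤ ℓ → ∀ f : EV n → ℝ, BL M ℓ f →
      |(Pop g s)^[k] f 0 - ∫ x, f x ∂(densMeasure fun x => Real.exp (-V x))| ≤ ℓ * C * s := by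
  obtain ⟨C, hC, hone⟩ := one_step hV hL hg hgc hsub
  set π := densMeasure fun x => Real.exp (-V x) with hπ
  have hπp : IsProbabilityMeasure π := hV.prob
  have hn1 : Integrable (fun x : EV n => ‖x‖) π := by
    refine (hV.integrable hV.int3).mono' (by fun_prop) (ae_of_all _ fun x => ?_)
    rw [norm_norm]
    have : 0 ≤ ‖x‖ := norm_nonneg x
    nlinarith [pow_nonneg this 2, pow_nonneg this 3]
  refine ⟨C / κ + ∫ x, ‖x‖ ∂π, add_nonneg (by positivity)
    (integral_nonneg fun x => norm_nonneg x), ?_⟩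
  intro s hs hs1 hq hT k hk M ℓ hℓ f hf
  set q := 1 - s ^ 2 * κ with hqd
  have A : ∀ k : ℕ, ∀ ℓ : ℝ, 0 ≤ ℓ → ∀ f : EV n → ℝ, BL M ℓ f →
      |∫ x, (Pop g s)^[k] f x ∂π - ∫ x, f x ∂π| ≤ ℓ * (C / κ * s) := by
    intro k
    induction k with
    | zero =>
      intro ℓ hℓ f hf
      simp only [Function.iterate_zero, id_eq, sub_self, abs_zero]
      positivity
    | succ k ih =>
      intro ℓ hℓ f hf
      rw [Function.iterate_succ_apply]
      have h1 := ih (q * ℓ) (by positivity) (Pop g s f) (Pop_BL hℓ hq hT hf)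
      have h2 := hone s hs hs1 f hf.1 ⟨M, hf.2.1⟩ ℓ hℓ hf.2.2
      have h3 : ∫ x, Pop g s f x ∂π =
        ∫ x, (∫ w, f ((x - s ^ 2 • g x) + s • w) ∂(gaus n)) ∂π := rfl
      rw [← h3] at h2
      have h4 := abs_sub_le (∫ x, (Pop g s)^[k] (Pop g s f) x ∂π) (∫ x, Pop g s f x ∂π)
        (∫ x, f x ∂π)
      have h5 : q * ℓ * (C / κ * s) + ℓ * (C * s ^ 3) = ℓ * (C / κ * s) := by
        rw [hqd]; field_simp; ring
      linarith
  have B := Pop_iter_BL hℓ hq hT hf k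
  have h1 := A k ℓ hℓ f hf
  have h2 : |(Pop g s)^[k] f 0 - ∫ x, (Pop g s)^[k] f x ∂π| ≤ q ^ k * ℓ * ∫ x, ‖x‖ ∂π := by
    have hi : Integrable ((Pop g s)^[k] f) π :=
      Integrable.of_bound B.1.aestronglyMeasurable M (ae_of_all _ fun z => B.2.1 _)
    have : (Pop g s)^[k] f 0 - ∫ x, (Pop g s)^[k] f x ∂π =
        ∫ x, ((Pop g s)^[k] f 0 - (Pop g s)^[k] f x) ∂π := by
      rw [integral_sub (integrable_const _) hi]; simp
    rw [this, ← integral_const_mul, ← Real.norm_eq_abs]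
    refine norm_integral_le_of_norm_le (hn1.const_mul _) (ae_of_all _ fun x => ?_)
    have := B.2.2 0 x
    rwa [zero_sub, norm_neg] at this
  have h3 : q ^ k * ℓ * ∫ x, ‖x‖ ∂π ≤ s * ℓ * ∫ x, ‖x‖ ∂π := by
    have : 0 ≤ ∫ x, ‖x‖ ∂π := integral_nonneg fun x => norm_nonneg x
    gcongr
  have h4 := abs_sub_le ((Pop g s)^[k] f 0) (∫ x, (Pop g s)^[k] f x ∂π) (∫ x, f x ∂π)
  have h5 : ℓ * (C / κ + ∫ x, ‖x‖ ∂π) * s = ℓ * (C / κ * s) + s * ℓ * ∫ x, ‖x‖ ∂π := by ring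
  linarith

/-- Synchronously coupled chains. -/
def claw {n : ℕ} (g g' : EV n → EV n) (s : ℝ) : ℕ → Measure (EV n × EV n)
  | 0 => Measure.dirac (0, 0)
  | k + 1 => ((claw g g' s k).prod (gaus n)).map fun z =>
      ((z.1.1 - s ^ 2 • g z.1.1) + s • z.2, (z.1.2 - s ^ 2 • g' z.1.2) + s • z.2)

lemma claw_prob {n : ℕ} {g g' : EV n → EV n} (hg : Continuous g) (hg' : Continuous g') (s : ℝ)
    (k : ℕ) : IsProbabilityMeasure (claw g g' s k) := by
  induction k with
  | zero => rw [claw]; infer_instance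
  | succ k ih =>
    rw [claw]
    exact Measure.isProbabilityMeasure_map (by fun_prop)

lemma claw_fst {n : ℕ} {g g' : EV n → EV n} (hg : Continuous g) (hg' : Continuous g') {s q : ℝ}
    (hq : 0 ≤ q)
    (hT : ∀ x y, ‖(x - s ^ 2 • g x) - (y - s ^ 2 • g y)‖ ≤ q * ‖x - y‖)
    (k : ℕ) : ∀ M ℓ : ℝ, 0 ≤ ℓ → ∀ f : EV n → ℝ, BL M ℓ f →
      ∫ z, f z.1 ∂(claw g g' s k) = (Pop g s)^[k] f 0 := by
  induction k with
  | zero =>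
    intro M ℓ hℓ f hf
    have := hf.1
    rw [claw, integral_dirac]
    rfl
  | succ k ih =>
    intro M ℓ hℓ f hf
    have hfc := hf.1
    have := claw_prob hg hg' s k
    rw [claw, integral_map (by fun_prop) (by fun_prop), integral_prod]
    · rw [Function.iterate_succ_apply, ← ih M (q * ℓ) (by positivity) _ (Pop_BL hℓ hq hT hf)]
      rfl
    · exact Integrable.of_bound (by fun_prop) M (ae_of_all _ fun z => hf.2.1 _)

lemma claw_snd {n : ℕ} {g g' : EV n → EV n} (hg : Continuous g) (hg' : Continuous g') {s q : ℝ}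
    (hq : 0 ≤ q)
    (hT : ∀ x y, ‖(x - s ^ 2 • g' x) - (y - s ^ 2 • g' y)‖ ≤ q * ‖x - y‖)
    (k : ℕ) : ∀ M ℓ : ℝ, 0 ≤ ℓ → ∀ f : EV n → ℝ, BL M ℓ f →
      ∫ z, f z.2 ∂(claw g g' s k) = (Pop g' s)^[k] f 0 := by
  induction k with
  | zero =>
    intro M ℓ hℓ f hf
    have := hf.1
    rw [claw, integral_dirac]
    rfl
  | succ k ih =>
    intro M ℓ hℓ f hf
    have hfc := hf.1
    have := claw_prob hg hg' s k
    rw [claw, integral_map (by fun_prop) (by fun_prop), integral_prod]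
    · rw [Function.iterate_succ_apply, ← ih M (q * ℓ) (by positivity) _ (Pop_BL hℓ hq hT hf)]
      rfl
    · exact Integrable.of_bound (by fun_prop) M (ae_of_all _ fun z => hf.2.1 _)

lemma claw_close {n : ℕ} {g g' : EV n → EV n} (hg : Continuous g) (hg' : Continuous g') {s r : ℝ}
    (hr : 0 ≤ r)
    (hT : ∀ x y, ‖x - y‖ ≤ r → ‖(x - s ^ 2 • g x) - (y - s ^ 2 • g' y)‖ ≤ r)
    (k : ℕ) : ∀ᵐ z ∂(claw g g' s k), ‖z.1 - z.2‖ ≤ r := by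
  have hF : MeasurableSet {z : EV n × EV n | ‖z.1 - z.2‖ ≤ r} :=
    (isClosed_le (by fun_prop) continuous_const).measurableSet
  induction k with
  | zero =>
    rw [claw, ae_dirac_iff hF]
    simpa using hr
  | succ k ih =>
    have := claw_prob hg hg' s k
    rw [claw, ae_map_iff (by fun_prop) hF]
    have h1 : ∀ᵐ z ∂((claw g g' s k).prod (gaus n)), ‖z.1.1 - z.1.2‖ ≤ r :=
      Measure.quasiMeasurePreserving_fst.ae ih
    filter_upwards [h1] with z hz
    rw [add_sub_add_right_eq_sub]
    exact hT _ _ hz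

lemma contraction_step {n : ℕ} {g : EV n → EV n} {L κ κ' h : ℝ}
    (hg : ∀ x y, ‖g x - g y‖ ≤ L * ‖x - y‖)
    (hmon : ∀ x y, κ * ‖x - y‖ ^ 2 ≤ inner ℝ (g x - g y) (x - y))
    (hh : 0 < h) (hhL : h * L ^ 2 ≤ 2 * (κ - κ')) (hq : 0 ≤ 1 - h * κ') (x y : EV n) :
    ‖(x - h • g x) - (y - h • g y)‖ ≤ (1 - h * κ') * ‖x - y‖ := by
  have e : (x - h • g x) - (y - h • g y) = (x - y) - h • (g x - g y) := by
    rw [smul_sub]; abel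
  rw [e]
  refine le_of_sq_le_sq ?_ (by positivity)
  rw [norm_sub_sq_real, norm_smul, inner_smul_right, Real.norm_of_nonneg hh.le, real_inner_comm]
  have h1 := hmon x y
  have h2 := hg x y
  have h3 : ‖g x - g y‖ ^ 2 ≤ L ^ 2 * ‖x - y‖ ^ 2 := by
    rw [← mul_pow]; gcongr
  have h4 : h * (κ * ‖x - y‖ ^ 2) ≤ h * inner ℝ (g x - g y) (x - y) := by gcongr
  have h5 : h ^ 2 * ‖g x - g y‖ ^ 2 ≤ h ^ 2 * (L ^ 2 * ‖x - y‖ ^ 2) := by gcongr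
  have h6 : h * (h * L ^ 2) * ‖x - y‖ ^ 2 ≤ h * (2 * (κ - κ')) * ‖x - y‖ ^ 2 := by gcongr
  have h7 : 0 ≤ h ^ 2 * κ' ^ 2 * ‖x - y‖ ^ 2 := by positivity
  nlinarith

lemma tendsto_of_BL {n : ℕ} (μs : ℕ → ProbabilityMeasure (EV n)) (μ : ProbabilityMeasure (EV n))
    (s : ℕ → ℝ) (hs : Tendsto s atTop (𝓝 0)) (C : ℝ)
    (h : ∀ j, ∀ M ℓ : ℝ, 0 ≤ ℓ → ∀ f : EV n → ℝ, BL M ℓ f →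
      |∫ x, f x ∂(μs j : Measure (EV n)) - ∫ x, f x ∂(μ : Measure (EV n))| ≤ ℓ * C * s j) :
    Tendsto μs atTop (𝓝 μ) := by
  rw [tendsto_iff_forall_lipschitz_integral_tendsto]
  rintro f ⟨D, hD⟩ ⟨L, hL⟩
  have hf : BL (|f 0| + D) (L : ℝ) f := by
    refine ⟨hL.continuous, fun x => ?_, fun x y => ?_⟩
    · have h1 := hD x 0
      rw [Real.dist_eq] at h1
      have h2 := abs_sub_abs_le_abs_sub (f x) (f 0)
      linarith
    · have := hL.dist_le_mul x y
      rwa [Real.dist_eq, dist_eq_norm] at this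
  have h0 : Tendsto (fun j => (L : ℝ) * C * s j) atTop (𝓝 0) := by
    simpa using hs.const_mul ((L : ℝ) * C)
  rw [tendsto_iff_norm_sub_tendsto_zero]
  exact squeeze_zero (fun j => norm_nonneg _) (fun j => h j _ _ L.2 f hf) h0

lemma smooth_case {n : ℕ} {V V' : EV n → ℝ} (hV : GoodPot V) (hV' : GoodPot V')
    {g g' : EV n → EV n} {b : EV n} (hgg : ∀ x, g' x = g x - b) {L κ κ' r : ℝ} (hL : 0 ≤ L)
    (hg : ∀ x y, ‖g x - g y‖ ≤ L * ‖x - y‖)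
    (hmon : ∀ x y, κ * ‖x - y‖ ^ 2 ≤ inner ℝ (g x - g y) (x - y))
    (hsub : ∀ x y, V x + inner ℝ (g x) (y - x) ≤ V y)
    (hsub' : ∀ x y, V' x + inner ℝ (g' x) (y - x) ≤ V' y)
    (hκ' : 0 < κ') (hκκ : κ' < κ) (hr : 0 ≤ r) (hb : ‖b‖ ≤ κ' * r) :
    HasCpl (densMeasure fun x => Real.exp (-V x)) (densMeasure fun x => Real.exp (-V' x)) r := by
  have hdiff : ∀ x y, g' x - g' y = g x - g y := fun x y => by rw [hgg, hgg]; abel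
  have hg' : ∀ x y, ‖g' x - g' y‖ ≤ L * ‖x - y‖ := fun x y => by rw [hdiff]; exact hg x y
  have hmon' : ∀ x y, κ * ‖x - y‖ ^ 2 ≤ inner ℝ (g' x - g' y) (x - y) :=
    fun x y => by rw [hdiff]; exact hmon x y
  have hgc : Continuous g := by
    refine (LipschitzWith.of_dist_le_mul (K := ⟨L, hL⟩) fun x y => ?_).continuous
    rw [dist_eq_norm, dist_eq_norm]; exact hg x y
  have hgc' : Continuous g' := by
    refine (LipschitzWith.of_dist_le_mul (K := ⟨L, hL⟩) fun x y => ?_).continuous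
    rw [dist_eq_norm, dist_eq_norm]; exact hg' x y
  obtain ⟨C, hC, h1⟩ := chain_conv hV hL hg hgc hsub hκ'
  obtain ⟨C', hC', h1'⟩ := chain_conv hV' hL hg' hgc' hsub' hκ'
  obtain ⟨s₀, hs0, hs01, hsa, hsb⟩ : ∃ s₀ : ℝ, 0 < s₀ ∧ s₀ ≤ 1 ∧ s₀ * L ^ 2 ≤ 2 * (κ - κ') ∧
      s₀ * κ' ≤ 1 := by
    have p1 : 0 < κ - κ' := by linarith
    refine ⟨min 1 (min (2 * (κ - κ') / (L ^ 2 + 1)) (1 / κ')), by positivity, min_le_left _ _, ?_, ?_⟩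
    · have : min 1 (min (2 * (κ - κ') / (L ^ 2 + 1)) (1 / κ')) ≤ 2 * (κ - κ') / (L ^ 2 + 1) :=
        (min_le_right _ _).trans (min_le_left _ _)
      calc _ ≤ 2 * (κ - κ') / (L ^ 2 + 1) * (L ^ 2 + 1) := by gcongr; linarith
        _ = _ := by field_simp
    · have : min 1 (min (2 * (κ - κ') / (L ^ 2 + 1)) (1 / κ')) ≤ 1 / κ' :=
        (min_le_right _ _).trans (min_le_right _ _)
      calc _ ≤ 1 / κ' * κ' := by gcongr
        _ = _ := by field_simp
  let s : ℕ → ℝ := fun j => s₀ * (1 / ((j : ℝ) + 1))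
  have hspos : ∀ j, 0 < s j := fun j => by positivity
  have hsle : ∀ j, s j ≤ s₀ := fun j => by
    refine mul_le_of_le_one_right hs0.le ?_
    rw [div_le_one (by positivity)]
    linarith [(Nat.cast_nonneg j : (0:ℝ) ≤ j)]
  have hs1 : ∀ j, s j ≤ 1 := fun j => (hsle j).trans hs01
  have hs2 : ∀ j, s j ^ 2 ≤ s₀ := fun j => by
    have := hspos j; have := hs1 j; have := hsle j
    nlinarith
  have hst : Tendsto s atTop (𝓝 0) := by
    have h := (tendsto_one_div_add_atTop_nhds_zero_nat (𝕜 := ℝ)).const_mul s₀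
    rw [mul_zero] at h
    exact h
  have hq0 : ∀ j, 0 ≤ 1 - s j ^ 2 * κ' := fun j => by
    have : s j ^ 2 * κ' ≤ s₀ * κ' := by gcongr; exact hs2 j
    linarith
  have hq1 : ∀ j, 1 - s j ^ 2 * κ' < 1 := fun j => by
    have : 0 < s j ^ 2 * κ' := by have := hspos j; positivity
    linarith
  have hhL : ∀ j, s j ^ 2 * L ^ 2 ≤ 2 * (κ - κ') := fun j => by
    have : s j ^ 2 * L ^ 2 ≤ s₀ * L ^ 2 := by gcongr; exact hs2 j
    linarith
  have hh : ∀ j, 0 < s j ^ 2 := fun j => by have := hspos j; positivity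
  have hT := fun j => contraction_step hg hmon (hh j) (hhL j) (hq0 j)
  have hT' := fun j => contraction_step hg' hmon' (hh j) (hhL j) (hq0 j)
  have hk : ∀ j, ∃ k : ℕ, (1 - s j ^ 2 * κ') ^ k < s j := fun j =>
    exists_pow_lt_of_lt_one (hspos j) (hq1 j)
  choose k hk using hk
  let γ := fun j => claw g g' (s j) (k j)
  have hγ : ∀ j, IsProbabilityMeasure (γ j) := fun j => claw_prob hgc hgc' _ _
  let μs : ℕ → ProbabilityMeasure (EV n) := fun j =>
    ⟨(γ j).map Prod.fst, Measure.isProbabilityMeasure_map (by fun_prop)⟩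
  let νs : ℕ → ProbabilityMeasure (EV n) := fun j =>
    ⟨(γ j).map Prod.snd, Measure.isProbabilityMeasure_map (by fun_prop)⟩
  refine hasCpl_limit μs νs ⟨_, hV.prob⟩ ⟨_, hV'.prob⟩ ?_ ?_ r fun j => ⟨γ j, hγ j, ⟨rfl, rfl⟩, ?_⟩
  · refine tendsto_of_BL _ _ s hst C fun j M ℓ hℓ f hf => ?_
    have hfc := hf.1
    have e : ∫ x, f x ∂(μs j : Measure (EV n)) = (Pop g (s j))^[k j] f 0 := by
      rw [← claw_fst hgc hgc' (hq0 j) (hT j) (k j) M ℓ hℓ f hf]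
      exact integral_map (by fun_prop) (by fun_prop)
    rw [e]
    exact h1 (s j) (hspos j) (hs1 j) (hq0 j) (hT j) (k j) (hk j).le M ℓ hℓ f hf
  · refine tendsto_of_BL _ _ s hst C' fun j M ℓ hℓ f hf => ?_
    have hfc := hf.1
    have e : ∫ x, f x ∂(νs j : Measure (EV n)) = (Pop g' (s j))^[k j] f 0 := by
      rw [← claw_snd hgc hgc' (hq0 j) (hT' j) (k j) M ℓ hℓ f hf]
      exact integral_map (by fun_prop) (by fun_prop)
    rw [e]
    exact h1' (s j) (hspos j) (hs1 j) (hq0 j) (hT' j) (k j) (hk j).le M ℓ hℓ f hf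
  · refine claw_close hgc hgc' hr (fun x y hxy => ?_) _
    have e : (x - s j ^ 2 • g x) - (y - s j ^ 2 • g' y) =
        ((x - s j ^ 2 • g x) - (y - s j ^ 2 • g y)) - s j ^ 2 • b := by
      rw [hgg, smul_sub]; abel
    rw [e]
    have a1 := hT j x y
    have a2 : (1 - s j ^ 2 * κ') * ‖x - y‖ ≤ (1 - s j ^ 2 * κ') * r :=
      mul_le_mul_of_nonneg_left hxy (hq0 j)
    have a3 : s j ^ 2 * ‖b‖ ≤ s j ^ 2 * (κ' * r) := mul_le_mul_of_nonneg_left hb (hh j).le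
    have a4 : ‖s j ^ 2 • b‖ = s j ^ 2 * ‖b‖ := by rw [norm_smul, Real.norm_of_nonneg (hh j).le]
    have a5 := norm_sub_le ((x - s j ^ 2 • g x) - (y - s j ^ 2 • g y)) (s j ^ 2 • b)
    linarith

/-- Existence of the proximal point, together with the strong subgradient inequality. -/
lemma prox_exists {n : ℕ} {U : EV n → ℝ} {m c l : ℝ} (hl : 0 < l)
    (hU : Continuous U) (hc : ∀ z, c ≤ U z)
    (hsc : ConvexOn ℝ Set.univ fun z => U z - m / 2 * ‖z‖ ^ 2) (x : EV n) :
    ∃ p : EV n, ∀ z, U p + (1 / l) * inner ℝ (x - p) (z - p) + m / 2 * ‖z - p‖ ^ 2 ≤ U z := by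
  have hcoer : Tendsto (fun z : EV n => U z + ‖x - z‖ ^ 2 / (2 * l)) (cocompact (EV n)) atTop := by
    have h1 : Tendsto (fun z : EV n => ‖z‖) (cocompact (EV n)) atTop :=
      tendsto_norm_cocompact_atTop
    have h2 : Tendsto (fun z : EV n => c + ‖x - z‖ ^ 2 / (2 * l)) (cocompact (EV n)) atTop := by
      apply tendsto_atTop_add_const_left
      apply Tendsto.atTop_div_const (by positivity)
      apply (tendsto_pow_atTop (two_ne_zero)).comp
      refine tendsto_atTop_mono (fun z => ?_) (tendsto_atTop_add_const_right _ (-‖x‖) h1)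
      have := norm_sub_norm_le z x
      rw [norm_sub_rev] at this
      linarith
    exact tendsto_atTop_mono (fun z => by have := hc z; linarith) h2
  obtain ⟨p, hp⟩ := Continuous.exists_forall_le (f := fun z : EV n => U z + ‖x - z‖ ^ 2 / (2 * l))
    (by fun_prop) hcoer
  refine ⟨p, fun z => ?_⟩
  -- for all t in (0,1), compare `p` with `p + t (z - p)`
  have key : ∀ t : ℝ, 0 < t → t < 1 →
      U p + (1 / l) * inner ℝ (x - p) (z - p) + m / 2 * ‖z - p‖ ^ 2
        ≤ U z + t * ((1 / (2 * l) + m / 2) * ‖z - p‖ ^ 2) := by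
    intro t ht ht1
    have h1 := hsc.2 (Set.mem_univ p) (Set.mem_univ z) (by linarith : 0 ≤ 1 - t) ht.le (by ring)
    have h2 := hp ((1 - t) • p + t • z)
    simp only [smul_eq_mul] at h1 h2
    have e1 : (1 - t) • p + t • z = p + t • (z - p) := by module
    have e2 : x - (p + t • (z - p)) = (x - p) - t • (z - p) := by abel
    have e3 : ‖(x - p) - t • (z - p)‖ ^ 2
        = ‖x - p‖ ^ 2 - 2 * (t * inner ℝ (x - p) (z - p)) + t ^ 2 * ‖z - p‖ ^ 2 := by
      rw [norm_sub_sq_real, inner_smul_right, norm_smul, mul_pow, Real.norm_eq_abs, sq_abs]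
    have e4 : ‖p + t • (z - p)‖ ^ 2
        = ‖p‖ ^ 2 + 2 * (t * inner ℝ p (z - p)) + t ^ 2 * ‖z - p‖ ^ 2 := by
      rw [norm_add_sq_real, inner_smul_right, norm_smul, mul_pow, Real.norm_eq_abs, sq_abs]
    have e5 : ‖z‖ ^ 2 = ‖p‖ ^ 2 + 2 * inner ℝ p (z - p) + ‖z - p‖ ^ 2 := by
      rw [← norm_add_sq_real]; congr 2; abel
    rw [e1] at h1 h2
    rw [e2, e3] at h2
    rw [e4, e5] at h1
    generalize inner ℝ (x - p) (z - p) = I at *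
    generalize inner ℝ p (z - p) = J at *
    generalize ‖z - p‖ ^ 2 = D at *
    generalize U (p + t • (z - p)) = u at *
    have h3 : U p + (1 / l) * (t * I) - t ^ 2 * D / (2 * l) ≤ u := by
      have : (‖x - p‖ ^ 2 - 2 * (t * I) + t ^ 2 * D) / (2 * l)
        = ‖x - p‖ ^ 2 / (2 * l) - (1 / l) * (t * I) + t ^ 2 * D / (2 * l) := by field_simp
      linarith
    have h4 : t * (U p + (1 / l) * I + m / 2 * D) ≤ t * (U z + t * ((1 / (2 * l) + m / 2) * D)) := by
      have : t ^ 2 * D / (2 * l) = t * (t * (1 / (2 * l) * D)) := by field_simp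
      linear_combination h1 + h3 + this
    exact le_of_mul_le_mul_left h4 ht
  have hlim : Tendsto (fun t : ℝ => U z + t * ((1 / (2 * l) + m / 2) * ‖z - p‖ ^ 2)) (𝓝[>] 0)
      (𝓝 (U z)) := by
    have : Tendsto (fun t : ℝ => U z + t * ((1 / (2 * l) + m / 2) * ‖z - p‖ ^ 2)) (𝓝 0)
      (𝓝 (U z + 0 * ((1 / (2 * l) + m / 2) * ‖z - p‖ ^ 2))) :=
      Continuous.tendsto (by fun_prop) 0
    rw [zero_mul, add_zero] at this
    exact this.mono_left nhdsWithin_le_nhds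
  refine ge_of_tendsto hlim ?_
  filter_upwards [Ioo_mem_nhdsGT (zero_lt_one' ℝ)] with t ht
  exact key t ht.1 ht.2

/-- The Moreau envelope and its properties. -/
lemma moreau {n : ℕ} {U : EV n → ℝ} {m c l : ℝ} (hm : 0 ≤ m) (hl : 0 < l)
    (hU : Continuous U) (hc : ∀ z, c ≤ U z)
    (hsc : ConvexOn ℝ Set.univ fun z => U z - m / 2 * ‖z‖ ^ 2) :
    ∃ (W : EV n → ℝ) (g : EV n → EV n),
      Continuous W ∧ (∀ x, c ≤ W x) ∧
      (∀ x, ∃ p, ‖x - p‖ ^ 2 ≤ 2 * l * (U x - c) ∧ U p ≤ W x ∧ W x ≤ U x) ∧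
      (∀ x y, W x + inner ℝ (g x) (y - x) ≤ W y) ∧
      (∀ x y, ‖g x - g y‖ ≤ (1 / l) * ‖x - y‖) ∧
      (∀ x y, m / (1 + l * m) * ‖x - y‖ ^ 2 ≤ inner ℝ (g x - g y) (x - y)) := by
  choose p hp using prox_exists hl hU hc hsc
  set g : EV n → EV n := fun x => (1 / l) • (x - p x) with hg
  set W : EV n → ℝ := fun x => U (p x) + l / 2 * ‖g x‖ ^ 2 with hW
  have hxp : ∀ x, x - p x = l • g x := fun x => by
    simp only [hg, smul_smul]; rw [mul_one_div_cancel hl.ne', one_smul]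
  have hs : ∀ x z, U (p x) + inner ℝ (g x) (z - p x) + m / 2 * ‖z - p x‖ ^ 2 ≤ U z := fun x z => by
    have := hp x z
    simp only [hg, inner_smul_left]
    simpa using this
  have hs2 : ∀ x y, W x + inner ℝ (g x) (y - x) + l / 2 * ‖g y - g x‖ ^ 2 ≤ W y := fun x y => by
    have h1 := hs x (p y)
    have e : p y - p x = (y - x) - l • (g y - g x) := by
      rw [smul_sub, ← hxp, ← hxp]; abel
    have h2 : 0 ≤ m / 2 * ‖p y - p x‖ ^ 2 := by positivity
    have e2 : inner ℝ (g x) (p y - p x)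
        = inner ℝ (g x) (y - x) - l * (inner ℝ (g x) (g y) - ‖g x‖ ^ 2) := by
      rw [e, inner_sub_right (g x) (y - x), inner_smul_right, inner_sub_right (g x) (g y),
        real_inner_self_eq_norm_sq]
    rw [e2] at h1
    have h3 := norm_sub_sq_real (g y) (g x)
    rw [real_inner_comm] at h3
    simp only [hW]
    nlinarith
  have hco : ∀ x y, l * ‖g x - g y‖ ^ 2 ≤ inner ℝ (g x - g y) (x - y) := fun x y => by
    have h1 := hs2 x y
    have h2 := hs2 y x
    rw [norm_sub_rev] at h1
    have : inner ℝ (g x - g y) (x - y) = -inner ℝ (g x) (y - x) - inner ℝ (g y) (x - y) := by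
      rw [inner_sub_left, ← inner_neg_right, neg_sub]
    rw [this]; linarith
  have hlip : ∀ x y, ‖g x - g y‖ ≤ (1 / l) * ‖x - y‖ := fun x y => by
    have h1 := (hco x y).trans (real_inner_le_norm _ _)
    rcases (norm_nonneg (g x - g y)).eq_or_lt with h0 | h0
    · rw [← h0]; positivity
    · rw [one_div_mul_eq_div, le_div_iff₀ hl]
      have : ‖g x - g y‖ * (‖g x - g y‖ * l) ≤ ‖g x - g y‖ * ‖x - y‖ := by linarith
      exact le_of_mul_le_mul_left this h0
  have hsub : ∀ x y, W x + inner ℝ (g x) (y - x) ≤ W y := fun x y => by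
    have := hs2 x y
    have h2 : 0 ≤ l / 2 * ‖g y - g x‖ ^ 2 := by positivity
    linarith
  have hgc : Continuous g := by
    have : LipschitzWith (Real.toNNReal (1 / l)) g := LipschitzWith.of_dist_le_mul fun x y => by
      rw [dist_eq_norm, dist_eq_norm, Real.coe_toNNReal _ (by positivity)]; exact hlip x y
    exact this.continuous
  refine ⟨W, g, ?_, fun x => ?_, fun x => ⟨p x, ?_⟩, hsub, hlip, fun x y => ?_⟩
  · rw [continuous_iff_continuousAt]
    intro x
    have l1 : Tendsto (fun y => W x + inner ℝ (g x) (y - x)) (𝓝 x) (𝓝 (W x)) := by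
      have : Continuous fun y => W x + inner ℝ (g x) (y - x) := by fun_prop
      simpa using this.tendsto x
    have l2 : Tendsto (fun y => W x - inner ℝ (g y) (x - y)) (𝓝 x) (𝓝 (W x)) := by
      have : Continuous fun y => W x - inner ℝ (g y) (x - y) := by fun_prop
      simpa using this.tendsto x
    exact tendsto_of_tendsto_of_tendsto_of_le_of_le l1 l2 (fun y => hsub x y)
      (fun y => by have := hsub y x; simp only; linarith)
  · have := hc (p x)
    have h2 : 0 ≤ l / 2 * ‖g x‖ ^ 2 := by positivity
    simp only [hW]; linarith
  · have h1 := hs x x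
    rw [hxp x, inner_smul_right, real_inner_self_eq_norm_sq] at h1
    have h2 : 0 ≤ m / 2 * ‖l • g x‖ ^ 2 := by positivity
    have h3 : 0 ≤ l * ‖g x‖ ^ 2 := by positivity
    have h4 := hc (p x)
    refine ⟨?_, ?_, ?_⟩
    · rw [hxp x, norm_smul, mul_pow, Real.norm_eq_abs, sq_abs]
      have : l * ‖g x‖ ^ 2 ≤ U x - c := by linarith
      nlinarith
    · simp only [hW]; linarith
    · simp only [hW]; linarith
  · have h1 := hs x (p y)
    have h2 := hs y (p x)
    set a := p x - p y with ha
    set e := g x - g y with he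
    have exy : x - y = a + l • e := by
      rw [he, smul_sub, ← hxp, ← hxp, ha]; abel
    have h3 : m * ‖a‖ ^ 2 ≤ inner ℝ e a := by
      have q1 : p y - p x = -a := by rw [ha]; abel
      rw [q1, inner_neg_right, norm_neg] at h1
      rw [he, inner_sub_left]
      linarith
    have h4 : inner ℝ e (x - y) = inner ℝ e a + l * ‖e‖ ^ 2 := by
      rw [exy, inner_add_right, inner_smul_right, real_inner_self_eq_norm_sq]
    have h5 : ‖x - y‖ ^ 2 = ‖a‖ ^ 2 + 2 * (l * inner ℝ e a) + l ^ 2 * ‖e‖ ^ 2 := by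
      rw [exy, norm_add_sq_real, inner_smul_right, norm_smul, mul_pow, Real.norm_eq_abs, sq_abs,
        real_inner_comm]
    have h6 : 0 ≤ ‖e‖ ^ 2 - m * inner ℝ e a := by
      have q := norm_sub_sq_real e (m • a)
      rw [inner_smul_right, norm_smul, mul_pow, Real.norm_eq_abs, sq_abs] at q
      have q2 : 0 ≤ ‖e - m • a‖ ^ 2 := by positivity
      have q3 := mul_nonneg hm (sub_nonneg.2 h3)
      linarith
    have hpos : 0 < 1 + l * m := by positivity
    rw [h4, h5, div_mul_eq_mul_div, div_le_iff₀ hpos]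
    have q4 := mul_nonneg hl.le h6
    linarith

/-- The normalized probability measure of a good potential. -/
def GoodPot.pm {n : ℕ} {V : EV n → ℝ} (hV : GoodPot V) : ProbabilityMeasure (EV n) :=
  ⟨densMeasure fun x => Real.exp (-V x), hV.prob⟩

lemma dens_tendsto {n : ℕ} {Vs : ℕ → EV n → ℝ} {V : EV n → ℝ} (hVs : ∀ k, GoodPot (Vs k))
    (hV : GoodPot V) {F : EV n → ℝ} (hF : Integrable F)
    (hdom : ∀ k x, Real.exp (-Vs k x) ≤ F x)
    (hlim : ∀ x, Tendsto (fun k => Vs k x) atTop (𝓝 (V x))) :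
    Tendsto (fun k => (hVs k).pm) atTop (𝓝 hV.pm) := by
  rw [ProbabilityMeasure.tendsto_iff_forall_integral_tendsto]
  intro f
  simp only [GoodPot.pm, ProbabilityMeasure.coe_mk]
  have hcs : ∀ k, Continuous (Vs k) := fun k => (hVs k).1
  have hexp : ∀ x, Tendsto (fun k => Real.exp (-Vs k x)) atTop (𝓝 (Real.exp (-V x))) := fun x =>
    (Real.continuous_exp.tendsto _).comp (hlim x).neg
  have h1 : Tendsto (fun k => ∫ x, Real.exp (-Vs k x)) atTop (𝓝 (∫ x, Real.exp (-V x))) := by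
    refine tendsto_integral_of_dominated_convergence F
      (fun k => by have := hcs k; fun_prop) hF (fun k => ae_of_all _ fun x => ?_)
      (ae_of_all _ hexp)
    rw [Real.norm_of_nonneg (Real.exp_pos _).le]; exact hdom k x
  have h2 : Tendsto (fun k => ∫ x, Real.exp (-Vs k x) * f x) atTop
      (𝓝 (∫ x, Real.exp (-V x) * f x)) := by
    refine tendsto_integral_of_dominated_convergence (fun x => F x * ‖f‖)
      (fun k => ?_) (hF.mul_const _) (fun k => ae_of_all _ fun x => ?_)
      (ae_of_all _ fun x => (hexp x).mul_const _)
    · have := hcs k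
      have := f.continuous
      exact (Continuous.aestronglyMeasurable (by fun_prop))
    · rw [norm_mul, Real.norm_of_nonneg (Real.exp_pos _).le]
      exact mul_le_mul (hdom k x) (f.norm_coe_le_norm x) (norm_nonneg _)
        ((Real.exp_pos _).le.trans (hdom k x))
  have h3 : (∫ x, Real.exp (-V x)) ≠ 0 :=
    (integral_exp_pos hV.int).ne'
  have h4 := (h1.inv₀ h3).mul h2
  rw [hV.integral]
  refine h4.congr fun k => ?_
  rw [(hVs k).integral]

/-- Gaussian domination of shifted Gaussians. -/
lemma shift_dom {n : ℕ} {c ρ : ℝ} (hρ : 0 < ρ) (a : EV n) :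
    ∀ (u : ℝ) (x : EV n), c ≤ u → Real.exp (-(u + ‖x - a‖ ^ 2 / (2 * ρ ^ 2))) ≤
      Real.exp (-c + ‖a‖ ^ 2 / (2 * ρ ^ 2)) * Real.exp (-(1 / (4 * ρ ^ 2)) * ‖x‖ ^ 2) := by
  intro u x hu
  rw [← Real.exp_add]
  apply Real.exp_le_exp.2
  have h1 : ‖x‖ ≤ ‖x - a‖ + ‖a‖ := by
    have := norm_add_le (x - a) a
    rwa [sub_add_cancel] at this
  have h2 : ‖x‖ ^ 2 ≤ 2 * ‖x - a‖ ^ 2 + 2 * ‖a‖ ^ 2 := by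
    have := norm_nonneg x
    nlinarith [sq_nonneg (‖x - a‖ - ‖a‖), norm_nonneg (x - a), norm_nonneg a]
  have h3 : (1 / (4 * ρ ^ 2)) * ‖x‖ ^ 2 ≤ (1 / (4 * ρ ^ 2)) * (2 * ‖x - a‖ ^ 2 + 2 * ‖a‖ ^ 2) := by
    gcongr
  have h4 : (1 / (4 * ρ ^ 2)) * (2 * ‖x - a‖ ^ 2 + 2 * ‖a‖ ^ 2)
      = ‖x - a‖ ^ 2 / (2 * ρ ^ 2) + ‖a‖ ^ 2 / (2 * ρ ^ 2) := by field_simp; ring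
  linarith

lemma shift_good {n : ℕ} {c ρ : ℝ} (hρ : 0 < ρ) (a : EV n) {W : EV n → ℝ} (hW : Continuous W)
    (hc : ∀ x, c ≤ W x) : GoodPot (fun x => W x + ‖x - a‖ ^ 2 / (2 * ρ ^ 2)) :=
  ⟨by fun_prop, _, 1 / (4 * ρ ^ 2), by positivity, fun x => shift_dom hρ a (W x) x (hc x)⟩

lemma quad_sub {n : ℕ} {ρ : ℝ} (hρ : 0 < ρ) (a x y : EV n) :
    ‖x - a‖ ^ 2 / (2 * ρ ^ 2) + inner ℝ ((1 / ρ ^ 2) • (x - a)) (y - x)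
      ≤ ‖y - a‖ ^ 2 / (2 * ρ ^ 2) := by
  have h : ‖y - a‖ ^ 2 = ‖x - a‖ ^ 2 + 2 * inner ℝ (x - a) (y - x) + ‖y - x‖ ^ 2 := by
    rw [← norm_add_sq_real]; congr 2; abel
  have h2 : ‖y - a‖ ^ 2 / (2 * ρ ^ 2) = ‖x - a‖ ^ 2 / (2 * ρ ^ 2)
      + 1 / ρ ^ 2 * inner ℝ (x - a) (y - x) + ‖y - x‖ ^ 2 / (2 * ρ ^ 2) := by
    rw [h]; field_simp
  have h3 : 0 ≤ ‖y - x‖ ^ 2 / (2 * ρ ^ 2) := by positivity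
  rw [real_inner_smul_left, h2]
  linarith

lemma main_cpl {n : ℕ} {U : EV n → ℝ} {m ρ c : ℝ} (hρ : 0 < ρ) (hm : 0 ≤ m)
    (hc : ∀ z, c ≤ U z) (hU : Continuous U)
    (hsc : ConvexOn ℝ Set.univ fun z => U z - m / 2 * ‖z‖ ^ 2) (a a' : EV n) {r : ℝ}
    (hr : ‖a - a'‖ / (1 + ρ ^ 2 * m) < r) :
    HasCpl (densMeasure fun z : EV n => Real.exp (-(U z + ‖z - a‖ ^ 2 / (2 * ρ ^ 2))))
      (densMeasure fun z : EV n => Real.exp (-(U z + ‖z - a'‖ ^ 2 / (2 * ρ ^ 2)))) r := by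
  have hr0 : 0 < r := lt_of_le_of_lt (by positivity) hr
  set κ := 1 / ρ ^ 2 + m with hκ
  set b : EV n := (1 / ρ ^ 2) • (a' - a) with hb
  have hnb : ‖b‖ = ‖a - a'‖ / ρ ^ 2 := by
    rw [hb, norm_smul, Real.norm_of_nonneg (by positivity), norm_sub_rev]; ring
  have hκ0 : 0 < κ := by positivity
  have hbr : ‖b‖ / r < κ := by
    rw [div_lt_iff₀ (by positivity)] at hr
    rw [div_lt_iff₀ hr0, hnb, div_lt_iff₀ (by positivity)]
    have : κ * r * ρ ^ 2 = r * (1 + ρ ^ 2 * m) := by rw [hκ]; field_simp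
    linarith
  set κ' := (‖b‖ / r + κ) / 2 with hκ'
  have hbr0 : 0 ≤ ‖b‖ / r := by positivity
  have hκ'0 : 0 < κ' := by rw [hκ']; linarith
  have hκ'1 : κ' < κ := by rw [hκ']; linarith
  have hbκ : ‖b‖ ≤ κ' * r := by
    have : ‖b‖ / r ≤ κ' := by rw [hκ']; linarith
    rwa [div_le_iff₀ hr0] at this
  have hl0 : Tendsto (fun k : ℕ => 1 / ((k : ℝ) + 1)) atTop (𝓝 0) :=
    tendsto_one_div_add_atTop_nhds_zero_nat
  have hκl : Tendsto (fun k : ℕ => 1 / ρ ^ 2 + m / (1 + 1 / ((k : ℝ) + 1) * m)) atTop (𝓝 κ) := by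
    have h1 : Tendsto (fun k : ℕ => 1 + 1 / ((k : ℝ) + 1) * m) atTop (𝓝 (1 + 0 * m)) :=
      (hl0.mul_const m).const_add 1
    have h2 := ((tendsto_const_nhds (x := m)).div h1 (by simp)).const_add (1 / ρ ^ 2)
    rw [zero_mul, add_zero, div_one] at h2
    exact h2
  obtain ⟨k₀, hk₀⟩ := eventually_atTop.1 (hκl.eventually (lt_mem_nhds hκ'1))
  set l : ℕ → ℝ := fun k => 1 / (((k + k₀ : ℕ) : ℝ) + 1) with hl
  have hlpos : ∀ k, 0 < l k := fun k => by simp only [hl]; positivity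
  have hlt : Tendsto l atTop (𝓝 0) := hl0.comp (tendsto_add_atTop_nat k₀)
  have hlκ : ∀ k, κ' < 1 / ρ ^ 2 + m / (1 + l k * m) := fun k => hk₀ (k + k₀) (by omega)
  choose W g hWc hWb hWp hWs hWl hWm using fun k => moreau hm (hlpos k) hU hc hsc
  have hWlim : ∀ x, Tendsto (fun k => W k x) atTop (𝓝 (U x)) := by
    intro x
    choose p hp1 hp2 hp3 using fun k => hWp k x
    have hd : Tendsto (fun k => ‖x - p k‖ ^ 2) atTop (𝓝 0) := by
      have : Tendsto (fun k => 2 * l k * (U x - c)) atTop (𝓝 0) := by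
        have := (hlt.const_mul 2).mul_const (U x - c)
        rwa [mul_zero, zero_mul] at this
      exact squeeze_zero (fun k => by positivity) hp1 this
    have hd2 : Tendsto (fun k => ‖p k - x‖) atTop (𝓝 0) := by
      have := (Real.continuous_sqrt.tendsto 0).comp hd
      rw [Real.sqrt_zero] at this
      refine this.congr fun k => ?_
      simp only [Function.comp]
      rw [Real.sqrt_sq (norm_nonneg _), norm_sub_rev]
    have hpx : Tendsto p atTop (𝓝 x) := tendsto_iff_norm_sub_tendsto_zero.2 hd2
    exact tendsto_of_tendsto_of_tendsto_of_le_of_le ((hU.tendsto x).comp hpx) tendsto_const_nhds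
      hp2 hp3
  have hG : ∀ (a : EV n) k, GoodPot (fun x => W k x + ‖x - a‖ ^ 2 / (2 * ρ ^ 2)) := fun a k =>
    shift_good hρ a (hWc k) (hWb k)
  have hGU : ∀ a : EV n, GoodPot (fun x => U x + ‖x - a‖ ^ 2 / (2 * ρ ^ 2)) := fun a =>
    shift_good hρ a hU hc
  have hT : ∀ a : EV n, _ := fun a => dens_tendsto (hG a) (hGU a)
    ((gauss_int (n := n) (β := 1 / (4 * ρ ^ 2)) (by positivity)).const_mul
      (Real.exp (-c + ‖a‖ ^ 2 / (2 * ρ ^ 2))))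
    (fun k x => shift_dom hρ a (W k x) x (hWb k x)) (fun x => (hWlim x).add_const _)
  refine hasCpl_limit _ _ _ _ (hT a) (hT a') r fun k => ?_
  refine smooth_case (hG a k) (hG a' k) (g := fun x => g k x + (1 / ρ ^ 2) • (x - a))
    (g' := fun x => g k x + (1 / ρ ^ 2) • (x - a')) (b := b) (fun x => ?_)
    (L := 1 / l k + 1 / ρ ^ 2) (κ := 1 / ρ ^ 2 + m / (1 + l k * m)) (κ' := κ')
    (by have := hlpos k; positivity) (fun x y => ?_) (fun x y => ?_) (fun x y => ?_)
    (fun x y => ?_) hκ'0 (hlκ k) hr0.le hbκ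
  · rw [hb]; module
  · have e : g k x + (1 / ρ ^ 2) • (x - a) - (g k y + (1 / ρ ^ 2) • (y - a))
      = (g k x - g k y) + (1 / ρ ^ 2) • (x - y) := by module
    rw [e, add_mul]
    refine (norm_add_le _ _).trans (add_le_add (hWl k x y) ?_)
    rw [norm_smul, Real.norm_of_nonneg (by positivity)]
  · have e : g k x + (1 / ρ ^ 2) • (x - a) - (g k y + (1 / ρ ^ 2) • (y - a))
      = (g k x - g k y) + (1 / ρ ^ 2) • (x - y) := by module
    rw [e, inner_add_left, real_inner_smul_left, real_inner_self_eq_norm_sq]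
    have := hWm k x y
    linarith
  · rw [inner_add_left]
    have := hWs k x y
    have := quad_sub hρ a x y
    linarith
  · rw [inner_add_left]
    have := hWs k x y
    have := quad_sub hρ a' x y
    linarith

lemma HasCpl.wp_le {n : ℕ} {μ ν : Measure (EV n)} {r : ℝ} (h : HasCpl μ ν r) (hr : 0 ≤ r)
    {p : ℝ} (hp : 1 ≤ p) : Wp p (fun x y => ‖x - y‖) μ ν ≤ r := by
  obtain ⟨γ, hγ, hcpl, hae⟩ := h
  have hp0 : 0 < p := by linarith
  have h1 : (∫ x, ‖x.1 - x.2‖ ^ p ∂γ) ≤ r ^ p := by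
    have h2 := integral_mono_of_nonneg (μ := γ) (f := fun x => ‖x.1 - x.2‖ ^ p)
      (g := fun _ => r ^ p) (ae_of_all _ fun x => by positivity) (integrable_const _)
      (by filter_upwards [hae] with x hx; exact Real.rpow_le_rpow (norm_nonneg _) hx hp0.le)
    simpa using h2
  have h3 : (∫ x, ‖x.1 - x.2‖ ^ p ∂γ) ^ (1 / p) ≤ r := by
    calc (∫ x, ‖x.1 - x.2‖ ^ p ∂γ) ^ (1 / p) ≤ (r ^ p) ^ (1 / p) :=
          Real.rpow_le_rpow (integral_nonneg fun x => by positivity) h1 (by positivity)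
      _ = r := by rw [← Real.rpow_mul hr, mul_one_div_cancel hp0.ne', Real.rpow_one]
  unfold Wp
  refine csInf_le_of_le ⟨0, ?_⟩ ⟨γ, hcpl, rfl⟩ h3
  rintro _ ⟨γ', -, rfl⟩
  exact Real.rpow_nonneg (integral_nonneg fun x => by positivity) _

lemma HasCpl.winf_le {n : ℕ} {μ ν : Measure (EV n)} {r : ℝ} (h : HasCpl μ ν r) (hr : 0 ≤ r) :
    Winf (fun x y => ‖x - y‖) μ ν ≤ r := by
  obtain ⟨γ, hγ, hcpl, hae⟩ := h
  have h1 : essSup (fun x : EV n × EV n => ENNReal.ofReal ‖x.1 - x.2‖) γ ≤ ENNReal.ofReal r :=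
    essSup_le_of_ae_le _ (by
      filter_upwards [hae] with x hx; exact ENNReal.ofReal_le_ofReal hx)
  unfold Winf
  refine csInf_le_of_le ⟨0, ?_⟩ ⟨γ, hcpl, rfl⟩ (ENNReal.toReal_le_of_le_ofReal hr h1)
  rintro _ ⟨γ', -, rfl⟩
  exact ENNReal.toReal_nonneg

theorem stmt13 {d n : ℕ} (A : Matrix (Fin n) (Fin d) ℝ) (U : EV n → ℝ)
    (m ρ : ℝ) (hρ : 0 < ρ) (hm : 0 ≤ m)
    -- well-definedness of the densities: U bounded below (and convex, from (A4))
    (hbdd : BddBelow (Set.range U))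
    -- (A4): U is m-strongly convex
    (hsc : ConvexOn ℝ Set.univ fun z => U z - m / 2 * ‖z‖ ^ 2)
    (θ θ' : EV d) :
    (∀ p : ℝ, 1 ≤ p →
      Wp p (fun x y => ‖x - y‖)
          (densMeasure fun z : EV n => Real.exp (-U z - ‖z - mvec A θ‖ ^ 2 / (2 * ρ ^ 2)))
          (densMeasure fun z : EV n => Real.exp (-U z - ‖z - mvec A θ'‖ ^ 2 / (2 * ρ ^ 2))) ≤
        ‖mvec A (θ - θ')‖ / (1 + ρ ^ 2 * m)) ∧
    Winf (fun x y => ‖x - y‖)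
        (densMeasure fun z : EV n => Real.exp (-U z - ‖z - mvec A θ‖ ^ 2 / (2 * ρ ^ 2)))
        (densMeasure fun z : EV n => Real.exp (-U z - ‖z - mvec A θ'‖ ^ 2 / (2 * ρ ^ 2))) ≤
      ‖mvec A (θ - θ')‖ / (1 + ρ ^ 2 * m) := by
  obtain ⟨c, hc⟩ := hbdd
  have hc' : ∀ z, c ≤ U z := fun z => hc ⟨z, rfl⟩
  have hU : Continuous U := by
    have h1 : Continuous fun z : EV n => U z - m / 2 * ‖z‖ ^ 2 :=
      continuousOn_univ.1 (hsc.continuousOn isOpen_univ)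
    have h2 : Continuous fun z : EV n => (U z - m / 2 * ‖z‖ ^ 2) + m / 2 * ‖z‖ ^ 2 := by fun_prop
    simpa using h2
  have hA : mvec A (θ - θ') = mvec A θ - mvec A θ' := by
    simp [mvec, Matrix.mulVec_sub]
  have hneg : ∀ t : EV d, (fun z : EV n => Real.exp (-U z - ‖z - mvec A t‖ ^ 2 / (2 * ρ ^ 2)))
      = fun z => Real.exp (-(U z + ‖z - mvec A t‖ ^ 2 / (2 * ρ ^ 2))) := fun t => by
    funext z; congr 1; ring
  rw [hneg θ, hneg θ', hA]
  have h0 : 0 ≤ ‖mvec A θ - mvec A θ'‖ / (1 + ρ ^ 2 * m) := by positivity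
  have key := fun (r : ℝ) (hr : ‖mvec A θ - mvec A θ'‖ / (1 + ρ ^ 2 * m) < r) =>
    main_cpl hρ hm hc' hU hsc (mvec A θ) (mvec A θ') hr
  refine ⟨fun p hp => le_of_forall_gt_imp_ge_of_dense fun r hr => ?_,
    le_of_forall_gt_imp_ge_of_dense fun r hr => ?_⟩
  · exact (key r hr).wp_le (h0.trans hr.le) hp
  · exact (key r hr).winf_le (h0.trans hr.le)

end
end

section
/- Let u, v ∈ ℝ^d with ‖v‖ ≤ ‖u‖. Then there exists a symmetric matrix W ∈ ℝ^{d×d} such that Wu = v and −I ⪯ W ⪯ I in the Loewner partial order (i.e. both I − W and W + I are positive semidefinite). -/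
/-!
STATEMENT 14: For u, v ∈ ℝ^d with ‖v‖ ≤ ‖u‖ (Euclidean norms), there is a symmetric
matrix W with Wu = v and −I ⪯ W ⪯ I (Loewner order).
-/

open Matrix

noncomputable section

theorem aux_reflect {d : ℕ} (u p : Fin d → ℝ) (h : p ⬝ᵥ p = u ⬝ᵥ u) (r : ℝ) (h0 : 0 ≤ r)
    (h1 : r ≤ 1) :
    ∃ W : Matrix (Fin d) (Fin d) ℝ, W.IsSymm ∧ W *ᵥ u = r • p ∧
      ((1 : Matrix (Fin d) (Fin d) ℝ) - W).PosSemidef ∧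
      (W + (1 : Matrix (Fin d) (Fin d) ℝ)).PosSemidef := by
  obtain ⟨w, hw⟩ : ∃ w, w = u - p := ⟨_, rfl⟩
  have hs : (vecMulVec w w)ᵀ = vecMulVec w w := by
    ext i j
    simp [vecMulVec_apply, mul_comm]
  have hn : 0 ≤ w ⬝ᵥ w := by
    simpa using dotProduct_star_self_nonneg w
  let W : Matrix (Fin d) (Fin d) ℝ := r • (1 - (2 / (w ⬝ᵥ w)) • vecMulVec w w)
  have hWs : Wᵀ = W := by
    simp [W, hs]
  have hWx : ∀ x, W *ᵥ x = r • (x - (2 / (w ⬝ᵥ w) * (w ⬝ᵥ x)) • w) := by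
    intro x
    simp only [W, smul_mulVec, sub_mulVec, one_mulVec, vecMulVec_mulVec, mul_smul]
    simp
  have hq : ∀ x, x ⬝ᵥ (W *ᵥ x) = r * (x ⬝ᵥ x - 2 * ((w ⬝ᵥ x) ^ 2 / (w ⬝ᵥ w))) := by
    intro x
    rw [hWx]
    simp only [dotProduct_smul, dotProduct_sub, smul_eq_mul, dotProduct_comm x w]
    ring
  have hx0 : ∀ x : Fin d → ℝ, 0 ≤ x ⬝ᵥ x := fun x => by
    simpa using dotProduct_star_self_nonneg x
  have hcs : ∀ x, (w ⬝ᵥ x) ^ 2 / (w ⬝ᵥ w) ≤ x ⬝ᵥ x := by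
    intro x
    apply div_le_of_le_mul₀ hn (hx0 x)
    have := Finset.sum_mul_sq_le_sq_mul_sq Finset.univ w x
    simp only [dotProduct, ← pow_two]
    linarith
  have hd0 : ∀ x, 0 ≤ (w ⬝ᵥ x) ^ 2 / (w ⬝ᵥ w) := fun x => by positivity
  refine ⟨W, hWs, ?_, ?_, ?_⟩
  · rw [hWx]
    congr 1
    by_cases hz : w ⬝ᵥ w = 0
    · have : w = 0 := dotProduct_self_eq_zero.mp hz
      rw [this] at hw ⊢
      simpa using (sub_eq_zero.mp hw.symm)
    · have e : w ⬝ᵥ w = 2 * (w ⬝ᵥ u) := by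
        rw [hw]
        simp only [dotProduct_sub, sub_dotProduct, dotProduct_comm p u, h]
        ring
      have : 2 / (w ⬝ᵥ w) * (w ⬝ᵥ u) = 1 := by
        rw [div_mul_eq_mul_div, ← e, div_self hz]
      rw [this, hw]
      simp
  · refine PosSemidef.of_dotProduct_mulVec_nonneg ?_ ?_
    · simp [IsHermitian, conjTranspose_eq_transpose_of_trivial, hWs]
    · intro x
      simp only [star_trivial, sub_mulVec, one_mulVec, dotProduct_sub, hq]
      nlinarith [hx0 x, hd0 x, mul_nonneg h0 (hd0 x), mul_nonneg (sub_nonneg.2 h1) (hx0 x)]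
  · refine PosSemidef.of_dotProduct_mulVec_nonneg ?_ ?_
    · simp [IsHermitian, conjTranspose_eq_transpose_of_trivial, hWs]
    · intro x
      simp only [star_trivial, add_mulVec, one_mulVec, dotProduct_add, hq]
      nlinarith [hx0 x, mul_nonneg h0 (sub_nonneg.2 (hcs x)),
        mul_nonneg (sub_nonneg.2 h1) (hx0 x)]

theorem stmt14 {d : ℕ} (u v : EV d) (h : ‖v‖ ≤ ‖u‖) :
    ∃ W : Matrix (Fin d) (Fin d) ℝ, W.IsSymm ∧ mvec W u = v ∧
      ((1 : Matrix (Fin d) (Fin d) ℝ) - W).PosSemidef ∧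
      (W + (1 : Matrix (Fin d) (Fin d) ℝ)).PosSemidef := by
  have hnorm : ∀ x : EV d, x.ofLp ⬝ᵥ x.ofLp = ‖x‖ ^ 2 := by
    intro x
    rw [EuclideanSpace.real_norm_sq_eq]
    simp [dotProduct, pow_two]
  by_cases hv : v = 0
  · refine ⟨0, by simp [IsSymm], by simp [mvec, hv], ?_, ?_⟩
    · simpa using PosSemidef.one
    · simpa using PosSemidef.one
  have hv0 : 0 < ‖v‖ := norm_pos_iff.2 hv
  have hu0 : 0 < ‖u‖ := hv0.trans_le h
  obtain ⟨W, a, b, c⟩ := aux_reflect u.ofLp ((‖u‖ / ‖v‖) • v.ofLp) (by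
    rw [dotProduct_smul, smul_dotProduct, hnorm v, hnorm u, smul_eq_mul, smul_eq_mul]
    field_simp) (‖v‖ / ‖u‖) (by positivity) ((div_le_one hu0).2 h)
  refine ⟨W, a, ?_, c⟩
  have e : ‖v‖ / ‖u‖ * (‖u‖ / ‖v‖) = 1 := by field_simp
  rw [smul_smul, e, one_smul] at b
  ext i
  exact congrFun b i

end
end

section
/- Fix ρ > 0 and define, for 1 ≤ i ≤ b, U_i^ρ(u) = −log ∫_{ℝ^{d_i}} exp(−U_i(z) − ‖z − u‖²/(2ρ²))·(2πρ²)^{−d_i/2} dz and U^ρ(θ) = Σ_i U_i^ρ(A_iθ). Let B̄(θ) = (ρ²/2)Σ_{i=1}^b‖∇U_i(A_iθ)‖² and B̲(θ) = Σ_{i=1}^b [ ρ²‖∇U_i(A_iθ)‖²/(2(1+ρ²M_i)) − (d_i/2)·log(1 + ρ²M_i) ]. Then: (i) under Assumptions (A0) and (A2), B̲(θ) ≤ U(θ) − U^ρ(θ) for all θ ∈ ℝ^d; and (ii) under Assumptions (A0), (A2) and (A4), U(θ) − U^ρ(θ) ≤ B̄(θ) for all θ ∈ ℝ^d. -/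
/-!
STATEMENT 15: With U_i^ρ the Gaussian smoothing of U_i, U^ρ(θ) = Σᵢ U_i^ρ(A_iθ),
B̄(θ) = (ρ²/2)Σᵢ‖∇Uᵢ(Aᵢθ)‖² and
B̲(θ) = Σᵢ[ρ²‖∇Uᵢ(Aᵢθ)‖²/(2(1+ρ²Mᵢ)) − (dᵢ/2)log(1+ρ²Mᵢ)]:
(i) under (A0), (A2): B̲(θ) ≤ U(θ) − U^ρ(θ);
(ii) under (A0), (A2), (A4): U(θ) − U^ρ(θ) ≤ B̄(θ).
-/

open MeasureTheory Matrix
open scoped ENNReal BigOperators RealInnerProductSpace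

noncomputable section

/-- The potential `U_i^ρ` obtained by Gaussian smoothing of `U`. -/
def Uirho {n : ℕ} (U : EV n → ℝ) (ρ : ℝ) (u : EV n) : ℝ :=
  -Real.log (∫ z : EV n,
    Real.exp (-U z - ‖z - u‖ ^ 2 / (2 * ρ ^ 2)) / (2 * Real.pi * ρ ^ 2) ^ ((n : ℝ) / 2))

/-- Real Gaussian integral with linear term, together with integrability. -/
theorem gauss_aux {n : ℕ} (a : ℝ) (ha : 0 < a) (g : EV n) :
    Integrable (fun v : EV n => Real.exp (-a * ‖v‖ ^ 2 - ⟪g, v⟫)) ∧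
    ∫ v : EV n, Real.exp (-a * ‖v‖ ^ 2 - ⟪g, v⟫) =
      (Real.pi / a) ^ ((n : ℝ) / 2) * Real.exp (‖g‖ ^ 2 / (4 * a)) := by
  have key : ∀ v : EV n, Complex.exp (-(a : ℂ) * (‖v‖ : ℂ) ^ 2 + (-1 : ℂ) * ((⟪g, v⟫ : ℝ) : ℂ)) =
      ((Real.exp (-a * ‖v‖ ^ 2 - ⟪g, v⟫) : ℝ) : ℂ) := by
    intro v
    push_cast
    congr 1
    ring
  have hre : 0 < (a : ℂ).re := by simpa using ha
  constructor
  · have h := GaussianFourier.integrable_cexp_neg_mul_sq_norm_add hre (-1) g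
    have h2 := h.re
    refine h2.congr (Filter.Eventually.of_forall fun v => ?_)
    have := congrArg Complex.re (key v)
    simpa only [Complex.ofReal_re] using! this
  · have h := GaussianFourier.integral_cexp_neg_mul_sq_norm_add hre (-1) g
    have h3 : (∫ v : EV n, Complex.exp (-(a : ℂ) * (‖v‖ : ℂ) ^ 2 +
        (-1 : ℂ) * ((⟪g, v⟫ : ℝ) : ℂ))) =
        ((∫ v : EV n, Real.exp (-a * ‖v‖ ^ 2 - ⟪g, v⟫) : ℝ) : ℂ) := by
      rw [← integral_complex_ofReal]
      exact integral_congr_ae (Filter.Eventually.of_forall key)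
    apply Complex.ofReal_injective
    rw [← h3]
    refine h.trans ?_
    rw [finrank_euclideanSpace_fin]
    push_cast
    rw [Complex.ofReal_cpow (by positivity)]
    push_cast
    norm_num

theorem line_hasDerivAt {n : ℕ} {U : EV n → ℝ} (hC2 : ContDiff ℝ 2 U) (u w : EV n) (t : ℝ) :
    HasDerivAt (fun t : ℝ => U (u + t • w)) ⟪gradient U (u + t • w), w⟫ t := by
  have hl : HasDerivAt (fun t : ℝ => u + t • w) w t := by
    simpa using ((hasDerivAt_id t).smul_const w).const_add u
  have hU : HasFDerivAt U (fderiv ℝ U (u + t • w)) (u + t • w) :=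
    ((hC2.differentiable (by norm_num)) _).hasFDerivAt
  have := hU.comp_hasDerivAt t hl
  rw [inner_gradient_left]
  exact this

theorem line_hasDerivAt2 {n : ℕ} {U : EV n → ℝ} (hC2 : ContDiff ℝ 2 U) (u w : EV n) (t : ℝ) :
    HasDerivAt (fun t : ℝ => ⟪gradient U (u + t • w), w⟫)
      ⟪w, fderiv ℝ (gradient U) (u + t • w) w⟫ t := by
  have hl : HasDerivAt (fun t : ℝ => u + t • w) w t := by
    simpa using ((hasDerivAt_id t).smul_const w).const_add u
  have hg : Differentiable ℝ (gradient U) := by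
    have h1 : Differentiable ℝ (fderiv ℝ U) :=
      (hC2.fderiv_right (m := 1) (by norm_num)).differentiable (by norm_num)
    exact (InnerProductSpace.toDual ℝ (EV n)).symm.toContinuousLinearEquiv.differentiable.comp h1
  have h2 := (hg (u + t • w)).hasFDerivAt.comp_hasDerivAt t hl
  have h3 := h2.inner ℝ (hasDerivAt_const t w)
  simp only [inner_zero_right, zero_add] at h3
  rw [real_inner_comm]
  exact h3

theorem quad_upper {n : ℕ} {U : EV n → ℝ} {M : ℝ} (hC2 : ContDiff ℝ 2 U)
    (hH : ∀ z v : EV n, |⟪v, fderiv ℝ (gradient U) z v⟫| ≤ M * ‖v‖ ^ 2) (u w : EV n) :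
    U (u + w) ≤ U u + ⟪gradient U u, w⟫ + M / 2 * ‖w‖ ^ 2 := by
  have hanti1 : Antitone (fun t : ℝ => ⟪gradient U (u + t • w), w⟫ - t * (M * ‖w‖ ^ 2)) := by
    have hd : ∀ t : ℝ, HasDerivAt
        (fun t : ℝ => ⟪gradient U (u + t • w), w⟫ - t * (M * ‖w‖ ^ 2))
        (⟪w, fderiv ℝ (gradient U) (u + t • w) w⟫ - 1 * (M * ‖w‖ ^ 2)) t := fun t =>
      (line_hasDerivAt2 hC2 u w t).sub ((hasDerivAt_id t).mul_const _)
    refine antitone_of_deriv_nonpos (fun t => (hd t).differentiableAt) fun t => ?_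
    rw [(hd t).deriv]
    have := (abs_le.mp (hH (u + t • w) w)).2
    linarith
  have hanti2 : AntitoneOn (fun t : ℝ => U (u + t • w) - t * ⟪gradient U u, w⟫ -
      t ^ 2 * (M / 2 * ‖w‖ ^ 2)) (Set.Ici 0) := by
    have hd : ∀ t : ℝ, HasDerivAt
        (fun t : ℝ => U (u + t • w) - t * ⟪gradient U u, w⟫ - t ^ 2 * (M / 2 * ‖w‖ ^ 2))
        (⟪gradient U (u + t • w), w⟫ - 1 * ⟪gradient U u, w⟫ -
          (2 * t) * (M / 2 * ‖w‖ ^ 2)) t := fun t => by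
      have hp : HasDerivAt (fun t : ℝ => t ^ 2) (2 * t) t := by
        simpa using hasDerivAt_pow 2 t
      exact ((line_hasDerivAt hC2 u w t).sub ((hasDerivAt_id t).mul_const _)).sub
        (hp.mul_const _)
    refine antitoneOn_of_deriv_nonpos (convex_Ici 0)
      (fun t _ => (hd t).continuousAt.continuousWithinAt)
      (fun t _ => (hd t).differentiableAt.differentiableWithinAt) fun t ht => ?_
    rw [interior_Ici] at ht
    rw [(hd t).deriv]
    have := hanti1 (le_of_lt ht : (0 : ℝ) ≤ t)
    simp only [zero_smul, add_zero, zero_mul, sub_zero] at this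
    linarith
  have h01 := hanti2 (Set.mem_Ici.mpr le_rfl) (Set.mem_Ici.mpr zero_le_one)
    (zero_le_one : (0 : ℝ) ≤ 1)
  simp only [zero_smul, one_smul, add_zero, zero_mul, sub_zero, one_pow, one_mul, ne_eq,
    OfNat.ofNat_ne_zero, not_false_eq_true, zero_pow] at h01
  linarith

theorem convex_lower {n : ℕ} {U : EV n → ℝ} (hC2 : ContDiff ℝ 2 U)
    (hc : ConvexOn ℝ Set.univ U) (u w : EV n) :
    U u + ⟪gradient U u, w⟫ ≤ U (u + w) := by
  have h1 : ConvexOn ℝ Set.univ (fun t : ℝ => U (u + t • w)) := by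
    have h := hc.comp_affineMap (AffineMap.lineMap u (u + w) : ℝ →ᵃ[ℝ] EV n)
    rw [Set.preimage_univ] at h
    refine h.congr fun t _ => ?_
    simp [AffineMap.lineMap_apply, add_comm]
  have h2 := h1.le_slope_of_hasDerivAt (Set.mem_univ 0) (Set.mem_univ 1) zero_lt_one
    (line_hasDerivAt hC2 u w 0)
  simp [slope_def_field] at h2
  rw [inner_gradient_left]
  linarith

theorem strong_convex {n : ℕ} {U : EV n → ℝ} {m : ℝ} (hm : 0 ≤ m)
    (hc : ConvexOn ℝ Set.univ fun z => U z - m / 2 * ‖z‖ ^ 2) : ConvexOn ℝ Set.univ U := by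
  have h1 : ConvexOn ℝ Set.univ (fun z : EV n => m / 2 * ‖z‖ ^ 2) := by
    have h := (convexOn_univ_norm (E := EV n)).pow (fun _ _ => norm_nonneg _) 2
    exact h.smul (by positivity : 0 ≤ m / 2)
  have h2 := hc.add h1
  refine h2.congr fun z _ => ?_
  simp

/-- The comparison Gaussian centred at `u`. -/
theorem gauss_shift {n : ℕ} (a ρ c : ℝ) (ha : 0 < a) (hρ : 0 < ρ) (g u : EV n) :
    Integrable (fun z : EV n => Real.exp (-c - ⟪g, z - u⟫ - a * ‖z - u‖ ^ 2) /
      (2 * Real.pi * ρ ^ 2) ^ ((n : ℝ) / 2)) ∧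
    ∫ z : EV n, Real.exp (-c - ⟪g, z - u⟫ - a * ‖z - u‖ ^ 2) /
      (2 * Real.pi * ρ ^ 2) ^ ((n : ℝ) / 2) =
      Real.exp (-c + ‖g‖ ^ 2 / (4 * a) - (n : ℝ) / 2 * Real.log (2 * ρ ^ 2 * a)) := by
  obtain ⟨hi, he⟩ := gauss_aux a ha g
  have heq : ∀ z : EV n, Real.exp (-c - ⟪g, z - u⟫ - a * ‖z - u‖ ^ 2) /
      (2 * Real.pi * ρ ^ 2) ^ ((n : ℝ) / 2) =
      (Real.exp (-c) / (2 * Real.pi * ρ ^ 2) ^ ((n : ℝ) / 2)) *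
        Real.exp (-a * ‖z - u‖ ^ 2 - ⟪g, z - u⟫) := by
    intro z
    rw [div_mul_eq_mul_div, ← Real.exp_add]
    congr 2
    ring
  simp only [heq]
  refine ⟨(hi.comp_sub_right u).const_mul _, ?_⟩
  rw [integral_const_mul, integral_sub_right_eq_self
    (fun v : EV n => Real.exp (-a * ‖v‖ ^ 2 - ⟪g, v⟫)) u, he]
  have hπ := Real.pi_pos
  rw [Real.rpow_def_of_pos (by positivity), Real.rpow_def_of_pos (by positivity),
    ← Real.exp_sub, ← Real.exp_add, ← Real.exp_add]
  congr 1
  have e1 : Real.log (2 * Real.pi * ρ ^ 2) = Real.log (2 * ρ ^ 2 * a) + Real.log (Real.pi / a) := by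
    rw [← Real.log_mul (by positivity) (by positivity)]
    congr 1
    field_simp
  rw [e1]
  ring

theorem F_integrable {n : ℕ} {U : EV n → ℝ} (hb : BddBelow (Set.range U)) (hU : Continuous U)
    (ρ : ℝ) (hρ : 0 < ρ) (u : EV n) :
    Integrable (fun z : EV n => Real.exp (-U z - ‖z - u‖ ^ 2 / (2 * ρ ^ 2)) /
      (2 * Real.pi * ρ ^ 2) ^ ((n : ℝ) / 2)) := by
  obtain ⟨K, hK⟩ := hb
  have hπ := Real.pi_pos
  refine (gauss_shift (1 / (2 * ρ ^ 2)) ρ K (by positivity) hρ 0 u).1.mono'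
    (Continuous.aestronglyMeasurable (by fun_prop)) (Filter.Eventually.of_forall fun z => ?_)
  rw [Real.norm_of_nonneg (by positivity)]
  have hz : K ≤ U z := hK ⟨z, rfl⟩
  refine div_le_div_of_nonneg_right (Real.exp_le_exp.mpr ?_) (by positivity)
  rw [inner_zero_left, div_eq_inv_mul, one_div]
  linarith

theorem lower_single {n : ℕ} {U : EV n → ℝ} {M : ℝ} (hM : 0 ≤ M)
    (hb : BddBelow (Set.range U)) (hC2 : ContDiff ℝ 2 U)
    (hH : ∀ z v : EV n, |⟪v, fderiv ℝ (gradient U) z v⟫| ≤ M * ‖v‖ ^ 2)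
    (ρ : ℝ) (hρ : 0 < ρ) (u : EV n) :
    Real.exp (-U u + (ρ ^ 2 * ‖gradient U u‖ ^ 2 / (2 * (1 + ρ ^ 2 * M)) -
      (n : ℝ) / 2 * Real.log (1 + ρ ^ 2 * M))) ≤
    ∫ z : EV n, Real.exp (-U z - ‖z - u‖ ^ 2 / (2 * ρ ^ 2)) /
      (2 * Real.pi * ρ ^ 2) ^ ((n : ℝ) / 2) := by
  have hπ := Real.pi_pos
  obtain ⟨hi, he⟩ := gauss_shift ((1 + ρ ^ 2 * M) / (2 * ρ ^ 2)) ρ (U u) (by positivity) hρ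
    (gradient U u) u
  have e1 : 2 * ρ ^ 2 * ((1 + ρ ^ 2 * M) / (2 * ρ ^ 2)) = 1 + ρ ^ 2 * M := by field_simp
  have hpos : 0 < 1 + ρ ^ 2 * M := by positivity
  have e2 : ‖gradient U u‖ ^ 2 / (4 * ((1 + ρ ^ 2 * M) / (2 * ρ ^ 2))) =
      ρ ^ 2 * ‖gradient U u‖ ^ 2 / (2 * (1 + ρ ^ 2 * M)) := by
    field_simp
    norm_num
  rw [e1, e2, add_sub_assoc] at he
  rw [← he]
  refine integral_mono hi (F_integrable hb hC2.continuous ρ hρ u) fun z => ?_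
  refine div_le_div_of_nonneg_right (Real.exp_le_exp.mpr ?_) (by positivity)
  have hq := quad_upper hC2 hH u (z - u)
  rw [add_sub_cancel] at hq
  have e3 : (1 + ρ ^ 2 * M) / (2 * ρ ^ 2) * ‖z - u‖ ^ 2 =
      ‖z - u‖ ^ 2 / (2 * ρ ^ 2) + M / 2 * ‖z - u‖ ^ 2 := by field_simp
  rw [e3]
  linarith

theorem upper_single {n : ℕ} {U : EV n → ℝ}
    (hb : BddBelow (Set.range U)) (hC2 : ContDiff ℝ 2 U)
    (hc : ConvexOn ℝ Set.univ U) (ρ : ℝ) (hρ : 0 < ρ) (u : EV n) :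
    ∫ z : EV n, Real.exp (-U z - ‖z - u‖ ^ 2 / (2 * ρ ^ 2)) /
      (2 * Real.pi * ρ ^ 2) ^ ((n : ℝ) / 2) ≤
    Real.exp (-U u + ρ ^ 2 / 2 * ‖gradient U u‖ ^ 2) := by
  have hπ := Real.pi_pos
  obtain ⟨hi, he⟩ := gauss_shift (1 / (2 * ρ ^ 2)) ρ (U u) (by positivity) hρ
    (gradient U u) u
  have e1 : 2 * ρ ^ 2 * (1 / (2 * ρ ^ 2)) = 1 := by field_simp
  have e2 : ‖gradient U u‖ ^ 2 / (4 * (1 / (2 * ρ ^ 2))) =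
      ρ ^ 2 / 2 * ‖gradient U u‖ ^ 2 := by
    field_simp
    norm_num
  rw [e1, e2, Real.log_one, mul_zero, sub_zero] at he
  rw [← he]
  refine integral_mono (F_integrable hb hC2.continuous ρ hρ u) hi fun z => ?_
  refine div_le_div_of_nonneg_right (Real.exp_le_exp.mpr ?_) (by positivity)
  have hq := convex_lower hC2 hc u (z - u)
  rw [add_sub_cancel] at hq
  rw [one_div, ← div_eq_inv_mul]
  linarith

theorem stmt15 {d b : ℕ} (hd : 0 < d) (hb : 0 < b)
    (dd : Fin b → ℕ) (hdd : ∀ i, 0 < dd i)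
    (A : ∀ i, Matrix (Fin (dd i)) (Fin d) ℝ) (U : ∀ i, EV (dd i) → ℝ)
    (M m : Fin b → ℝ) (ρ : ℝ) (hρ : 0 < ρ)
    -- (A0)
    (hA0bdd : ∀ j, BddBelow (Set.range (U j)))
    (hA0 : ∃ i, ∃ h : dd i = d,
      IsUnit (Matrix.det (Matrix.reindex (finCongr h) (Equiv.refl (Fin d)) (A i))) ∧
      Integrable fun z : EV (dd i) => Real.exp (-U i z))
    -- (A2): each Uᵢ is C² with −Mᵢ I ⪯ ∇²Uᵢ ⪯ Mᵢ I
    (hC2 : ∀ i, ContDiff ℝ 2 (U i))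
    (hHess : ∀ i (z v : EV (dd i)), |⟪v, fderiv ℝ (gradient (U i)) z v⟫| ≤ M i * ‖v‖ ^ 2) :
    -- (i): lower bound  B̲(θ) ≤ U(θ) − U^ρ(θ)
    (∀ θ : EV d,
      (∑ i, (ρ ^ 2 * ‖gradient (U i) (mvec (A i) θ)‖ ^ 2 / (2 * (1 + ρ ^ 2 * M i)) -
          (dd i : ℝ) / 2 * Real.log (1 + ρ ^ 2 * M i))) ≤
        (∑ i, U i (mvec (A i) θ)) - ∑ i, Uirho (U i) ρ (mvec (A i) θ)) ∧
    -- (ii): under (A4), upper bound  U(θ) − U^ρ(θ) ≤ B̄(θ)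
    ((∀ i, 0 ≤ m i) →
      (∀ i, ConvexOn ℝ Set.univ fun z => U i z - m i / 2 * ‖z‖ ^ 2) →
      ∀ θ : EV d,
        (∑ i, U i (mvec (A i) θ)) - (∑ i, Uirho (U i) ρ (mvec (A i) θ)) ≤
          ρ ^ 2 / 2 * ∑ i, ‖gradient (U i) (mvec (A i) θ)‖ ^ 2) := by
  have hM : ∀ i, 0 ≤ M i := by
    intro i
    have h := hHess i 0 (EuclideanSpace.single ⟨0, hdd i⟩ (1 : ℝ))
    have h2 := (abs_nonneg _).trans h
    simpa using h2
  have hlow := fun i (u : EV (dd i)) =>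
    lower_single (hM i) (hA0bdd i) (hC2 i) (hHess i) ρ hρ u
  constructor
  · intro θ
    rw [← Finset.sum_sub_distrib]
    refine Finset.sum_le_sum fun i _ => ?_
    have h := hlow i (mvec (A i) θ)
    have h2 := (Real.le_log_iff_exp_le (lt_of_lt_of_le (Real.exp_pos _) h)).mpr h
    unfold Uirho
    linarith
  · intro hm hconv θ
    rw [← Finset.sum_sub_distrib, Finset.mul_sum]
    refine Finset.sum_le_sum fun i _ => ?_
    have h := hlow i (mvec (A i) θ)
    have h1 := upper_single (hA0bdd i) (hC2 i) (strong_convex (hm i) (hconv i)) ρ hρ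
      (mvec (A i) θ)
    have h2 := (Real.log_le_iff_le_exp (lt_of_lt_of_le (Real.exp_pos _) h)).mpr h1
    unfold Uirho
    linarith


end
end

section
/- Suppose Assumptions (A2) and (A4) hold. Define β(θ) = (Σ_{i=1}^b ‖∇U_i(A_iθ)‖²)^{1/2} for θ ∈ ℝ^d, and let A ∈ ℝ^{(d_1+…+d_b)×d} be the matrix obtained by stacking A_1,…,A_b one upon another. Then β is Lipschitz with respect to the Euclidean distance with Lipschitz constant L_β = ‖AᵀA‖^{1/2}·max_{i≤b} M_i, where ‖·‖ is the spectral norm. -/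
/-!
STATEMENT 16: Under (A2) and (A4), the function β(θ) = (Σᵢ‖∇Uᵢ(Aᵢθ)‖²)^{1/2} is
Lipschitz with constant L_β = ‖AᵀA‖^{1/2}·maxᵢ Mᵢ, where A is the stacked matrix
and ‖·‖ the spectral norm.
-/

open MeasureTheory Matrix
open scoped RealInnerProductSpace BigOperators

noncomputable section

/-- Spectral (ℓ²-operator) norm of a matrix. -/
def specNorm {m n : Type*} [Fintype m] [Fintype n] [DecidableEq n]
    (A : Matrix m n ℝ) : ℝ :=
  ‖LinearMap.toContinuousLinearMap (Matrix.toEuclideanLin A)‖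

/-- The matrix obtained by stacking `A 1, …, A b` one upon another. -/
def stacked {d b : ℕ} (dd : Fin b → ℕ) (A : ∀ i, Matrix (Fin (dd i)) (Fin d) ℝ) :
    Matrix ((i : Fin b) × Fin (dd i)) (Fin d) ℝ :=
  Matrix.of fun p j => A p.1 p.2 j

lemma aux_op {E : Type*} [NormedAddCommGroup E] [InnerProductSpace ℝ E] (T : E →L[ℝ] E) (M : ℝ)
    (hs : ∀ u v : E, ⟪u, T v⟫ = ⟪v, T u⟫) (hq : ∀ v : E, |⟪v, T v⟫| ≤ M * ‖v‖ ^ 2) (v : E) :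
    ‖T v‖ ≤ M * ‖v‖ := by
  have key : ∀ u v : E, 4 * ⟪u, T v⟫ ≤ M * (2 * ‖u‖ ^ 2 + 2 * ‖v‖ ^ 2) := by
    intro u v
    have h1 := (abs_le.1 (hq (u + v))).2
    have h2 := (abs_le.1 (hq (u - v))).1
    have h3 := parallelogram_law_with_norm ℝ u v
    simp only [map_add, map_sub, inner_add_left, inner_add_right, inner_sub_left,
      inner_sub_right] at h1 h2
    have h4 := hs u v
    have h5 : M * (2 * ‖u‖ ^ 2 + 2 * ‖v‖ ^ 2) = M * ‖u + v‖ ^ 2 + M * ‖u - v‖ ^ 2 := by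
      linear_combination (-M) * h3
    linarith
  by_cases hv : v = 0
  · simp [hv]
  have hv' : 0 < ‖v‖ := norm_pos_iff.2 hv
  by_cases hT : T v = 0
  · have h := (abs_nonneg _).trans (hq v)
    rw [hT, norm_zero]
    by_contra hc
    nlinarith
  have hT' : 0 < ‖T v‖ := norm_pos_iff.2 hT
  have h := key ((‖v‖ / ‖T v‖) • T v) v
  rw [real_inner_smul_left, real_inner_self_eq_norm_sq, norm_smul, Real.norm_of_nonneg (by positivity),
    div_mul_cancel₀ _ hT'.ne'] at h
  have h6 : ‖v‖ / ‖T v‖ * ‖T v‖ ^ 2 = ‖v‖ * ‖T v‖ := by field_simp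
  rw [h6] at h
  nlinarith

lemma aux_lip {E : Type*} [NormedAddCommGroup E] [InnerProductSpace ℝ E] [CompleteSpace E]
    (U : E → ℝ) (M : ℝ) (hM : 0 ≤ M) (hC : ContDiff ℝ 2 U)
    (hH : ∀ z v : E, |⟪v, fderiv ℝ (gradient U) z v⟫| ≤ M * ‖v‖ ^ 2) (x y : E) :
    ‖gradient U x - gradient U y‖ ≤ M * ‖x - y‖ := by
  have hd : Differentiable ℝ (fderiv ℝ U) :=
    (hC.fderiv_right (m := 1) (by norm_num)).differentiable (by norm_num)
  let L : StrongDual ℝ E →L[ℝ] E :=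
    { toFun := fun f => (InnerProductSpace.toDual ℝ E).symm f
      map_add' := fun f g => map_add _ f g
      map_smul' := fun c f => by simp
      cont := (InnerProductSpace.toDual ℝ E).symm.continuous }
  have hg : ∀ z, HasFDerivAt (gradient U) (L.comp (fderiv ℝ (fderiv ℝ U) z)) z := by
    intro z
    exact L.hasFDerivAt.comp z (hd z).hasFDerivAt
  have hin : ∀ z u v, ⟪u, fderiv ℝ (gradient U) z v⟫ = fderiv ℝ (fderiv ℝ U) z v u := by
    intro z u v
    rw [(hg z).fderiv, real_inner_comm]
    exact InnerProductSpace.toDual_symm_apply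
  refine Convex.norm_image_sub_le_of_norm_fderiv_le (𝕜 := ℝ) (s := Set.univ)
    (fun z _ => (hg z).differentiableAt) (fun z _ => ?_) convex_univ trivial trivial
  refine ContinuousLinearMap.opNorm_le_bound _ hM (aux_op _ M ?_ (hH z))
  intro u v
  rw [hin, hin]
  exact (hC.contDiffAt.isSymmSndFDerivAt (by simp)) v u

lemma aux_tri {b : ℕ} (dd : Fin b → ℕ) (f g : ∀ i, EV (dd i)) :
    |Real.sqrt (∑ i, ‖f i‖ ^ 2) - Real.sqrt (∑ i, ‖g i‖ ^ 2)| ≤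
      Real.sqrt (∑ i, ‖f i - g i‖ ^ 2) := by
  have h := abs_norm_sub_norm_le (WithLp.toLp 2 f : PiLp 2 fun i => EV (dd i)) (WithLp.toLp 2 g)
  simpa [PiLp.norm_eq_of_L2] using h

lemma aux_spec {d b : ℕ} (dd : Fin b → ℕ)
    (A : ∀ i, Matrix (Fin (dd i)) (Fin d) ℝ) (v : EV d) :
    ∑ i, ‖mvec (A i) v‖ ^ 2 ≤ specNorm ((stacked dd A)ᵀ * stacked dd A) * ‖v‖ ^ 2 := by
  have h1 : ∑ i, ‖mvec (A i) v‖ ^ 2 =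
      ⟪v, Matrix.toEuclideanLin ((stacked dd A)ᵀ * stacked dd A) v⟫ := by
    have : ⟪v, Matrix.toEuclideanLin ((stacked dd A)ᵀ * stacked dd A) v⟫ =
        (WithLp.ofLp v) ⬝ᵥ (((stacked dd A)ᵀ * stacked dd A) *ᵥ (WithLp.ofLp v)) := by
      simp [PiLp.inner_apply, dotProduct, Matrix.toLpLin_apply, mul_comm]
    rw [this, ← Matrix.mulVec_mulVec, Matrix.dotProduct_mulVec, Matrix.vecMul_transpose]
    simp only [dotProduct, Fintype.sum_sigma, EuclideanSpace.norm_sq_eq]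
    refine Finset.sum_congr rfl fun i _ => Finset.sum_congr rfl fun j _ => ?_
    rw [Real.norm_eq_abs, sq_abs, sq]
    rfl
  rw [h1]
  refine (real_inner_le_norm _ _).trans ?_
  have h2 := (LinearMap.toContinuousLinearMap
    (Matrix.toEuclideanLin ((stacked dd A)ᵀ * stacked dd A))).le_opNorm v
  have h3 := mul_le_mul_of_nonneg_left h2 (norm_nonneg v)
  refine h3.trans (le_of_eq ?_)
  unfold specNorm
  ring

theorem stmt16 {d b : ℕ} (hb : 0 < b) (dd : Fin b → ℕ)
    (A : ∀ i, Matrix (Fin (dd i)) (Fin d) ℝ) (U : ∀ i, EV (dd i) → ℝ)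
    (M m : Fin b → ℝ)
    -- (A2): each Uᵢ is C² with −Mᵢ I ⪯ ∇²Uᵢ ⪯ Mᵢ I
    (hC2 : ∀ i, ContDiff ℝ 2 (U i))
    (hHess : ∀ i (z v : EV (dd i)), |⟪v, fderiv ℝ (gradient (U i)) z v⟫| ≤ M i * ‖v‖ ^ 2)
    -- (A4): each Uᵢ is mᵢ-strongly convex (mᵢ ≥ 0)
    (hm : ∀ i, 0 ≤ m i)
    (hsc : ∀ i, ConvexOn ℝ Set.univ fun z => U i z - m i / 2 * ‖z‖ ^ 2)
    -- maxᵢ Mᵢ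
    (Mmax : ℝ) (hMmax : IsGreatest (Set.range M) Mmax) :
    ∀ x y : EV d,
      |Real.sqrt (∑ i, ‖gradient (U i) (mvec (A i) x)‖ ^ 2) -
          Real.sqrt (∑ i, ‖gradient (U i) (mvec (A i) y)‖ ^ 2)| ≤
        Real.sqrt (specNorm ((stacked dd A)ᵀ * stacked dd A)) * Mmax * ‖x - y‖ := by
  intro x y
  refine (aux_tri dd _ _).trans ?_
  have hle : ∀ i, M i ≤ Mmax := fun i => hMmax.2 ⟨i, rfl⟩
  by_cases h0 : ∀ i, dd i = 0
  · have hz : ∑ i, ‖gradient (U i) (mvec (A i) x) - gradient (U i) (mvec (A i) y)‖ ^ 2 = 0 := by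
      refine Finset.sum_eq_zero fun i _ => ?_
      haveI : IsEmpty (Fin (dd i)) := by rw [h0 i]; infer_instance
      haveI : Subsingleton (EV (dd i)) := inferInstance
      rw [Subsingleton.elim (gradient (U i) (mvec (A i) x)) (gradient (U i) (mvec (A i) y))]
      simp
    have hs : (stacked dd A)ᵀ * stacked dd A = 0 := by
      ext p q
      rw [Matrix.mul_apply]
      refine Finset.sum_eq_zero fun r _ => ?_
      exact absurd r.2.2 (by simp [h0 r.1])
    have hs' : specNorm ((stacked dd A)ᵀ * stacked dd A) = 0 := by
      rw [hs]; simp [specNorm]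
    rw [hz, hs']
    simp
  push Not at h0
  have hnn : ∀ i, dd i ≠ 0 → 0 ≤ M i := by
    intro i hi
    have h := (abs_nonneg _).trans
      (hHess i 0 (EuclideanSpace.single ⟨0, Nat.pos_of_ne_zero hi⟩ 1))
    simpa using h
  obtain ⟨i0, hi0⟩ := h0
  have hM0 : 0 ≤ Mmax := (hnn i0 hi0).trans (hle i0)
  have hsub : ∀ i, mvec (A i) x - mvec (A i) y = mvec (A i) (x - y) := by
    intro i
    simp [mvec, Matrix.mulVec_sub]
  have hb1 : ∑ i, ‖gradient (U i) (mvec (A i) x) - gradient (U i) (mvec (A i) y)‖ ^ 2 ≤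
      Mmax ^ 2 * (specNorm ((stacked dd A)ᵀ * stacked dd A) * ‖x - y‖ ^ 2) := by
    refine le_trans ?_ (mul_le_mul_of_nonneg_left (aux_spec dd A (x - y)) (sq_nonneg Mmax))
    rw [Finset.mul_sum]
    refine Finset.sum_le_sum fun i _ => ?_
    rw [← mul_pow, ← hsub]
    refine pow_le_pow_left₀ (norm_nonneg _) ?_ 2
    refine aux_lip (U i) Mmax hM0 (hC2 i) (fun z v => (hHess i z v).trans ?_) _ _
    exact mul_le_mul_of_nonneg_right (hle i) (sq_nonneg _)
  have hsn : 0 ≤ specNorm ((stacked dd A)ᵀ * stacked dd A) := norm_nonneg _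
  rw [Real.sqrt_le_left (by positivity)]
  refine hb1.trans (le_of_eq ?_)
  rw [mul_pow, mul_pow, Real.sq_sqrt hsn]
  ring

end
end
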